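/- Let (ΛV,d) be a formal elliptic minimal Sullivan algebra over Q with V^i = 0 for all i < r for some integer r ≥ 2, and let n be its formal dimension (the largest degree in which H^*(ΛV,d) is nonzero). Then dim_Q H^*(ΛV,d) ≤ 2^{n/r}. -/

import Mathlib

/-!
Commutative differential graded algebras over `ℚ`, (minimal) Sullivan algebras,
ellipticity and formality; cf. Amann–Zoller, "On the toral rank conjecture and
some consequences of new variants of formality".
-/

/-- A non-negatively graded commutative (in the graded sense) differential
graded algebra over `ℚ`. -/
structure CDGA : Type 1 where
  carrier : Type
  [ringStr : Ring carrier]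
  [algStr : Algebra ℚ carrier]
  /-- The grading, by `ℚ`-subspaces. -/
  grading : ℤ → Submodule ℚ carrier
  /-- The grading is an internal direct sum decomposition. -/
  internal : DirectSum.IsInternal grading
  one_mem : (1 : carrier) ∈ grading 0
  mul_mem : ∀ {i j : ℤ} {a b : carrier}, a ∈ grading i → b ∈ grading j → a * b ∈ grading (i + j)
  /-- Graded commutativity (Koszul signs). -/
  gcomm : ∀ {i j : ℤ} {a b : carrier}, a ∈ grading i → b ∈ grading j →
      a * b = ((-1 : ℚ) ^ (i * j)) • (b * a)
  /-- Non-negative grading. -/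
  nonneg : ∀ i : ℤ, i < 0 → grading i = ⊥
  /-- The differential. -/
  d : carrier →ₗ[ℚ] carrier
  d_mem : ∀ {i : ℤ} {a : carrier}, a ∈ grading i → d a ∈ grading (i + 1)
  d_sq : ∀ a : carrier, d (d a) = 0
  /-- Graded Leibniz rule. -/
  leibniz : ∀ {i : ℤ} {a : carrier}, a ∈ grading i → ∀ b : carrier,
      d (a * b) = d a * b + ((-1 : ℚ) ^ i) • (a * d b)

attribute [instance] CDGA.ringStr CDGA.algStr

/-- The cohomology of a cdga, as a `ℚ`-vector space. -/
abbrev CDGA.Hspace (A : CDGA) : Type :=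
  ↥(LinearMap.ker A.d) ⧸ ((LinearMap.range A.d).comap (LinearMap.ker A.d).subtype)

/-- The degree-`n` cocycles of a cdga, inside the cocycle subspace. -/
def CDGA.cocyclesAt (A : CDGA) (n : ℤ) : Submodule ℚ ↥(LinearMap.ker A.d) :=
  (A.grading n).comap (LinearMap.ker A.d).subtype

/-- The degree-`n` part of the cohomology of a cdga. -/
def CDGA.Hpiece (A : CDGA) (n : ℤ) : Submodule ℚ A.Hspace :=
  (A.cocyclesAt n).map ((LinearMap.range A.d).comap (LinearMap.ker A.d).subtype).mkQ

/-- A morphism of cdgas: a degree-preserving algebra map commuting with the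
differentials. -/
structure CDGAHom (A B : CDGA) where
  toFun : A.carrier →ₐ[ℚ] B.carrier
  map_grading : ∀ i : ℤ, ∀ x ∈ A.grading i, toFun x ∈ B.grading i
  comm_d : ∀ x : A.carrier, toFun (A.d x) = B.d (toFun x)

/-- A morphism of cdgas is a quasi-isomorphism if it induces a bijection on
cohomology. -/
def CDGAHom.IsQuasiIso {A B : CDGA} (f : CDGAHom A B) : Prop :=
  (∀ x : A.carrier, A.d x = 0 → f.toFun x ∈ LinearMap.range B.d →
      x ∈ LinearMap.range A.d) ∧
  (∀ y : B.carrier, B.d y = 0 → ∃ x : A.carrier, A.d x = 0 ∧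
      f.toFun x - y ∈ LinearMap.range B.d)

/-- Two cdgas are connected by a chain (zigzag) of cdga quasi-isomorphisms. -/
def CDGAConnected (A B : CDGA) : Prop :=
  Relation.EqvGen (fun X Y : CDGA => ∃ f : CDGAHom X Y, f.IsQuasiIso) A B

/-- A cdga is formal if it is connected to its cohomology algebra, equipped
with the zero differential, by a chain of cdga quasi-isomorphisms; equivalently
(as stated here), it is connected by a chain of cdga quasi-isomorphisms to a
cdga with zero differential. -/
def CDGA.IsFormal (A : CDGA) : Prop :=
  ∃ B : CDGA, B.d = 0 ∧ CDGAConnected A B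

/-- The monomial `∏ g x ^ e x` associated with a finitely supported exponent
function `e`, the product being taken in increasing order of the (linearly
ordered) index set. -/
def monomialIn {A : Type} [Ring A] {ι : Type} (lo : LinearOrder ι)
    (g : ι → A) (e : ι →₀ ℕ) : A :=
  letI := lo
  ((e.support.sort (· ≤ ·)).map fun x => g x ^ e x).prod

/-- A Sullivan algebra `(ΛV, d)`: the free graded-commutative algebra on a
simply connected graded vector space `V = V^{≥2}` of finite type.  Freeness is
expressed by the requirement that the admissible monomials (square-free in the
odd-degree generators) in a homogeneous basis of `V` form a `ℚ`-basis. -/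
structure SullivanAlgebra extends CDGA where
  /-- The space of generators, as a graded subspace. -/
  V : ℤ → Submodule ℚ carrier
  V_le : ∀ i : ℤ, V i ≤ grading i
  /-- Simple connectedness: `V = V^{≥2}`. -/
  V_lower : ∀ i : ℤ, i ≤ 1 → V i = ⊥
  /-- Finite type. -/
  V_findim : ∀ i : ℤ, FiniteDimensional ℚ ↥(V i)
  /-- `ΛV` is free graded-commutative on `V`. -/
  free : ∃ (ι : Type) (lo : LinearOrder ι) (deg : ι → ℤ) (g : ι → carrier),
    (∀ x : ι, g x ∈ V (deg x)) ∧
    (∀ i : ℤ, V i = Submodule.span ℚ (g '' {x : ι | deg x = i})) ∧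
    LinearIndependent ℚ
      (fun e : {e : ι →₀ ℕ // ∀ x : ι, Odd (deg x) → e x ≤ 1} =>
        monomialIn lo g e.1) ∧
    ⊤ ≤ Submodule.span ℚ
      (Set.range fun e : {e : ι →₀ ℕ // ∀ x : ι, Odd (deg x) → e x ≤ 1} =>
        monomialIn lo g e.1)

/-- The set of homogeneous elements of positive degree. -/
def CDGA.posSet (A : CDGA) : Set A.carrier :=
  {a : A.carrier | ∃ i : ℤ, 0 < i ∧ a ∈ A.grading i}

/-- The decomposable elements `Λ^{≥2}V = A⁺ · A⁺` of a connected cdga. -/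
def CDGA.decomposables (A : CDGA) : Submodule ℚ A.carrier :=
  Submodule.span ℚ
    {z : A.carrier | ∃ x ∈ A.posSet, ∃ y ∈ A.posSet, z = x * y}

/-- A Sullivan algebra is minimal if `d(V) ⊆ Λ^{≥2}V`. -/
def SullivanAlgebra.IsMinimal (A : SullivanAlgebra) : Prop :=
  ∀ i : ℤ, ∀ v ∈ A.V i, A.d v ∈ A.toCDGA.decomposables

/-- A Sullivan algebra is elliptic if both `V` and `H^*(ΛV, d)` are
finite-dimensional. -/
def SullivanAlgebra.Elliptic (A : SullivanAlgebra) : Prop :=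
  (∃ N : ℤ, ∀ i : ℤ, N ≤ i → A.V i = ⊥) ∧
  FiniteDimensional ℚ A.toCDGA.Hspace

/-- The total dimension of the odd-degree part of `V`. -/
noncomputable def SullivanAlgebra.oddDim (A : SullivanAlgebra) : ℕ :=
  finsum fun i : ℤ => if Odd i then Module.finrank ℚ ↥(A.V i) else 0

/-- The total dimension of the even-degree part of `V`. -/
noncomputable def SullivanAlgebra.evenDim (A : SullivanAlgebra) : ℕ :=
  finsum fun i : ℤ => if Even i then Module.finrank ℚ ↥(A.V i) else 0

set_option linter.unusedSectionVars false
set_option linter.unusedSimpArgs false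

abbrev Idx (X Y : Type) := (X →₀ ℕ) × Finset Y

structure FA (X Y A : Type) [Fintype X] [DecidableEq X] [Fintype Y] [DecidableEq Y]
    [Ring A] [Algebra ℚ A] where
  a : X → ℕ
  c : Y → ℕ
  a_even : ∀ i, Even (a i)
  a_pos : ∀ i, 2 ≤ a i
  c_odd : ∀ j, Odd (c j)
  c_pos : ∀ j, 2 ≤ c j
  φ : MvPolynomial X ℚ →ₐ[ℚ] A
  φ_central : ∀ s x, φ s * x = x * φ s
  y : Finset Y → A
  y_empty : y ∅ = 1
  sg : Finset Y → Finset Y → ℚ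
  y_mul : ∀ I J, y I * y J = sg I J • y (I ∪ J)
  sg_disj : ∀ I J, Disjoint I J → sg I J * sg I J = 1
  sg_ndisj : ∀ I J, ¬ Disjoint I J → sg I J = 0
  sg_comm : ∀ I J, sg I J = (-1 : ℚ) ^ (I.card * J.card) * sg J I
  B : Module.Basis (Idx X Y) ℚ A
  B_eq : ∀ m I, B (m, I) = φ (MvPolynomial.monomial m 1) * y I
  τ : A →ₐ[ℚ] A
  τ_B : ∀ m I, τ (B (m, I)) = (-1 : ℚ) ^ I.card • B (m, I)
  d : A →ₗ[ℚ] A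
  d_sq : ∀ x, d (d x) = 0
  leib : ∀ x z, d (x * z) = d x * z + τ x * d z
  d_wt : ∀ b : Idx X Y, d (B b) ∈ Submodule.span ℚ (B '' {b' : Idx X Y |
    (∑ i, b'.1 i * a i + ∑ j ∈ b'.2, c j) = (∑ i, b.1 i * a i + ∑ j ∈ b.2, c j) + 1})
  minX : ∀ i, d (B (Finsupp.single i 1, ∅)) ∈ Submodule.span ℚ (B '' {b' : Idx X Y |
    2 ≤ (∑ i, b'.1 i) + b'.2.card})
  minY : ∀ j, d (B (0, {j})) ∈ Submodule.span ℚ (B '' {b' : Idx X Y |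
    2 ≤ (∑ i, b'.1 i) + b'.2.card})

namespace FA

variable {X Y A : Type} [Fintype X] [DecidableEq X] [Fintype Y] [DecidableEq Y]
    [Ring A] [Algebra ℚ A] (F : FA X Y A)

def wt (b : Idx X Y) : ℕ := ∑ i, b.1 i * F.a i + ∑ j ∈ b.2, F.c j
def len (b : Idx X Y) : ℕ := (∑ i, b.1 i) + b.2.card

def sp (s : Set (Idx X Y)) : Submodule ℚ A := Submodule.span ℚ (F.B '' s)

lemma mem_sp {s : Set (Idx X Y)} {x : A} : x ∈ F.sp s ↔ ∀ b, F.B.repr x b ≠ 0 → b ∈ s := by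
  rw [sp, Module.Basis.mem_span_image]
  simp only [Set.subset_def, Finset.mem_coe, Finsupp.mem_support_iff]

lemma B_mem_sp {s : Set (Idx X Y)} {b} (h : b ∈ s) : F.B b ∈ F.sp s :=
  Submodule.subset_span ⟨b, h, rfl⟩

lemma sp_mono {s t : Set (Idx X Y)} (h : s ⊆ t) : F.sp s ≤ F.sp t :=
  Submodule.span_mono (Set.image_mono h)

lemma mem_sp_inter {s t : Set (Idx X Y)} {x : A} (h : x ∈ F.sp s) (h' : x ∈ F.sp t) :
    x ∈ F.sp (s ∩ t) := by
  rw [mem_sp] at *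
  exact fun b hb => ⟨h b hb, h' b hb⟩

lemma sp_univ : F.sp Set.univ = ⊤ := by
  rw [eq_top_iff]; intro x _; rw [mem_sp]; intros; trivial

lemma sp_empty : F.sp ∅ = ⊥ := by simp [sp]

lemma sp_induction {s : Set (Idx X Y)} {P : A → Prop} (h0 : P 0)
    (ha : ∀ x z, P x → P z → P (x + z)) (hs : ∀ (q : ℚ) x, P x → P (q • x))
    (hB : ∀ b ∈ s, P (F.B b)) {x : A} (hx : x ∈ F.sp s) : P x := by
  refine Submodule.span_induction ?_ h0 (fun x z _ _ => ha x z) (fun q x _ => hs q x) hx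
  rintro _ ⟨b, hb, rfl⟩; exact hB b hb

/-- submodule version -/
lemma sp_le {s : Set (Idx X Y)} {P : Submodule ℚ A} (hB : ∀ b ∈ s, F.B b ∈ P) : F.sp s ≤ P := by
  rw [sp, Submodule.span_le]; rintro _ ⟨b, hb, rfl⟩; exact hB b hb

lemma sp_map_le {s : Set (Idx X Y)} {P : Submodule ℚ A} (f : A →ₗ[ℚ] A)
    (hB : ∀ b ∈ s, f (F.B b) ∈ P) {x} (hx : x ∈ F.sp s) : f x ∈ P :=
  F.sp_le (P := P.comap f) hB hx

/-- projection onto the span of a set of monomials -/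
noncomputable def pr (s : Set (Idx X Y)) : A →ₗ[ℚ] A := by
  classical exact F.B.constr ℚ (fun b => if b ∈ s then F.B b else 0)

lemma pr_B_mem {s : Set (Idx X Y)} {b} (h : b ∈ s) : F.pr s (F.B b) = F.B b := by
  simp [pr, h]

lemma pr_B_not_mem {s : Set (Idx X Y)} {b} (h : b ∉ s) : F.pr s (F.B b) = 0 := by
  simp [pr, h]

lemma ext_B {M : Type*} [AddCommMonoid M] [Module ℚ M] {f g : A →ₗ[ℚ] M}
    (h : ∀ b, f (F.B b) = g (F.B b)) (x) : f x = g x := by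
  rw [F.B.ext h]

lemma pr_repr (s : Set (Idx X Y)) (x : A) (b : Idx X Y) [Decidable (b ∈ s)] :
    F.B.repr (F.pr s x) b = if b ∈ s then F.B.repr x b else 0 := by
  have := F.ext_B (f := (Finsupp.lapply b) ∘ₗ F.B.repr.toLinearMap ∘ₗ F.pr s)
    (g := if b ∈ s then (Finsupp.lapply b) ∘ₗ F.B.repr.toLinearMap else 0) (by
      intro b'
      by_cases h' : b' ∈ s
      · by_cases h : b ∈ s
        · simp [h, pr_B_mem, h']
        · have : b' ≠ b := fun e => h (e ▸ h')
          simp [h, pr_B_mem, h', Finsupp.single_apply, this]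
      · by_cases h : b ∈ s
        · have : b' ≠ b := fun e => h' (e ▸ h)
          simp [h, pr_B_not_mem, h', Finsupp.single_apply, this]
        · simp [h, pr_B_not_mem, h']) x
  split_ifs with h <;> simpa [h] using this

lemma pr_mem (s : Set (Idx X Y)) (x : A) : F.pr s x ∈ F.sp s := by
  classical
  rw [mem_sp]; intro b; rw [pr_repr]; split_ifs with h
  · exact fun _ => h
  · exact fun h => absurd rfl h

lemma pr_mem_of_mem {t} (s : Set (Idx X Y)) {x : A} (h : x ∈ F.sp t) : F.pr s x ∈ F.sp t := by
  classical
  rw [mem_sp] at *; intro b hb; rw [pr_repr] at hb; split_ifs at hb with h'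
  · exact h _ hb
  · exact absurd rfl hb

lemma pr_eq_self {s : Set (Idx X Y)} {x : A} (h : x ∈ F.sp s) : F.pr s x = x := by
  classical
  rw [mem_sp] at h
  apply F.B.repr.injective; ext b; rw [pr_repr]; split_ifs with h'
  · rfl
  · by_contra h2; exact h' (h b (fun e => h2 e.symm))

lemma pr_eq_zero {s t : Set (Idx X Y)} {x : A} (h : x ∈ F.sp t) (hd : ∀ b ∈ t, b ∉ s) :
    F.pr s x = 0 := by
  have : F.sp t ≤ LinearMap.ker (F.pr s) := F.sp_le (fun b hb => F.pr_B_not_mem (hd b hb))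
  exact this h

lemma pr_sub_mem (s : Set (Idx X Y)) (x : A) : x - F.pr s x ∈ F.sp sᶜ := by
  classical
  rw [mem_sp]; intro b; rw [map_sub, Finsupp.sub_apply, pr_repr]; split_ifs with h
  · simp
  · exact fun _ => h

/-- multiplication of monomials -/
lemma B_mul (m m' : X →₀ ℕ) (I J : Finset Y) :
    F.B (m, I) * F.B (m', J) = F.sg I J • F.B (m + m', I ∪ J) := by
  rw [B_eq, B_eq, B_eq, mul_assoc, ← mul_assoc (F.y I), ← F.φ_central, mul_assoc, y_mul,
    ← mul_assoc, ← map_mul, MvPolynomial.monomial_mul, mul_one, mul_smul_comm]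

lemma sg_ne {I J : Finset Y} (h : Disjoint I J) : F.sg I J ≠ 0 := by
  intro e; have := F.sg_disj I J h; simp [e] at this

lemma sp_mul {s t u : Set (Idx X Y)} (h : ∀ b ∈ s, ∀ b' ∈ t, Disjoint b.2 b'.2 →
    (b.1 + b'.1, b.2 ∪ b'.2) ∈ u) {x z : A} (hx : x ∈ F.sp s) (hz : z ∈ F.sp t) :
    x * z ∈ F.sp u := by
  refine F.sp_map_le (LinearMap.mulRight ℚ z) ?_ hx
  intro b hb
  refine F.sp_map_le (LinearMap.mulLeft ℚ (F.B b)) ?_ hz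
  intro b' hb'
  rw [LinearMap.mulLeft_apply]
  obtain ⟨m, I⟩ := b
  obtain ⟨m', J⟩ := b'
  rw [B_mul]
  by_cases hd : Disjoint I J
  · exact Submodule.smul_mem _ _ (F.B_mem_sp (h _ hb _ hb' hd))
  · rw [F.sg_ndisj _ _ hd, zero_smul]; exact Submodule.zero_mem _

lemma sg_empty_left (J : Finset Y) : F.sg ∅ J = 1 := by
  have h := F.B_mul 0 0 ∅ J
  have h1 : F.B (0, ∅) = 1 := by
    rw [B_eq, F.y_empty, mul_one]; exact map_one F.φ
  rw [h1, one_mul, add_zero, Finset.empty_union] at h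
  have h2 := congrArg (fun x => F.B.repr x (0, J)) h
  simpa using h2.symm

lemma B_one : F.B (0, ∅) = 1 := by
    rw [B_eq, F.y_empty, mul_one]; exact map_one F.φ

lemma τ_τ (x : A) : F.τ (F.τ x) = x := by
  refine F.ext_B (f := F.τ.toLinearMap ∘ₗ F.τ.toLinearMap) (g := LinearMap.id) ?_ x
  rintro ⟨m, I⟩
  simp only [LinearMap.comp_apply, AlgHom.toLinearMap_apply, τ_B, map_smul, smul_smul, LinearMap.id_apply]
  rw [← mul_pow]; simp

lemma τ_sp {s : Set (Idx X Y)} {x} (h : x ∈ F.sp s) : F.τ x ∈ F.sp s := by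
  refine F.sp_map_le F.τ.toLinearMap ?_ h
  rintro ⟨m, I⟩ hb
  rw [AlgHom.toLinearMap_apply, τ_B]
  exact Submodule.smul_mem _ _ (F.B_mem_sp hb)

def Gr (m : ℕ) : Submodule ℚ A := F.sp {b | F.wt b = m}

lemma wt_add (m m' : X →₀ ℕ) (I J : Finset Y) (h : Disjoint I J) :
    F.wt (m + m', I ∪ J) = F.wt (m, I) + F.wt (m', J) := by
  simp only [wt, Finsupp.add_apply, add_mul, Finset.sum_add_distrib, Finset.sum_union h]
  ring

lemma len_add (m m' : X →₀ ℕ) (I J : Finset Y) (h : Disjoint I J) :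
    len (m + m', I ∪ J) = len (m, I) + len (m', J) := by
  simp only [len, Finsupp.add_apply, Finset.sum_add_distrib, Finset.card_union_of_disjoint h]
  ring

lemma Gr_mul {m m' : ℕ} {x z : A} (hx : x ∈ F.Gr m) (hz : z ∈ F.Gr m') : x * z ∈ F.Gr (m + m') := by
  refine F.sp_mul ?_ hx hz
  rintro ⟨m, I⟩ hb ⟨m', J⟩ hb' hd
  simp only [Set.mem_ofPred_eq] at *
  rw [F.wt_add _ _ _ _ hd, hb, hb']

lemma d_B (b : Idx X Y) : F.d (F.B b) ∈ F.Gr (F.wt b + 1) := F.d_wt b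

lemma d_sp_wt {P Q : ℕ → Prop} (h : ∀ m, P m → Q (m + 1)) {x : A} (hx : x ∈ F.sp {b | P (F.wt b)}) :
    F.d x ∈ F.sp {b | Q (F.wt b)} := by
  refine F.sp_map_le F.d ?_ hx
  intro b hb
  refine F.sp_mono ?_ (F.d_B b)
  intro b' hb'
  simp only [Set.mem_ofPred_eq] at *
  rw [hb']; exact h _ hb

lemma d_Gr {m : ℕ} {x : A} (hx : x ∈ F.Gr m) : F.d x ∈ F.Gr (m + 1) :=
  F.d_sp_wt (P := fun k => k = m) (Q := fun k => k = m + 1) (by simp) hx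

/-- parity of weight -/
lemma wt_parity (b : Idx X Y) : (-1 : ℚ) ^ (F.wt b) = (-1) ^ b.2.card := by
  have h1 : Even (∑ i, b.1 i * F.a i) :=
    Finset.even_sum _ (fun i _ => (F.a_even i).mul_left _)
  rw [wt, pow_add, h1.neg_one_pow, one_mul, ← Finset.prod_pow_eq_pow_sum]
  simp [(F.c_odd _).neg_one_pow]

lemma τ_Gr {m : ℕ} {x : A} (hx : x ∈ F.Gr m) : F.τ x = (-1 : ℚ) ^ m • x := by
  refine F.sp_induction (P := fun x => F.τ x = (-1 : ℚ) ^ m • x) (by simp) ?_ ?_ ?_ hx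
  · intro x z hx hz; rw [map_add, hx, hz, smul_add]
  · intro q x hx; rw [map_smul, hx, smul_comm]
  · rintro ⟨m, I⟩ hb
    simp only [Set.mem_ofPred_eq] at hb
    rw [τ_B, ← hb, wt_parity]

lemma d_τ (x : A) : F.d (F.τ x) = - F.τ (F.d x) := by
  refine F.ext_B (f := F.d ∘ₗ F.τ.toLinearMap) (g := - (F.τ.toLinearMap ∘ₗ F.d)) ?_ x
  intro b
  have h1 : F.B b ∈ F.Gr (F.wt b) := F.B_mem_sp rfl
  simp only [LinearMap.comp_apply, AlgHom.toLinearMap_apply, LinearMap.neg_apply]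
  rw [F.τ_Gr h1, F.τ_Gr (F.d_Gr h1), map_smul, pow_succ]
  simp

/-- supercommutativity -/
lemma comm_even {x : A} (hx : F.τ x = x) (z : A) : x * z = z * x := by
  have key : ∀ b : Idx X Y, (F.B b + F.τ (F.B b)) * z = z * (F.B b + F.τ (F.B b)) := by
    rintro ⟨m, I⟩
    refine F.ext_B (f := LinearMap.mulLeft ℚ (F.B (m, I) + F.τ (F.B (m, I))))
      (g := LinearMap.mulRight ℚ (F.B (m, I) + F.τ (F.B (m, I)))) ?_ z
    rintro ⟨m', J⟩
    simp only [LinearMap.mulLeft_apply, LinearMap.mulRight_apply, τ_B, add_mul, mul_add,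
      smul_mul_assoc, mul_smul_comm, B_mul]
    rw [F.sg_comm J I, add_comm m' m, Finset.union_comm J I]
    rcases Nat.even_or_odd I.card with h | h
    · rw [(h.mul_left J.card).neg_one_pow, one_mul]
    · simp [h.neg_one_pow]
  have h2 : ∀ x : A, (x + F.τ x) * z = z * (x + F.τ x) := by
    intro x
    refine F.ext_B (f := LinearMap.mulRight ℚ z ∘ₗ (LinearMap.id + F.τ.toLinearMap))
      (g := LinearMap.mulLeft ℚ z ∘ₗ (LinearMap.id + F.τ.toLinearMap)) ?_ x
    intro b
    simpa using key b
  have h3 := h2 x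
  rw [hx, ← two_smul ℚ x, smul_mul_assoc, mul_smul_comm] at h3
  have := congrArg (fun t => (1/2 : ℚ) • t) h3
  simpa [smul_smul] using this

lemma comm_odd {x : A} (hx : F.τ x = -x) (z : A) : x * z = F.τ z * x := by
  have key : ∀ b : Idx X Y, (F.B b - F.τ (F.B b)) * z = F.τ z * (F.B b - F.τ (F.B b)) := by
    rintro ⟨m, I⟩
    refine F.ext_B (f := LinearMap.mulLeft ℚ (F.B (m, I) - F.τ (F.B (m, I))))
      (g := LinearMap.mulRight ℚ (F.B (m, I) - F.τ (F.B (m, I))) ∘ₗ F.τ.toLinearMap) ?_ z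
    rintro ⟨m', J⟩
    simp only [LinearMap.mulLeft_apply, LinearMap.mulRight_apply, LinearMap.comp_apply,
      AlgHom.toLinearMap_apply, τ_B, sub_mul, mul_sub,
      smul_mul_assoc, mul_smul_comm, B_mul]
    rw [F.sg_comm J I, add_comm m' m, Finset.union_comm J I]
    rcases Nat.even_or_odd I.card with h | h
    · simp [h.neg_one_pow]
    · rcases Nat.even_or_odd J.card with h' | h'
      · rw [(h'.mul_right I.card).neg_one_pow, h.neg_one_pow, h'.neg_one_pow]; simp
      · rw [(h'.mul h).neg_one_pow, h.neg_one_pow, h'.neg_one_pow]; simp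
  have h2 : ∀ x : A, (x - F.τ x) * z = F.τ z * (x - F.τ x) := by
    intro x
    refine F.ext_B (f := LinearMap.mulRight ℚ z ∘ₗ (LinearMap.id - F.τ.toLinearMap))
      (g := LinearMap.mulLeft ℚ (F.τ z) ∘ₗ (LinearMap.id - F.τ.toLinearMap)) ?_ x
    intro b
    simpa using key b
  have h3 := h2 x
  rw [hx, sub_neg_eq_add, ← two_smul ℚ x, smul_mul_assoc, mul_smul_comm] at h3
  have := congrArg (fun t => (1/2 : ℚ) • t) h3
  simpa [smul_smul] using this

end FA

namespace FA

variable {X Y A : Type} [Fintype X] [DecidableEq X] [Fintype Y] [DecidableEq Y]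
    [Ring A] [Algebra ℚ A] (F : FA X Y A)

/-- exponent of a generator -/
noncomputable def gi : X ⊕ Y → Idx X Y
  | Sum.inl i => (Finsupp.single i 1, ∅)
  | Sum.inr j => (0, {j})

/-- the generator divides the monomial -/
def dv : X ⊕ Y → Idx X Y → Prop
  | Sum.inl i, b => b.1 i ≠ 0
  | Sum.inr j, b => j ∈ b.2

def deg : X ⊕ Y → ℕ
  | Sum.inl i => F.a i
  | Sum.inr j => F.c j

noncomputable def gen (v : X ⊕ Y) : A := F.B (gi v)

/-- parity sign -/
def sn : X ⊕ Y → ℚ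
  | Sum.inl _ => 1
  | Sum.inr _ => -1

lemma two_le_deg (v : X ⊕ Y) : 2 ≤ F.deg v := by
  cases v
  · exact F.a_pos _
  · exact F.c_pos _

lemma wt_gi (v : X ⊕ Y) : F.wt (gi v) = F.deg v := by
  cases v with
  | inl i => simp [wt, gi, deg, Finsupp.single_apply]
  | inr j => simp [wt, gi, deg]

lemma len_gi (v : X ⊕ Y) : len (gi v) = 1 := by
  cases v with
  | inl i => simp [len, gi, Finsupp.single_apply]
  | inr j => simp [len, gi]

lemma gen_Gr (v : X ⊕ Y) : F.gen v ∈ F.Gr (F.deg v) := F.B_mem_sp (F.wt_gi v)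

lemma τ_gen (v : X ⊕ Y) : F.τ (F.gen v) = (sn v : ℚ) • F.gen v := by
  cases v <;> simp [gen, gi, τ_B, sn]

/-- a monomial divisible by a generator is a product -/
lemma exists_of_dv {v : X ⊕ Y} {b : Idx X Y} (h : dv v b) :
    ∃ b' : Idx X Y, Disjoint (gi v).2 b'.2 ∧ b = ((gi v).1 + b'.1, (gi v).2 ∪ b'.2) := by
  obtain ⟨m, I⟩ := b
  cases v with
  | inl i =>
    refine ⟨(m - Finsupp.single i 1, I), by simp [gi], ?_⟩
    have h : m i ≠ 0 := h
    simp only [gi, Finset.empty_union, Prod.mk.injEq, and_true]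
    rw [add_tsub_cancel_of_le]
    rw [Finsupp.single_le_iff]; omega
  | inr j =>
    refine ⟨(m, I.erase j), by simp [gi], ?_⟩
    have h : j ∈ I := h
    simp only [gi, zero_add, Prod.mk.injEq, true_and]
    rw [← Finset.insert_eq, Finset.insert_erase h]

lemma gen_mul_B {v : X ⊕ Y} {b : Idx X Y} :
    F.gen v * F.B b = F.sg (gi v).2 b.2 • F.B ((gi v).1 + b.1, (gi v).2 ∪ b.2) := by
  rw [gen, ← F.B_mul]

lemma B_eq_gen_mul {v : X ⊕ Y} {b' : Idx X Y} (hd : Disjoint (gi v).2 b'.2) :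
    F.B ((gi v).1 + b'.1, (gi v).2 ∪ b'.2) = F.gen v * (F.sg (gi v).2 b'.2 • F.B b') := by
  rw [mul_smul_comm, gen_mul_B, smul_smul, F.sg_disj _ _ hd, one_smul]

/-- elements supported on multiples of `v` are products -/
lemma exists_gen_mul {v : X ⊕ Y} {s : Set (Idx X Y)} {x : A} (hx : x ∈ F.sp {b | dv v b ∧ b ∈ s}) :
    ∃ z ∈ F.sp {b | Disjoint (gi v).2 b.2 ∧ ((gi v).1 + b.1, (gi v).2 ∪ b.2) ∈ s},
      x = F.gen v * z := by
  refine F.sp_induction (P := fun x => ∃ z ∈ F.sp {b | Disjoint (gi v).2 b.2 ∧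
    ((gi v).1 + b.1, (gi v).2 ∪ b.2) ∈ s}, x = F.gen v * z) ?_ ?_ ?_ ?_ hx
  · exact ⟨0, Submodule.zero_mem _, by simp⟩
  · rintro _ _ ⟨z, hz, rfl⟩ ⟨z', hz', rfl⟩
    exact ⟨z + z', Submodule.add_mem _ hz hz', by rw [mul_add]⟩
  · rintro q _ ⟨z, hz, rfl⟩
    exact ⟨q • z, Submodule.smul_mem _ _ hz, by rw [mul_smul_comm]⟩
  · rintro b ⟨hb, hs⟩
    obtain ⟨b', hd, rfl⟩ := exists_of_dv hb
    exact ⟨_, Submodule.smul_mem _ _ (F.B_mem_sp ⟨hd, hs⟩), F.B_eq_gen_mul hd⟩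

lemma dv_mul_left {v : X ⊕ Y} {b b' : Idx X Y} (h : dv v b) : dv v (b.1 + b'.1, b.2 ∪ b'.2) := by
  cases v with
  | inl i => simp only [dv] at *; simp; omega
  | inr j => simp only [dv] at *; simp [h]

lemma dv_mul_right {v : X ⊕ Y} {b b' : Idx X Y} (h : dv v b') : dv v (b.1 + b'.1, b.2 ∪ b'.2) := by
  cases v with
  | inl i => simp only [dv] at *; simp; omega
  | inr j => simp only [dv] at *; simp [h]

lemma dv_mul {v : X ⊕ Y} {b b' : Idx X Y} (h : dv v (b.1 + b'.1, b.2 ∪ b'.2)) : dv v b ∨ dv v b' := by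
  cases v with
  | inl i => simp only [dv] at *; simp at h; omega
  | inr j => simp only [dv] at *; simpa using h

lemma dv_gi {v w : X ⊕ Y} : dv v (gi w) ↔ v = w := by
  cases v <;> cases w <;> simp [dv, gi, Finsupp.single_apply, eq_comm]

lemma sp_congr_le {s t : Set (Idx X Y)} (h : ∀ b, b ∈ s → b ∈ t) : F.sp s ≤ F.sp t := F.sp_mono h

/-- ideal generated by the generators in T -/
def IT (T : Finset (X ⊕ Y)) : Submodule ℚ A := F.sp {b | ∃ v ∈ T, dv v b}

lemma IT_empty : F.IT ∅ = ⊥ := by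
  rw [IT, ← F.sp_empty]; congr 1; ext; simp

lemma IT_mono {T T' : Finset (X ⊕ Y)} (h : T ⊆ T') : F.IT T ≤ F.IT T' :=
  F.sp_mono (fun _ ⟨v, hv, hb⟩ => ⟨v, h hv, hb⟩)

lemma IT_mul_left {T} {x z : A} (hx : x ∈ F.IT T) : x * z ∈ F.IT T := by
  refine F.sp_mul (t := Set.univ) ?_ hx (by rw [F.sp_univ]; trivial)
  rintro b ⟨v, hv, hb⟩ b' _ _
  exact ⟨v, hv, dv_mul_left hb⟩

lemma IT_mul_right {T} {x z : A} (hx : x ∈ F.IT T) : z * x ∈ F.IT T := by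
  refine F.sp_mul (s := Set.univ) ?_ (by rw [F.sp_univ]; trivial) hx
  rintro b _ b' ⟨v, hv, hb⟩ _
  exact ⟨v, hv, dv_mul_right hb⟩

lemma IT_τ {T} {x : A} (hx : x ∈ F.IT T) : F.τ x ∈ F.IT T := F.τ_sp hx

lemma gen_mem_IT {T} {v} (hv : v ∈ T) : F.gen v ∈ F.IT T := F.B_mem_sp ⟨v, hv, dv_gi.2 rfl⟩

/-- Decomposition of `IT (insert v T)`, with support control. -/
lemma IT_insert {T v} {s : Set (Idx X Y)} {x : A} (hx : x ∈ F.IT (insert v T)) (hs : x ∈ F.sp s) :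
    ∃ z ∈ F.sp {b | Disjoint (gi v).2 b.2 ∧ ((gi v).1 + b.1, (gi v).2 ∪ b.2) ∈ s},
      ∃ w ∈ F.IT T, w ∈ F.sp s ∧ x = F.gen v * z + w := by
  classical
  set t : Set (Idx X Y) := {b | dv v b}
  have h1 : F.pr t x ∈ F.sp {b | dv v b ∧ b ∈ s} :=
    F.mem_sp_inter (F.pr_mem t x) (F.pr_mem_of_mem t hs)
  obtain ⟨z, hz, hz'⟩ := F.exists_gen_mul h1
  refine ⟨z, hz, x - F.pr t x, ?_, Submodule.sub_mem _ hs (F.pr_mem_of_mem t hs), ?_⟩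
  · have h2 := F.mem_sp_inter (F.pr_sub_mem t x) (Submodule.sub_mem _ hx (F.pr_mem_of_mem t hx))
    refine F.sp_mono ?_ h2
    rintro b ⟨hb, w, hw, hb'⟩
    rcases Finset.mem_insert.1 hw with rfl | hw
    · exact absurd hb' hb
    · exact ⟨w, hw, hb'⟩
  · rw [← hz']; abel

lemma gi_add_inj {v : X ⊕ Y} {b b' : Idx X Y} (hd : Disjoint (gi v).2 b.2) (hd' : Disjoint (gi v).2 b'.2)
    (h : (((gi v).1 + b.1, (gi v).2 ∪ b.2) : Idx X Y) = ((gi v).1 + b'.1, (gi v).2 ∪ b'.2)) : b = b' := by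
  obtain ⟨m, I⟩ := b
  obtain ⟨m', I'⟩ := b'
  simp only [Prod.mk.injEq, add_right_inj] at h
  obtain ⟨rfl, h⟩ := h
  have : I = I' := by
    have h1 := Finset.union_sdiff_cancel_left hd
    have h2 := Finset.union_sdiff_cancel_left hd'
    simp only at h1 h2
    rw [← h1, ← h2, h]
  rw [this]

lemma repr_gen_mul (v : X ⊕ Y) (b : Idx X Y) (hd : Disjoint (gi v).2 b.2) (z : A) :
    F.B.repr (F.gen v * z) ((gi v).1 + b.1, (gi v).2 ∪ b.2) = F.sg (gi v).2 b.2 * F.B.repr z b := by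
  refine F.ext_B (f := Finsupp.lapply ((gi v).1 + b.1, (gi v).2 ∪ b.2) ∘ₗ F.B.repr.toLinearMap ∘ₗ
    LinearMap.mulLeft ℚ (F.gen v)) (g := F.sg (gi v).2 b.2 • (Finsupp.lapply b ∘ₗ
      F.B.repr.toLinearMap)) ?_ z
  intro b'
  simp only [LinearMap.comp_apply, LinearMap.mulLeft_apply, LinearMap.smul_apply,
    LinearEquiv.coe_coe, gen_mul_B, map_smul, Module.Basis.repr_self, Finsupp.lapply_apply,
    Finsupp.single_apply, smul_eq_mul]
  by_cases hd' : Disjoint (gi v).2 b'.2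
  · by_cases h : b' = b
    · subst h; simp
    · rw [if_neg, if_neg h]
      · simp
      · exact fun e => h (gi_add_inj hd' hd e)
  · rw [F.sg_ndisj _ _ hd']
    have : b' ≠ b := by rintro rfl; exact hd' hd
    simp [this]

/-- regularity: even and odd cases in one -/
lemma regular {T} {v : X ⊕ Y} (hv : v ∉ T) {z : A} (h : F.gen v * z ∈ F.IT T) :
    z ∈ F.sp {b | (∃ w ∈ T, dv w b) ∨ ¬ Disjoint (gi v).2 b.2} := by
  rw [mem_sp]
  intro b hb
  by_cases hd : Disjoint (gi v).2 b.2
  · left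
    rw [IT, mem_sp] at h
    obtain ⟨w, hw, hb'⟩ := h ((gi v).1 + b.1, (gi v).2 ∪ b.2) (by
      rw [repr_gen_mul _ _ _ hd]; exact mul_ne_zero (F.sg_ne hd) hb)
    refine ⟨w, hw, (dv_mul hb').resolve_left ?_⟩
    rw [dv_gi]; rintro rfl; exact hv hw
  · exact Or.inr hd

lemma regular_even {T} {i : X} (hv : Sum.inl i ∉ T) {z : A} (h : F.gen (Sum.inl i) * z ∈ F.IT T) :
    z ∈ F.IT T := by
  refine F.sp_mono ?_ (F.regular hv h)
  rintro b (hb | hb)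
  · exact hb
  · simp [gi] at hb

lemma regular_odd {T} {j : Y} (hv : Sum.inr j ∉ T) {z : A} (h : F.gen (Sum.inr j) * z ∈ F.IT T) :
    z ∈ F.IT (insert (Sum.inr j) T) := by
  refine F.sp_mono ?_ (F.regular hv h)
  rintro b (⟨w, hw, hb⟩ | hb)
  · exact ⟨w, Finset.mem_insert_of_mem hw, hb⟩
  · refine ⟨Sum.inr j, Finset.mem_insert_self _ _, ?_⟩
    simpa [gi, dv] using hb

def Low (T : Finset (X ⊕ Y)) : Prop := ∀ v ∈ T, ∀ w, F.deg w < F.deg v → w ∈ T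

def L (k : ℕ) : Submodule ℚ A := F.sp {b | k ≤ len b}

lemma L_mul {k l} {x z : A} (hx : x ∈ F.L k) (hz : z ∈ F.L l) : x * z ∈ F.L (k + l) := by
  refine F.sp_mul ?_ hx hz
  rintro ⟨m, I⟩ hb ⟨m', J⟩ hb' hd
  simp only [Set.mem_ofPred_eq] at *
  rw [len_add _ _ _ _ hd]; omega

lemma d_gen_L2 (v : X ⊕ Y) : F.d (F.gen v) ∈ F.L 2 := by
  cases v with
  | inl i => exact F.minX i
  | inr j => exact F.minY j

lemma exists_dv {b : Idx X Y} (h : len b ≠ 0) : ∃ v : X ⊕ Y, dv v b := by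
  by_contra hc
  push Not at hc
  apply h
  have h1 : ∀ i, b.1 i = 0 := fun i => by simpa [dv] using hc (Sum.inl i)
  have h2 : b.2 = ∅ := by
    ext j; simpa [dv] using hc (Sum.inr j)
  simp [len, h1, h2]

lemma d_gen_terms (v : X ⊕ Y) : F.d (F.gen v) ∈ F.sp {b | 2 ≤ len b ∧ F.wt b = F.deg v + 1} :=
  F.mem_sp_inter (F.d_gen_L2 v) (F.d_Gr (F.gen_Gr v))

lemma dv_small {v : X ⊕ Y} {b : Idx X Y} (h : 2 ≤ len b) (hw : F.wt b = F.deg v + 1) :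
    ∃ w, dv w b ∧ F.deg w < F.deg v := by
  obtain ⟨w, hwb⟩ := exists_dv (b := b) (by omega)
  obtain ⟨b', hd, rfl⟩ := exists_of_dv hwb
  refine ⟨w, hwb, ?_⟩
  have h1 := len_add (gi w).1 b'.1 (gi w).2 b'.2 hd
  have h2 := F.wt_add (gi w).1 b'.1 (gi w).2 b'.2 hd
  simp only [Prod.mk.eta, len_gi, wt_gi] at h1 h2
  obtain ⟨u, hub⟩ := exists_dv (b := b') (by omega)
  obtain ⟨b'', hd', rfl⟩ := exists_of_dv hub
  have h3 := F.wt_add (gi u).1 b''.1 (gi u).2 b''.2 hd'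
  simp only [Prod.mk.eta, wt_gi] at h3
  have := F.two_le_deg u
  omega

lemma d_gen_IT {T} {v : X ⊕ Y} (hT : ∀ w, F.deg w < F.deg v → w ∈ T) : F.d (F.gen v) ∈ F.IT T := by
  refine F.sp_mono ?_ (F.d_gen_terms v)
  rintro b ⟨h1, h2⟩
  obtain ⟨w, hw, hd⟩ := F.dv_small h1 h2
  exact ⟨w, hT w hd, hw⟩

lemma d_IT {T} (hT : F.Low T) {x : A} (hx : x ∈ F.IT T) : F.d x ∈ F.IT T := by
  refine F.sp_map_le F.d ?_ hx
  rintro b ⟨v, hv, hb⟩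
  obtain ⟨b', hd, rfl⟩ := exists_of_dv hb
  rw [F.B_eq_gen_mul hd, F.leib, F.τ_gen]
  refine Submodule.add_mem _ (F.IT_mul_left (F.d_gen_IT (hT v hv))) ?_
  exact F.IT_mul_left (Submodule.smul_mem _ _ (F.gen_mem_IT hv))

/-- `v` is a live generator of minimal degree -/
def MinLive (T : Finset (X ⊕ Y)) (v : X ⊕ Y) : Prop := v ∉ T ∧ ∀ w, F.deg w < F.deg v → w ∈ T

lemma Low_insert {T v} (hT : F.Low T) (hv : F.MinLive T v) : F.Low (insert v T) := by
  intro u hu w hw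
  rcases Finset.mem_insert.1 hu with rfl | hu
  · exact Finset.mem_insert_of_mem (hv.2 w hw)
  · exact Finset.mem_insert_of_mem (hT u hu w hw)

lemma low_induction {P : Finset (X ⊕ Y) → Prop} (h0 : P ∅)
    (hs : ∀ T v, F.Low T → F.MinLive T v → P T → P (insert v T)) : ∀ T, F.Low T → P T := by
  intro T
  induction hk : T.card generalizing T with
  | zero => intro _; rw [Finset.card_eq_zero.1 hk]; exact h0
  | succ k ih =>
    intro hT
    have hne : T.Nonempty := by rw [← Finset.card_pos]; omega
    obtain ⟨v, hv, hmax⟩ := Finset.exists_max_image T F.deg hne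
    have hlow : F.Low (T.erase v) := by
      intro u hu w hw
      have hu := Finset.mem_erase.1 hu
      refine Finset.mem_erase.2 ⟨?_, hT u hu.2 w hw⟩
      rintro rfl
      have := hmax u hu.2
      omega
    have := hs (T.erase v) v hlow ⟨Finset.notMem_erase _ _, fun w hw =>
      Finset.mem_erase.2 ⟨by rintro rfl; omega, hT v hv w hw⟩⟩
      (ih _ (by rw [Finset.card_erase_of_mem hv]; omega) hlow)
    rwa [Finset.insert_erase hv] at this

lemma Low_univ : F.Low Finset.univ := fun _ _ _ _ => Finset.mem_univ _

lemma IT_univ_L : F.IT Finset.univ = F.L 1 := by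
  apply le_antisymm <;> refine F.sp_mono ?_
  · rintro b ⟨v, _, hb⟩
    by_contra h
    have h : len b = 0 := by simpa using h
    simp only [len] at h
    cases v with
    | inl i =>
      have h1 : ∑ i, b.1 i = 0 := by omega
      simp only [Finset.sum_eq_zero_iff, Finset.mem_univ, true_imp_iff] at h1
      exact hb (h1 i)
    | inr j =>
      have h2 : b.2.card = 0 := by omega
      rw [Finset.card_eq_zero] at h2
      simp [dv, h2] at hb
  · intro b hb
    simp only [Set.mem_ofPred_eq] at hb
    obtain ⟨v, hv⟩ := exists_dv (b := b) (by omega)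
    exact ⟨v, Finset.mem_univ _, hv⟩

lemma one_not_mem_L1 : (1 : A) ∉ F.L 1 := by
  rw [← F.B_one, L, mem_sp]
  intro h
  have := h (0, ∅) (by simp)
  simp [len] at this

end FA

/-- super-commutative differential algebra, with parity automorphism -/
structure SDA (E : Type) [Ring E] [Algebra ℚ E] where
  τ : E →ₐ[ℚ] E
  D : E →ₗ[ℚ] E
  ττ : ∀ x, τ (τ x) = x
  DD : ∀ x, D (D x) = 0
  Dτ : ∀ x, D (τ x) = - τ (D x)
  leib : ∀ x z, D (x * z) = D x * z + τ x * D z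
  comm_even : ∀ x, τ x = x → ∀ z, x * z = z * x
  comm_odd : ∀ x, τ x = - x → ∀ z, x * z = τ z * x

/-- Extension by an odd generator. -/
def OE {E : Type} [Ring E] [Algebra ℚ E] (_τ : E →ₐ[ℚ] E) : Type := E × E

namespace OE
variable {E : Type} [Ring E] [Algebra ℚ E] (τ : E →ₐ[ℚ] E)

instance : AddCommGroup (OE τ) := inferInstanceAs (AddCommGroup (E × E))
instance : Module ℚ (OE τ) := inferInstanceAs (Module ℚ (E × E))
instance : Mul (OE τ) := ⟨fun x z => ((x.1 * z.1, x.1 * z.2 + x.2 * τ z.1) : E × E)⟩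
instance : One (OE τ) := ⟨((1, 0) : E × E)⟩

@[simp] lemma mul_fst (x z : OE τ) : (x * z).1 = x.1 * z.1 := rfl
@[simp] lemma mul_snd (x z : OE τ) : (x * z).2 = x.1 * z.2 + x.2 * τ z.1 := rfl
@[simp] lemma one_fst : (1 : OE τ).1 = 1 := rfl
@[simp] lemma one_snd : (1 : OE τ).2 = 0 := rfl
@[simp] lemma add_fst (x z : OE τ) : (x + z).1 = x.1 + z.1 := rfl
@[simp] lemma add_snd (x z : OE τ) : (x + z).2 = x.2 + z.2 := rfl
@[simp] lemma neg_fst (x : OE τ) : (-x).1 = -x.1 := rfl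
@[simp] lemma neg_snd (x : OE τ) : (-x).2 = -x.2 := rfl
@[simp] lemma sub_fst (x z : OE τ) : (x - z).1 = x.1 - z.1 := rfl
@[simp] lemma sub_snd (x z : OE τ) : (x - z).2 = x.2 - z.2 := rfl
@[simp] lemma zero_fst : (0 : OE τ).1 = 0 := rfl
@[simp] lemma zero_snd : (0 : OE τ).2 = 0 := rfl
@[simp] lemma smul_fst (q : ℚ) (x : OE τ) : (q • x).1 = q • x.1 := rfl
@[simp] lemma smul_snd (q : ℚ) (x : OE τ) : (q • x).2 = q • x.2 := rfl

lemma ext' {x z : OE τ} (h1 : x.1 = z.1) (h2 : x.2 = z.2) : x = z := Prod.ext h1 h2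

instance : Ring (OE τ) :=
  { (inferInstance : AddCommGroup (OE τ)), (inferInstance : Mul (OE τ)),
    (inferInstance : One (OE τ)) with
    left_distrib := fun x y z => by apply ext' <;> simp [mul_add]; abel
    right_distrib := fun x y z => by apply ext' <;> simp [add_mul]; abel
    zero_mul := fun x => by apply ext' <;> simp
    mul_zero := fun x => by apply ext' <;> simp
    mul_assoc := fun x y z => by apply ext' <;> simp [mul_assoc, add_mul, mul_add, add_assoc]
    one_mul := fun x => by apply ext' <;> simp
    mul_one := fun x => by apply ext' <;> simp }

instance : Algebra ℚ (OE τ) := Algebra.ofModule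
  (fun q x z => by apply ext' <;> simp)
  (fun q x z => by apply ext' <;> simp)

/-- constructor -/
def mk (x z : E) : OE τ := ((x, z) : E × E)
@[simp] lemma mk_fst (x z : E) : (mk τ x z).1 = x := rfl
@[simp] lemma mk_snd (x z : E) : (mk τ x z).2 = z := rfl

/-- inclusion -/
def incL : E →ₗ[ℚ] OE τ where
  toFun := fun x => mk τ x 0
  map_add' := fun x z => by apply ext' <;> simp
  map_smul' := fun q x => by apply ext' <;> simp

@[simp] lemma incL_fst (x : E) : (incL τ x).1 = x := rfl
@[simp] lemma incL_snd (x : E) : (incL τ x).2 = 0 := rfl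

def inc : E →ₐ[ℚ] OE τ := AlgHom.ofLinearMap (incL τ) rfl
  (fun x z => by apply ext' <;> simp)

/-- augmentation to the constant term -/
def fs : OE τ →ₐ[ℚ] E := AlgHom.ofLinearMap
  { toFun := fun x => x.1
    map_add' := fun _ _ => rfl
    map_smul' := fun _ _ => rfl } rfl
  (fun _ _ => rfl)

/-- multiple of the new generator -/
def up (x : E) : OE τ := mk τ 0 x

@[simp] lemma inc_fst (x : E) : (inc τ x).1 = x := rfl
@[simp] lemma inc_snd (x : E) : (inc τ x).2 = 0 := rfl
@[simp] lemma up_fst (x : E) : (up τ x).1 = 0 := rfl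
@[simp] lemma up_snd (x : E) : (up τ x).2 = x := rfl
@[simp] lemma fs_apply (x : OE τ) : fs τ x = x.1 := rfl

def tL : OE τ →ₗ[ℚ] OE τ where
  toFun := fun x => mk τ (τ x.1) (- τ x.2)
  map_add' := fun x z => by apply ext' <;> simp; abel
  map_smul' := fun q x => by apply ext' <;> simp

@[simp] lemma tL_fst (x) : (tL τ x).1 = τ x.1 := rfl
@[simp] lemma tL_snd (x) : (tL τ x).2 = - τ x.2 := rfl

def tA : OE τ →ₐ[ℚ] OE τ := AlgHom.ofLinearMap (tL τ)
    (by apply ext' <;> simp)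
    (fun x z => by apply ext' <;> simp; abel)

@[simp] lemma tA_fst (x) : (tA τ x).1 = τ x.1 := rfl
@[simp] lemma tA_snd (x) : (tA τ x).2 = - τ x.2 := rfl

variable {τ}

def DO (S : SDA E) (w : E) : OE S.τ →ₗ[ℚ] OE S.τ where
  toFun := fun x => mk _ (S.D x.1 + S.τ x.2 * w) (S.D x.2)
  map_add' := fun x z => by apply ext' <;> simp [add_mul]; abel
  map_smul' := fun q x => by apply ext' <;> simp

@[simp] lemma DO_fst (S : SDA E) (w : E) (x) : (DO S w x).1 = S.D x.1 + S.τ x.2 * w := rfl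
@[simp] lemma DO_snd (S : SDA E) (w : E) (x) : (DO S w x).2 = S.D x.2 := rfl

def sda (S : SDA E) (w : E) (hw : S.τ w = w) (hD : S.D w = 0) : SDA (OE S.τ) where
  τ := tA S.τ
  D := DO S w
  ττ := fun x => by apply ext' <;> simp [S.ττ]
  DD := fun x => by apply ext' <;> simp [S.DD, S.leib, S.Dτ, hD]
  Dτ := fun x => by
    apply ext' <;> simp [S.Dτ, S.ττ, hw]; abel
  leib := fun x z => by
    have h1 : ∀ e : E, w * e = e * w := S.comm_even w hw
    apply ext' 
    · simp [S.leib, S.ττ, mul_add, add_mul, mul_assoc, h1]; abel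
    · simp [S.leib, S.ττ, mul_add, add_mul, mul_assoc, h1, S.Dτ, hw]; abel
  comm_even := fun x hx z => by
    have h1 : S.τ x.1 = x.1 := congrArg Prod.fst hx
    have h2 : - S.τ x.2 = x.2 := congrArg Prod.snd hx
    have h3 : S.τ x.2 = - x.2 := by rw [neg_eq_iff_eq_neg] at h2; exact h2
    apply ext'
    · simp [S.comm_even _ h1 z.1]
    · simp [S.comm_even _ h1 z.2, S.comm_odd _ h3 (S.τ z.1), S.ττ, h1]; abel
  comm_odd := fun x hx z => by
    have h1 : S.τ x.1 = - x.1 := congrArg Prod.fst hx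
    have h2 : - S.τ x.2 = - x.2 := congrArg Prod.snd hx
    have h3 : S.τ x.2 = x.2 := neg_injective h2
    apply ext'
    · simp [S.comm_odd _ h1 z.1]
    · simp [S.comm_odd _ h1 z.2, S.comm_even _ h3 (S.τ z.1), h1]; abel

@[simp] lemma sda_τ_fst (S : SDA E) (w : E) (hw hD) (x) : ((sda S w hw hD).τ x).1 = S.τ x.1 := rfl
@[simp] lemma sda_τ_snd (S : SDA E) (w : E) (hw hD) (x) : ((sda S w hw hD).τ x).2 = - S.τ x.2 := rfl
@[simp] lemma sda_D_fst (S : SDA E) (w : E) (hw hD) (x) :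
    ((sda S w hw hD).D x).1 = S.D x.1 + S.τ x.2 * w := rfl
@[simp] lemma sda_D_snd (S : SDA E) (w : E) (hw hD) (x) : ((sda S w hw hD).D x).2 = S.D x.2 := rfl

end OE

namespace PE
open Polynomial
variable {E : Type} [Ring E] [Algebra ℚ E]

/-- apply an additive map coefficientwise -/
noncomputable def cw (f : E →ₗ[ℚ] E) : E[X] →ₗ[ℚ] E[X] where
  toFun p := p.sum (fun n x => monomial n (f x))
  map_add' p q := by
    apply sum_add_index <;> simp
  map_smul' q p := by
    ext n
    simp only [RingHom.id_apply, coeff_smul]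
    rw [sum_def, sum_def, finsetSum_coeff, finsetSum_coeff]
    simp only [coeff_monomial, Finset.sum_ite_eq', mem_support_iff, coeff_smul, map_smul]
    by_cases h : p.coeff n = 0
    · simp [h]
    · by_cases h' : q = 0
      · simp [h']
      · simp [h, h']

@[simp] lemma coeff_cw (f : E →ₗ[ℚ] E) (p : E[X]) (n) : (cw f p).coeff n = f (p.coeff n) := by
  simp only [cw, LinearMap.coe_mk, AddHom.coe_mk]
  rw [sum_def, finsetSum_coeff]
  simp only [coeff_monomial, Finset.sum_ite_eq', mem_support_iff]
  by_cases h : p.coeff n = 0 <;> simp [h]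

/-- algebra version -/
noncomputable def mapA (τ : E →ₐ[ℚ] E) : E[X] →ₐ[ℚ] E[X] := AlgHom.ofLinearMap (cw τ.toLinearMap)
  (by ext n; simp [coeff_one])
  (fun p q => by ext n; simp [coeff_mul])

@[simp] lemma coeff_mapA (τ : E →ₐ[ℚ] E) (p : E[X]) (n) : (mapA τ p).coeff n = τ (p.coeff n) := by
  simp [mapA]

noncomputable def DP (S : SDA E) (w : E) : E[X] →ₗ[ℚ] E[X] where
  toFun p := cw S.D p + derivative (mapA S.τ p) * C w
  map_add' p q := by simp only [map_add, add_mul]; abel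
  map_smul' q p := by simp only [map_smul, derivative_smul, smul_mul_assoc, RingHom.id_apply, smul_add]

@[simp] lemma coeff_DP (S : SDA E) (w : E) (p : E[X]) (n) :
    (DP S w p).coeff n = S.D (p.coeff n) + S.τ (p.coeff (n+1)) * (n + 1) * w := by
  simp only [DP, LinearMap.coe_mk, AddHom.coe_mk, coeff_add, coeff_cw, coeff_mul_C, coeff_derivative, coeff_mapA]

noncomputable def sda (S : SDA E) (w : E) (hw : S.τ w = - w) (hD : S.D w = 0) : SDA E[X] where
  τ := mapA S.τ
  D := DP S w
  ττ := fun x => by ext n; simp [S.ττ]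
  Dτ := fun x => by
    ext n
    simp [S.Dτ, S.ττ, hw]
    abel
  DD := fun x => by
    have hww : w * w = 0 := by
      have h1 := S.comm_odd w hw w
      rw [hw] at h1
      have h2 : (2 : ℚ) • (w * w) = 0 := by rw [two_smul]; nth_rewrite 1 [h1]; simp
      simpa using h2
    have hN : ∀ k : ℕ, S.D ((k : E)) = 0 := by
      intro k
      have h1 : S.D 1 = 0 := by
        have := S.leib 1 1
        simpa using this
      rw [← nsmul_one, map_nsmul, h1, smul_zero]
    ext n
    have hc : ((n : E) + 1) = ((n + 1 : ℕ) : E) := by push_cast; rfl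
    have hc2 : (((n + 1 : ℕ) : E) + 1) = ((n + 2 : ℕ) : E) := by push_cast; rw [add_assoc, one_add_one_eq_two]
    simp only [coeff_DP, map_add, S.DD, S.leib, S.Dτ, hD, hc, hc2, hN, map_mul, map_natCast, S.ττ, hw]
    simp only [mul_zero, add_zero, zero_add, mul_neg, coeff_zero, add_mul]
    have : x.coeff (n + 1 + 1) * ((n + 2 : ℕ) : E) * w * ((n + 1 : ℕ) : E) * w = 0 := by
      rw [mul_assoc _ ((n + 1 : ℕ) : E) w, Nat.cast_comm, ← mul_assoc, mul_assoc _ w w, hww]; simp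
    simp only [neg_mul, this]; simp
  leib := fun x z => by
    have hww : ∀ p : E[X], C w * p = mapA S.τ p * C w := by
      intro p; ext n; simp [S.comm_odd w hw]
    have h1 : cw S.D (x * z) = cw S.D x * z + mapA S.τ x * cw S.D z := by
      ext n; simp [coeff_mul, S.leib, Finset.sum_add_distrib]
    simp only [DP, LinearMap.coe_mk, AddHom.coe_mk, h1, map_mul, derivative_mul, add_mul, mul_add,
      mul_assoc, hww]
    abel
  comm_even := fun x hx z => by
    have h : ∀ n, S.τ (x.coeff n) = x.coeff n := fun n => by rw [← coeff_mapA, hx]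
    ext n
    rw [coeff_mul, coeff_mul, ← Finset.Nat.sum_antidiagonal_swap]
    exact Finset.sum_congr rfl (fun p _ => by simp [S.comm_even _ (h _)])
  comm_odd := fun x hx z => by
    have h : ∀ n, S.τ (x.coeff n) = - x.coeff n := fun n => by rw [← coeff_mapA, hx, coeff_neg]
    ext n
    rw [coeff_mul, coeff_mul, ← Finset.Nat.sum_antidiagonal_swap]
    exact Finset.sum_congr rfl (fun p _ => by simp [S.comm_odd _ (h _)])

end PE

namespace FA
variable {X Y A : Type} [Fintype X] [DecidableEq X] [Fintype Y] [DecidableEq Y]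
    [Ring A] [Algebra ℚ A] (F : FA X Y A)

lemma d_one : F.d 1 = 0 := by
  have := F.leib 1 1
  simpa using this

lemma L_mono {k l : ℕ} (h : k ≤ l) : F.L l ≤ F.L k := F.sp_mono (fun _ hb => le_trans h hb)

lemma L_zero (x : A) : x ∈ F.L 0 := by
  have : F.L 0 = ⊤ := by
    rw [L, ← F.sp_univ]; congr 1; ext; simp
  rw [this]; trivial

lemma gen_L (v : X ⊕ Y) : F.gen v ∈ F.L 1 := F.B_mem_sp (by simp [len_gi])

lemma d_L2 (x : A) : F.d x ∈ F.L 2 := by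
  have key : ∀ k, ∀ b : Idx X Y, len b = k → F.d (F.B b) ∈ F.L 2 := by
    intro k
    induction k with
    | zero =>
      intro b hb
      have : b = (0, ∅) := by
        simp only [len, Nat.add_eq_zero_iff, Finset.sum_eq_zero_iff, Finset.card_eq_zero,
          Finset.mem_univ, true_imp_iff] at hb
        exact Prod.ext (Finsupp.ext hb.1) hb.2
      rw [this, F.B_one, d_one]; exact Submodule.zero_mem _
    | succ k ih =>
      intro b hb
      obtain ⟨v, hv⟩ := exists_dv (b := b) (by omega)
      obtain ⟨b', hd, rfl⟩ := exists_of_dv hv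
      have h1 := len_add (gi v).1 b'.1 (gi v).2 b'.2 hd
      simp only [Prod.mk.eta, len_gi] at h1
      rw [F.B_eq_gen_mul hd, F.leib, F.τ_gen, map_smul]
      refine Submodule.add_mem _ ?_ ?_
      · have := F.L_mul (F.d_gen_L2 v) (F.L_zero (F.sg (gi v).2 b'.2 • F.B b'))
        exact this
      · refine F.L_mono (show 2 ≤ 1 + 2 by omega) (F.L_mul (Submodule.smul_mem _ _ (F.gen_L v))
          (Submodule.smul_mem _ _ (ih b' (by omega))))
  have h : x ∈ F.sp Set.univ := by rw [F.sp_univ]; trivial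
  exact F.sp_map_le F.d (fun b _ => key _ b rfl) h

lemma coeff_gen_L2 {v : X ⊕ Y} {x : A} (h : x ∈ F.L 2) : F.B.repr x (gi v) = 0 := by
  by_contra hc
  rw [L, mem_sp] at h
  have := h _ hc
  simp [len_gi] at this

lemma coeff_gen_IT {T} {v : X ⊕ Y} (hv : v ∉ T) {x : A} (h : x ∈ F.IT T) : F.B.repr x (gi v) = 0 := by
  by_contra hc
  rw [IT, mem_sp] at h
  obtain ⟨w, hw, hd⟩ := h _ hc
  rw [dv_gi] at hd
  exact hv (hd ▸ hw)

variable {F}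
variable {K : Type} [CommRing K] [IsDomain K] [Algebra ℚ K]

structure NSt (F : FA X Y A) (ε : A →ₐ[ℚ] K) (T : Finset (X ⊕ Y)) where
  E : Type
  [rE : Ring E]
  [aE : Algebra ℚ E]
  S : SDA E
  ι : A →ₐ[ℚ] E
  P : ℕ → Submodule ℚ E
  I : Submodule ℚ E
  Kr : Submodule ℚ E
  M : ℕ
  ε' : E →ₐ[ℚ] K
  ι_d : ∀ x, ι (F.d x) = S.D (ι x)
  ι_τ : ∀ x, ι (F.τ x) = S.τ (ι x)
  ι_L : ∀ k, ∀ x ∈ F.L k, ι x ∈ P k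
  P_zero : ∀ x, x ∈ P 0
  P_mul : ∀ {k l x z}, x ∈ P k → z ∈ P l → x * z ∈ P (k + l)
  P_τ : ∀ {k x}, x ∈ P k → S.τ x ∈ P k
  P_I : ∀ {x}, x ∈ P M → x ∈ I
  I_mul : ∀ {x z}, x ∈ I → x * z ∈ I
  I_τ : ∀ {x}, x ∈ I → S.τ x ∈ I
  I_ac : ∀ z ∈ I, S.D z = 0 → ∃ w ∈ I, S.D w = z
  K_ml : ∀ {x z}, x ∈ Kr → x * z ∈ Kr
  K_mr : ∀ {x z}, x ∈ Kr → z * x ∈ Kr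
  K_τ : ∀ {x}, x ∈ Kr → S.τ x ∈ Kr
  K_D : ∀ {x}, x ∈ Kr → S.D x ∈ Kr
  K_sur : ∀ x, ∃ a, x - ι a ∈ Kr
  K_IT : ∀ {a}, ι a ∈ Kr → a ∈ F.IT T
  IT_K : ∀ {a}, a ∈ F.IT T → ι a ∈ Kr
  K_ac : ∀ z ∈ Kr, S.D z = 0 → ∃ w ∈ Kr, S.D w = z
  Q : ∀ Ψ, S.D Ψ ∈ P 2 → ∃ q : ℚ, Ψ - q • 1 ∈ P 1
  one_nm : ∀ x ∈ Kr, (1 : E) - x ∉ P 1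
  P2 : ∀ x ∈ P 2, ∃ l ∈ F.L 2, x - ι l ∈ Kr
  ε_K : ∀ {x}, x ∈ Kr → ε' x = 0
  ε_D : ∀ x, ε' (S.D x) = 0
  ε_ι : ∀ a, ε' (ι a) = ε a

attribute [instance] NSt.rE NSt.aE

namespace NSt
variable {ε : A →ₐ[ℚ] K} {T : Finset (X ⊕ Y)} (N : NSt F ε T)

lemma q_zero {v : X ⊕ Y} (hv : v ∉ T) {w : N.E} (hw : N.ι (F.gen v) - w ∈ N.Kr) {q : ℚ} {x : N.E}
    (h : N.S.D x + q • w ∈ N.P 2) : q = 0 := by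
  obtain ⟨a, ha⟩ := N.K_sur x
  obtain ⟨l, hl, hl'⟩ := N.P2 _ h
  have h1 : N.ι (F.d a + q • F.gen v - l) ∈ N.Kr := by
    have h2 := N.K_D ha
    have h3 := Submodule.smul_mem _ q hw
    have h4 := Submodule.add_mem _ (Submodule.sub_mem _ hl' h2) h3
    convert h4 using 1
    rw [map_sub, map_add, map_sub, N.ι_d, map_smul, smul_sub]
    abel
  have h5 := F.coeff_gen_IT hv (N.K_IT h1)
  rw [map_sub, map_add, map_smul] at h5
  simp only [Finsupp.sub_apply, Finsupp.add_apply, Finsupp.smul_apply, F.coeff_gen_L2 hl,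
    F.coeff_gen_L2 (F.d_L2 a)] at h5
  simpa [gen] using h5

/-- the closed representative of the generator -/
lemma exists_w (hT : F.Low T) {v : X ⊕ Y} (hv : F.MinLive T v) :
    ∃ w : N.E, N.ι (F.gen v) - w ∈ N.Kr ∧ N.S.τ w = (sn v : ℚ) • w ∧ N.S.D w = 0 ∧ w ∈ N.P 1 := by
  have hdv := F.d_gen_IT hv.2
  obtain ⟨Ψ, hΨ, hD⟩ := N.K_ac _ (N.IT_K hdv) (by rw [← N.ι_d, F.d_sq, map_zero])
  set s : ℚ := sn v with hs
  have hss : s * s = 1 := by rw [hs]; cases v <;> simp [sn]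
  have hτ : F.τ (F.gen v) = s • F.gen v := F.τ_gen v
  set Φ : N.E := (1/2 : ℚ) • (Ψ + s • N.S.τ Ψ) with hΦ
  have hΦK : Φ ∈ N.Kr := Submodule.smul_mem _ _ (Submodule.add_mem _ hΨ
    (Submodule.smul_mem _ _ (N.K_τ hΨ)))
  have hΦD : N.S.D Φ = N.ι (F.d (F.gen v)) := by
    have h1 : N.S.D (N.S.τ Ψ) = s • N.ι (F.d (F.gen v)) := by
      rw [N.S.Dτ, hD, ← N.ι_τ, ← map_neg, ← F.d_τ, hτ, map_smul, map_smul]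
    rw [hΦ, map_smul, map_add, map_smul, h1, hD, smul_smul, hss, one_smul, ← two_smul ℚ, smul_smul]
    norm_num
  have hΦτ : N.S.τ Φ = s • Φ := by
    rw [hΦ, map_smul, map_add, map_smul, N.S.ττ, smul_comm s, smul_add s, smul_smul s s, hss, one_smul,
      add_comm]
  have hΦP : Φ ∈ N.P 1 := by
    obtain ⟨q, hq⟩ := N.Q Φ (by rw [hΦD]; exact N.ι_L _ _ (F.d_gen_L2 v))
    by_cases h0 : q = 0
    · simpa [h0] using hq
    · exfalso
      refine N.one_nm (q⁻¹ • Φ) (Submodule.smul_mem _ _ hΦK) ?_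
      clear_value Φ
      have := Submodule.smul_mem _ (-q⁻¹) hq
      rw [smul_sub, smul_smul (-q⁻¹) q] at this
      convert this using 1
      rw [neg_mul, inv_mul_cancel₀ h0]
      simp
      abel
  refine ⟨N.ι (F.gen v) - Φ, by simpa using hΦK, ?_, ?_, ?_⟩
  · rw [map_sub, ← N.ι_τ, hτ, hΦτ, map_smul, smul_sub]
  · rw [map_sub, ← N.ι_d, hΦD, sub_self]
  · exact Submodule.sub_mem _ (N.ι_L _ _ (F.gen_L v)) hΦP

lemma D_pow (S : N.E) (hτ : N.S.D S = 0) (k : ℕ) : N.S.D (S ^ k) = 0 := by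
  induction k with
  | zero =>
    have := N.S.leib 1 1
    simpa using this
  | succ k ih => rw [pow_succ, N.S.leib, ih, hτ]; simp

lemma pow_P {w : N.E} (h : w ∈ N.P 1) (k : ℕ) : w ^ k ∈ N.P k := by
  induction k with
  | zero => exact N.P_zero _
  | succ k ih => rw [pow_succ]; exact N.P_mul ih h

/-- the augmentation kills the generator -/
lemma ε_gen {v : X ⊕ Y} {w : N.E} (hw : N.ι (F.gen v) - w ∈ N.Kr)
    (hD : N.S.D w = 0) (hP : w ∈ N.P 1) : ε (F.gen v) = 0 ∧ N.ε' w = 0 := by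
  have h1 : ε (F.gen v) = N.ε' w := by
    have := N.ε_K hw
    rw [map_sub, N.ε_ι, sub_eq_zero] at this; exact this
  obtain ⟨z, _, hz⟩ := N.I_ac _ (N.P_I (N.pow_P hP N.M)) (N.D_pow w hD _)
  have h2 : (N.ε' w) ^ N.M = 0 := by rw [← map_pow, ← hz, N.ε_D]
  have h3 := eq_zero_of_pow_eq_zero h2
  exact ⟨h1.trans h3, h3⟩

end NSt
end FA

namespace FA
variable {X Y A : Type} [Fintype X] [DecidableEq X] [Fintype Y] [DecidableEq Y]
    [Ring A] [Algebra ℚ A] {F : FA X Y A}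
variable {K : Type} [CommRing K] [IsDomain K] [Algebra ℚ K]

namespace NSt
variable {ε : A →ₐ[ℚ] K} {T : Finset (X ⊕ Y)} (N : NSt F ε T)

/-- the ideal generated by the kernel and the new closed element -/
def Kw (w : N.E) : Submodule ℚ N.E := N.Kr ⊔ LinearMap.range (LinearMap.mulLeft ℚ w)

lemma mem_Kw {w x : N.E} : x ∈ N.Kw w ↔ ∃ e, x - w * e ∈ N.Kr := by
  rw [Kw, Submodule.mem_sup]
  constructor
  · rintro ⟨k, hk, _, ⟨e, rfl⟩, rfl⟩
    exact ⟨e, by simpa using hk⟩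
  · rintro ⟨e, he⟩
    exact ⟨_, he, _, ⟨e, rfl⟩, by simp⟩

lemma Kr_le {w x : N.E} (h : x ∈ N.Kr) : x ∈ N.Kw w := N.mem_Kw.2 ⟨0, by simpa using h⟩

lemma w_mem {w : N.E} (e : N.E) : w * e ∈ N.Kw w := N.mem_Kw.2 ⟨e, by simp⟩

/-- data of the closed representative -/
structure IsW (v : X ⊕ Y) (w : N.E) : Prop where
  nv : v ∉ T
  rep : N.ι (F.gen v) - w ∈ N.Kr
  τw : N.S.τ w = (sn v : ℚ) • w
  Dw : N.S.D w = 0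
  Pw : w ∈ N.P 1
  cw : ∀ z, ∃ z', z * w = w * z'

lemma exists_isW {v : X ⊕ Y} (hT : F.Low T) (hv : F.MinLive T v) : ∃ w, N.IsW v w := by
  obtain ⟨w, h1, h2, h3, h4⟩ := N.exists_w hT hv
  refine ⟨w, hv.1, h1, h2, h3, h4, ?_⟩
  intro z
  cases v with
  | inl i => exact ⟨z, (N.S.comm_even w (by simpa [sn] using h2) z).symm⟩
  | inr j =>
    refine ⟨N.S.τ z, ?_⟩
    rw [N.S.comm_odd w (by simpa [sn] using h2), N.S.ττ]

variable {N} {v : X ⊕ Y} {w : N.E}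

lemma w_mem' (W : N.IsW v w) (e : N.E) : e * w ∈ N.Kw w := by
  obtain ⟨z', h⟩ := W.cw e
  rw [h]; exact N.w_mem _

lemma Kw_ml (W : N.IsW v w) {x z : N.E} (h : x ∈ N.Kw w) : x * z ∈ N.Kw w := by
  rw [mem_Kw] at h ⊢
  obtain ⟨e, he⟩ := h
  exact ⟨e * z, by rw [← mul_assoc, ← sub_mul]; exact N.K_ml he⟩

lemma Kw_mr (W : N.IsW v w) {x z : N.E} (h : x ∈ N.Kw w) : z * x ∈ N.Kw w := by
  rw [mem_Kw] at h ⊢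
  obtain ⟨e, he⟩ := h
  obtain ⟨z', hz⟩ := W.cw z
  exact ⟨z' * e, by rw [← mul_assoc, ← hz, mul_assoc, ← mul_sub]; exact N.K_mr he⟩

lemma Kw_τ (W : N.IsW v w) {x : N.E} (h : x ∈ N.Kw w) : N.S.τ x ∈ N.Kw w := by
  rw [mem_Kw] at h ⊢
  obtain ⟨e, he⟩ := h
  refine ⟨(sn v : ℚ) • N.S.τ e, ?_⟩
  have := N.K_τ he
  rw [map_sub, map_mul, W.τw] at this
  simpa using this

lemma Kw_D (W : N.IsW v w) {x : N.E} (h : x ∈ N.Kw w) : N.S.D x ∈ N.Kw w := by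
  rw [mem_Kw] at h ⊢
  obtain ⟨e, he⟩ := h
  refine ⟨(sn v : ℚ) • N.S.D e, ?_⟩
  have := N.K_D he
  rw [map_sub, N.S.leib, W.τw, W.Dw] at this
  simpa using this

lemma Kw_IT (W : N.IsW v w) {a : A} (h : N.ι a ∈ N.Kw w) : a ∈ F.IT (insert v T) := by
  rw [mem_Kw] at h
  obtain ⟨e, he⟩ := h
  obtain ⟨e', he'⟩ := N.K_sur e
  have h1 : N.ι (a - F.gen v * e') ∈ N.Kr := by
    have h2 := N.K_mr (z := w) he'
    have h3 := N.K_ml (z := N.ι e') W.rep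
    have h4 := Submodule.sub_mem _ (Submodule.add_mem _ he h2) h3
    convert h4 using 1
    rw [map_sub, map_mul, mul_sub, sub_mul]; abel
  have h5 := F.IT_mono (Finset.subset_insert v T) (N.K_IT h1)
  have h6 := F.IT_mul_left (z := e') (F.gen_mem_IT (Finset.mem_insert_self v T))
  have := Submodule.add_mem _ h5 h6
  simpa using this

lemma IT_Kw (W : N.IsW v w) {a : A} (h : a ∈ F.IT (insert v T)) : N.ι a ∈ N.Kw w := by
  obtain ⟨z, _, k, hk, _, rfl⟩ := F.IT_insert (s := Set.univ) h (by rw [F.sp_univ]; trivial)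
  rw [mem_Kw]
  refine ⟨N.ι z, ?_⟩
  have h3 := Submodule.add_mem _ (N.K_ml (z := N.ι z) W.rep) (N.IT_K hk)
  convert h3 using 1
  rw [map_add, map_mul, sub_mul]; abel

lemma Kw_one (W : N.IsW v w) (x : N.E) (h : x ∈ N.Kw w) : (1 : N.E) - x ∉ N.P 1 := by
  rw [mem_Kw] at h
  obtain ⟨e, he⟩ := h
  intro hc
  refine N.one_nm _ he ?_
  have := Submodule.add_mem _ hc (N.P_mul W.Pw (N.P_zero e))
  convert this using 1; abel

lemma Kw_ε (W : N.IsW v w) {x : N.E} (h : x ∈ N.Kw w) : N.ε' x = 0 := by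
  rw [mem_Kw] at h
  obtain ⟨e, he⟩ := h
  have := N.ε_K he
  rw [map_sub, map_mul, (N.ε_gen W.rep W.Dw W.Pw).2] at this
  simpa using this

lemma gen_K (W : N.IsW v w) {z : A} : F.gen v * z ∈ F.IT T ↔ w * N.ι z ∈ N.Kr := by
  have h := N.K_ml (z := N.ι z) W.rep
  rw [sub_mul, ← map_mul] at h
  constructor
  · intro h1
    have := Submodule.sub_mem _ (N.IT_K h1) h
    simpa using this
  · intro h1
    have := Submodule.add_mem _ h1 h
    exact N.K_IT (by simpa using this)

open OE
/-- coefficientwise submodule -/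
def cs {E : Type} [Ring E] [Algebra ℚ E] (τ : E →ₐ[ℚ] E) (p q : Submodule ℚ E) : Submodule ℚ (OE τ) where
  carrier := {x | x.1 ∈ p ∧ x.2 ∈ q}
  add_mem' := fun ha hb => ⟨Submodule.add_mem _ ha.1 hb.1, Submodule.add_mem _ ha.2 hb.2⟩
  zero_mem' := ⟨Submodule.zero_mem _, Submodule.zero_mem _⟩
  smul_mem' := fun c _ ha => ⟨Submodule.smul_mem _ c ha.1, Submodule.smul_mem _ c ha.2⟩

lemma mem_cs {E : Type} [Ring E] [Algebra ℚ E] {τ : E →ₐ[ℚ] E} {p q : Submodule ℚ E} {x : OE τ} :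
  x ∈ cs τ p q ↔ x.1 ∈ p ∧ x.2 ∈ q := Iff.rfl

noncomputable def stepEven {i : X} {w : N.E} (W : N.IsW (Sum.inl i) w) : NSt F ε (insert (Sum.inl i) T) :=
  have hτ : N.S.τ w = w := by simpa [sn] using W.τw
  have εw : N.ε' w = 0 := (N.ε_gen W.rep W.Dw W.Pw).2
  { E := OE N.S.τ
    S := OE.sda N.S w hτ W.Dw
    ι := (OE.inc N.S.τ).comp N.ι
    P := fun k => cs _ (N.P k) (N.P k)
    I := cs _ N.I N.I
    Kr := cs _ (N.Kw w) ⊤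
    M := N.M
    ε' := N.ε'.comp (OE.fs N.S.τ)
    ι_d := fun x => by apply OE.ext' <;> simp [N.ι_d]
    ι_τ := fun x => by apply OE.ext' <;> simp [N.ι_τ]
    ι_L := fun k x hx => ⟨N.ι_L k x hx, Submodule.zero_mem _⟩
    P_zero := fun x => ⟨N.P_zero _, N.P_zero _⟩
    P_mul := fun {k l x z} hx hz => ⟨N.P_mul hx.1 hz.1,
      Submodule.add_mem _ (N.P_mul hx.1 hz.2) (N.P_mul hx.2 (N.P_τ hz.1))⟩
    P_τ := fun {k x} hx => ⟨N.P_τ hx.1, Submodule.neg_mem _ (N.P_τ hx.2)⟩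
    P_I := fun {x} hx => ⟨N.P_I hx.1, N.P_I hx.2⟩
    I_mul := fun {x z} hx => ⟨N.I_mul hx.1, Submodule.add_mem _ (N.I_mul hx.1) (N.I_mul hx.2)⟩
    I_τ := fun {x} hx => ⟨N.I_τ hx.1, Submodule.neg_mem _ (N.I_τ hx.2)⟩
    I_ac := fun z hz hD => by
      have h1 : N.S.D z.1 + N.S.τ z.2 * w = 0 := congrArg Prod.fst hD
      have h2 : N.S.D z.2 = 0 := congrArg Prod.snd hD
      obtain ⟨u, hu, rfl'⟩ := N.I_ac _ hz.2 h2
      obtain ⟨e, he, he'⟩ := N.I_ac (z.1 - N.S.τ u * w)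
        (Submodule.sub_mem _ hz.1 (N.I_mul (N.I_τ hu))) (by
          rw [map_sub, N.S.leib, N.S.ττ, W.Dw, N.S.Dτ, rfl', eq_neg_of_add_eq_zero_left h1]; simp)
      exact ⟨OE.mk _ e u, ⟨he, hu⟩, by apply OE.ext' <;> simp [he', rfl']⟩
    K_ml := fun {x z} hx => ⟨Kw_ml W hx.1, trivial⟩
    K_mr := fun {x z} hx => ⟨Kw_mr W hx.1, trivial⟩
    K_τ := fun {x} hx => ⟨Kw_τ W hx.1, trivial⟩
    K_D := fun {x} hx => ⟨Submodule.add_mem _ (Kw_D W hx.1) (w_mem' W _), trivial⟩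
    K_sur := fun x => by
      obtain ⟨a, ha⟩ := N.K_sur x.1
      exact ⟨a, N.Kr_le ha, trivial⟩
    K_IT := fun {a} h => Kw_IT W h.1
    IT_K := fun {a} h => ⟨IT_Kw W h, trivial⟩
    K_ac := fun z hz hD => by
      have h1 : N.S.D z.1 + N.S.τ z.2 * w = 0 := congrArg Prod.fst hD
      have h2 : N.S.D z.2 = 0 := congrArg Prod.snd hD
      obtain ⟨e, he⟩ := N.mem_Kw.1 hz.1
      set b := z.2 - N.S.D (N.S.τ e) with hb
      have hbK : b ∈ N.Kr := by
        have h3 : w * N.S.τ b ∈ N.Kr := by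
          have h4 := Submodule.neg_mem _ (N.K_D he)
          convert h4 using 1
          rw [map_sub N.S.D, eq_neg_of_add_eq_zero_left h1, N.S.leib, W.Dw, hτ, hb, map_sub, N.S.Dτ,
            map_neg, N.S.ττ, mul_sub, N.S.comm_even w hτ (N.S.τ z.2)]
          simp; abel
        obtain ⟨b', hb'⟩ := N.K_sur (N.S.τ b)
        have h5 : F.gen (Sum.inl i) * b' ∈ F.IT T := by
          rw [gen_K W]
          have := Submodule.sub_mem _ h3 (N.K_mr (z := w) hb')
          convert this using 1
          rw [mul_sub]; abel
        have h6 := N.IT_K (F.regular_even W.nv h5)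
        have h7 := Submodule.add_mem _ hb' h6
        have h8 := N.K_τ h7
        simpa [N.S.ττ] using h8
      obtain ⟨b2, hb2, hb2'⟩ := N.K_ac b hbK (by rw [hb, map_sub, h2, N.S.DD, sub_zero])
      obtain ⟨k, hk, hk'⟩ := N.K_ac (z.1 - w * e - N.S.τ b2 * w)
        (Submodule.sub_mem _ he (N.K_ml (N.K_τ hb2))) (by
          rw [map_sub, map_sub, eq_neg_of_add_eq_zero_left h1, N.S.leib, N.S.leib, W.Dw, N.S.Dτ, hb2', hτ,
            hb, map_sub, N.S.Dτ, map_neg, N.S.ττ, N.S.comm_even w hτ]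
          simp [add_mul]; abel)
      refine ⟨OE.mk _ k (N.S.τ e + b2), ⟨N.Kr_le hk, trivial⟩, ?_⟩
      apply OE.ext'
      · simp [hk', N.S.ττ, add_mul, N.S.comm_even w hτ]
      · simp [hb2', hb]
    Q := fun Ψ hΨ => by
      have h1 : N.S.D Ψ.1 + N.S.τ Ψ.2 * w ∈ N.P 2 := hΨ.1
      obtain ⟨q, hq⟩ := N.Q Ψ.2 hΨ.2
      have h2 := N.P_mul (N.P_τ hq) W.Pw
      have hq0 : q = 0 := by
        refine N.q_zero W.nv W.rep (x := Ψ.1) ?_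
        have := Submodule.sub_mem _ h1 h2
        convert this using 1
        rw [map_sub, map_smul, map_one, sub_mul, smul_mul_assoc, one_mul]; abel
      subst hq0
      obtain ⟨q', hq'⟩ := N.Q Ψ.1 (by
        have := Submodule.sub_mem _ h1 h2
        simpa using this)
      exact ⟨q', hq', by simpa using hq⟩
    one_nm := fun x hx hc => Kw_one W x.1 hx.1 hc.1
    P2 := fun x hx => by
      obtain ⟨l, hl, hl'⟩ := N.P2 _ hx.1
      exact ⟨l, hl, N.Kr_le hl', trivial⟩
    ε_K := fun {x} hx => Kw_ε W hx.1
    ε_D := fun x => by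
      show N.ε' (N.S.D x.1 + N.S.τ x.2 * w) = 0
      rw [map_add, N.ε_D, map_mul, εw]; simp
    ε_ι := fun a => N.ε_ι a }

end NSt
end FA

namespace PE
open Polynomial
variable {E : Type} [Ring E] [Algebra ℚ E]

/-- coefficientwise submodule -/
def cs (p : Submodule ℚ E) : Submodule ℚ E[X] where
  carrier := {x | ∀ n, x.coeff n ∈ p}
  add_mem' := fun ha hb n => by rw [coeff_add]; exact Submodule.add_mem _ (ha n) (hb n)
  zero_mem' := fun n => by rw [coeff_zero]; exact Submodule.zero_mem _
  smul_mem' := fun c x ha n => by rw [coeff_smul]; exact Submodule.smul_mem _ c (ha n)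

lemma mem_cs {p : Submodule ℚ E} {x : E[X]} : x ∈ cs p ↔ ∀ n, x.coeff n ∈ p := Iff.rfl

/-- condition on the constant coefficient -/
def c0 (p : Submodule ℚ E) : Submodule ℚ E[X] where
  carrier := {x | x.coeff 0 ∈ p}
  add_mem' := fun {a b} ha hb => by
    show (a + b).coeff 0 ∈ p
    rw [coeff_add]; exact Submodule.add_mem _ ha hb
  zero_mem' := by show (0 : E[X]).coeff 0 ∈ p; rw [coeff_zero]; exact Submodule.zero_mem _
  smul_mem' := fun c x ha => by show (c • x).coeff 0 ∈ p; rw [coeff_smul]; exact Submodule.smul_mem _ c ha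

lemma mem_c0 {p : Submodule ℚ E} {x : E[X]} : x ∈ c0 p ↔ x.coeff 0 ∈ p := Iff.rfl

@[simp] lemma sda_τ (S : SDA E) (w hw hD) (p : E[X]) (n) :
   ((sda S w hw hD).τ p).coeff n = S.τ (p.coeff n) := coeff_mapA _ _ _

@[simp] lemma sda_D (S : SDA E) (w hw hD) (p : E[X]) (n) :
   ((sda S w hw hD).D p).coeff n = S.D (p.coeff n) + S.τ (p.coeff (n+1)) * (n + 1) * w := coeff_DP _ _ _ _

lemma cs_ac (S : SDA E) (w : E) (hw : S.τ w = - w) (hD : S.D w = 0) (J : Submodule ℚ E)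
    (J_mul : ∀ {x z}, x ∈ J → x * z ∈ J) (J_τ : ∀ {x}, x ∈ J → S.τ x ∈ J)
    (J_ac : ∀ z ∈ J, S.D z = 0 → ∃ u ∈ J, S.D u = z) (z : E[X]) (hz : z ∈ cs J)
    (hDz : (sda S w hw hD).D z = 0) : ∃ u ∈ cs J, (sda S w hw hD).D u = z := by
  have key : ∀ N, ∀ z : E[X], z ∈ cs J → (∀ n, N ≤ n → z.coeff n = 0) → (sda S w hw hD).D z = 0 →
      ∃ u ∈ cs J, (sda S w hw hD).D u = z := by
    intro N
    induction N with
    | zero =>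
      intro z hz h0 _
      have : z = 0 := by ext n; simpa using h0 n (Nat.zero_le _)
      exact ⟨0, Submodule.zero_mem _, by rw [this, map_zero]⟩
    | succ N ih =>
      intro z hz h0 hDz
      have h1 : S.D (z.coeff N) = 0 := by
        have := congrArg (fun p => p.coeff N) hDz
        simpa [h0 (N+1) le_rfl] using this
      obtain ⟨u, hu, hu'⟩ := J_ac _ (hz N) h1
      have hm : monomial N u ∈ cs J := by
        intro n
        rw [coeff_monomial]
        split_ifs
        · exact hu
        · exact Submodule.zero_mem _
      have hmD : (sda S w hw hD).D (monomial N u) ∈ cs J := by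
        intro n
        rw [sda_D]
        refine Submodule.add_mem _ ?_ (J_mul (J_mul (J_τ (hm _))))
        rw [coeff_monomial]
        split_ifs
        · rw [hu']; exact hz N
        · rw [map_zero]; exact Submodule.zero_mem _
      obtain ⟨u2, hu2, hu2'⟩ := ih (z - (sda S w hw hD).D (monomial N u)) (Submodule.sub_mem _ hz hmD) (by
        intro n hn
        rw [coeff_sub, sda_D, coeff_monomial, coeff_monomial, if_neg (by omega : N ≠ n + 1)]
        rcases Nat.eq_or_lt_of_le hn with rfl | h
        · simp [hu']
        · rw [if_neg (by omega), h0 n h]; simp) (by rw [map_sub, hDz, (sda S w hw hD).DD, sub_zero])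
      exact ⟨monomial N u + u2, Submodule.add_mem _ hm hu2, by rw [map_add, hu2']; abel⟩
  exact key (z.natDegree + 1) z hz (fun n hn => coeff_eq_zero_of_natDegree_lt (by omega)) hDz

end PE

namespace FA
variable {X Y A : Type} [Fintype X] [DecidableEq X] [Fintype Y] [DecidableEq Y]
    [Ring A] [Algebra ℚ A] {F : FA X Y A}

lemma exists_wt_bound (F : FA X Y A) (x : A) : ∃ M, x ∈ F.sp {b | F.wt b ≤ M} := by
  refine ⟨(F.B.repr x).support.sup F.wt, ?_⟩
  rw [mem_sp]
  intro b hb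
  exact Finset.le_sup (f := F.wt) (Finsupp.mem_support_iff.2 hb)

/-- The recursion for the odd step. -/
lemma exists_beta {T} (hT : F.Low T) {j0 : Y} (hv : F.MinLive T (Sum.inr j0)) (α : ℕ → A) (n0 : ℕ)
    (h0 : ∀ n, n0 ≤ n → α n = 0) (hα0 : α 0 ∈ F.IT (insert (Sum.inr j0) T))
    (hc : ∀ n, F.d (α n) + ((n : ℚ) + 1) • (F.τ (α (n+1)) * F.gen (Sum.inr j0)) ∈ F.IT T) :
    ∃ β : ℕ → A, ∃ N, β 0 = 0 ∧ (∀ n, N < n → β n = 0) ∧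
      ∀ n, α n - F.d (β n) - ((n : ℚ) + 1) • (F.τ (β (n+1)) * F.gen (Sum.inr j0)) ∈ F.IT T := by
  set v : X ⊕ Y := Sum.inr j0 with hvd
  have hτv : F.τ (F.gen v) = - F.gen v := by rw [F.τ_gen]; simp [hvd, sn]
  have hvc : ∀ z, F.gen v * z = F.τ z * F.gen v := F.comm_odd hτv
  have hdv : F.d (F.gen v) ∈ F.IT T := F.d_gen_IT hv.2
  obtain ⟨N, hN⟩ : ∃ N, ∀ j, α j ∈ F.sp {b | F.wt b + j ≤ N + 1} := by
    choose M hM using fun j => F.exists_wt_bound (α j)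
    refine ⟨(Finset.range n0).sup (fun j => M j + j), fun j => ?_⟩
    by_cases hj : j < n0
    · refine F.sp_mono ?_ (hM j)
      intro b hb
      have h1 : F.wt b ≤ M j := hb
      have h2 := Finset.le_sup (f := fun j => M j + j) (Finset.mem_range.2 hj)
      rw [Set.mem_ofPred_eq]
      omega
    · rw [h0 j (by omega)]; exact Submodule.zero_mem _
  -- one step
  have step : ∀ (j : ℕ) (b : A), b ∈ F.sp {c | F.wt c + j ≤ N} → α j - F.d b ∈ F.IT (insert v T) →
      ∃ b' ∈ F.sp {c | F.wt c + (j + 1) ≤ N}, α j - F.d b - ((j : ℚ) + 1) • (F.τ b' * F.gen v) ∈ F.IT T ∧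
        α (j+1) - F.d b' ∈ F.IT (insert v T) := by
    intro j b hb hI
    have hdb : F.d b ∈ F.sp {c | F.wt c + j ≤ N + 1} := by
      refine F.sp_map_le F.d ?_ hb
      intro c hc
      have hc' : F.wt c + j ≤ N := hc
      refine F.sp_mono ?_ (F.d_B c)
      intro c' h
      have : F.wt c' = F.wt c + 1 := h
      rw [Set.mem_ofPred_eq]
      omega
    obtain ⟨z, hz, k, hk, _, hx⟩ := F.IT_insert hI (Submodule.sub_mem _ (hN j) hdb)
    have hj : ((j : ℚ) + 1) ≠ 0 := by positivity
    have hz' : z ∈ F.sp {c | F.wt c + (j + 1) ≤ N} := by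
      refine F.sp_mono ?_ hz
      rintro c ⟨hc1, hc2⟩
      have h1 := F.wt_add (gi v).1 c.1 (gi v).2 c.2 hc1
      have h2 := F.wt_gi v
      have h3 := F.two_le_deg v
      have h4 : F.wt ((gi v).1 + c.1, (gi v).2 ∪ c.2) + j ≤ N + 1 := hc2
      simp only [Prod.mk.eta] at h1
      rw [Set.mem_ofPred_eq]
      omega
    set b' := ((j : ℚ) + 1)⁻¹ • z with hb'
    have e1 : ((j : ℚ) + 1) • (F.τ b' * F.gen v) = F.gen v * z := by
      rw [hb', map_smul, smul_mul_assoc, smul_smul, mul_inv_cancel₀ hj, one_smul, hvc]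
    have hcl : α j - F.d b - ((j : ℚ) + 1) • (F.τ b' * F.gen v) ∈ F.IT T := by
      rw [e1, hx]; simpa using hk
    refine ⟨b', Submodule.smul_mem _ _ hz', hcl, ?_⟩
    refine F.regular_odd hv.1 ?_
    have h1 := F.d_IT hT hcl
    rw [map_sub, map_sub, F.d_sq, sub_zero, map_smul, F.leib, F.d_τ, F.τ_τ] at h1
    have h2 := Submodule.smul_mem _ ((j : ℚ) + 1)  (F.IT_mul_right (z := b') hdv)
    have h3 := Submodule.sub_mem _ (hc j) (Submodule.add_mem _ h1 h2)
    have h4 := Submodule.smul_mem _ ((j : ℚ) + 1)⁻¹ h3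
    convert h4 using 1
    rw [hvc, map_sub, sub_mul]
    have e2 : F.d (α j) + ((j : ℚ) + 1) • (F.τ (α (j + 1)) * F.gen v) -
        (F.d (α j) - ((j : ℚ) + 1) • (-F.τ (F.d b') * F.gen v + b' * F.d (F.gen v))
        + ((j : ℚ) + 1) • (b' * F.d (F.gen v))) = ((j : ℚ) + 1) • (F.τ (α (j + 1)) * F.gen v -
          F.τ (F.d b') * F.gen v) := by
      rw [smul_add, smul_sub, neg_mul, smul_neg]; abel
    rw [e2, smul_smul, inv_mul_cancel₀ hj, one_smul]
  choose! st hst1 hst2 hst3 using step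
  let β : ℕ → A := fun n => Nat.rec 0 (fun j b => st j b) n
  have hβ0 : β 0 = 0 := rfl
  have hβs : ∀ j, β (j+1) = st j (β j) := fun j => rfl
  have inv : ∀ j, β j ∈ F.sp {c | F.wt c + j ≤ N} ∧ α j - F.d (β j) ∈ F.IT (insert v T) := by
    intro j
    induction j with
    | zero =>
      rw [hβ0]
      exact ⟨Submodule.zero_mem _, by simpa using hα0⟩
    | succ j ih =>
      rw [hβs]
      exact ⟨hst1 j _ ih.1 ih.2, hst3 j _ ih.1 ih.2⟩
  refine ⟨β, N, hβ0, fun n hn => ?_, fun n => ?_⟩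
  · have := (inv n).1
    have he : {c | F.wt c + n ≤ N} = (∅ : Set (Idx X Y)) := by
      ext c; simp; omega
    rw [he, F.sp_empty] at this
    simpa using this
  · rw [hβs]; exact hst2 n _ (inv n).1 (inv n).2

variable {K : Type} [CommRing K] [IsDomain K] [Algebra ℚ K]

namespace NSt
variable {ε : A →ₐ[ℚ] K} {T : Finset (X ⊕ Y)} {N : NSt F ε T}
open Polynomial

noncomputable def stepOdd (hT : F.Low T) {j : Y} (hv : F.MinLive T (Sum.inr j)) {w : N.E}
    (W : N.IsW (Sum.inr j) w) : NSt F ε (insert (Sum.inr j) T) :=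
  have hτ : N.S.τ w = - w := by simpa [sn] using W.τw
  have εw : N.ε' w = 0 := (N.ε_gen W.rep W.Dw W.Pw).2
  { E := N.E[X]
    S := PE.sda N.S w hτ W.Dw
    ι := CAlgHom.comp N.ι
    P := fun k => PE.cs (N.P k)
    I := PE.cs N.I
    Kr := PE.c0 (N.Kw w)
    M := N.M
    ε' := N.ε'.comp (AlgHom.ofLinearMap ((Polynomial.lcoeff N.E 0).restrictScalars ℚ) (by simp)
      (by intro x z; simp [mul_coeff_zero]))
    ι_d := fun x => by ext n; simp [N.ι_d, coeff_C]; split_ifs <;> simp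
    ι_τ := fun x => by ext n; simp [N.ι_τ, coeff_C]; split_ifs <;> simp
    ι_L := fun k x hx => by
      intro n
      show (C (N.ι x)).coeff n ∈ _
      rw [coeff_C]; split_ifs
      · exact N.ι_L k x hx
      · exact Submodule.zero_mem _
    P_zero := fun x n => N.P_zero _
    P_mul := fun {k l x z} hx hz n => by
      rw [coeff_mul]
      exact Submodule.sum_mem _ (fun p _ => N.P_mul (hx _) (hz _))
    P_τ := fun {k x} hx n => by rw [PE.sda_τ]; exact N.P_τ (hx n)
    P_I := fun {x} hx n => N.P_I (hx n)
    I_mul := fun {x z} hx n => by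
      rw [coeff_mul]
      exact Submodule.sum_mem _ (fun p _ => N.I_mul (hx _))
    I_τ := fun {x} hx n => by rw [PE.sda_τ]; exact N.I_τ (hx n)
    I_ac := fun z hz hD => PE.cs_ac N.S w hτ W.Dw N.I N.I_mul N.I_τ N.I_ac z hz hD
    K_ml := fun {x z} hx => by
      rw [PE.mem_c0] at hx ⊢
      rw [mul_coeff_zero]; exact Kw_ml W hx
    K_mr := fun {x z} hx => by
      rw [PE.mem_c0] at hx ⊢
      rw [mul_coeff_zero]; exact Kw_mr W hx
    K_τ := fun {x} hx => by
      rw [PE.mem_c0] at hx ⊢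
      rw [PE.sda_τ]; exact Kw_τ W hx
    K_D := fun {x} hx => by
      rw [PE.mem_c0] at hx ⊢
      rw [PE.sda_D]; exact Submodule.add_mem _ (Kw_D W hx) (w_mem' W _)
    K_sur := fun x => by
      obtain ⟨a, ha⟩ := N.K_sur (x.coeff 0)
      refine ⟨a, ?_⟩
      rw [PE.mem_c0]
      show (x - C (N.ι a)).coeff 0 ∈ _
      rw [coeff_sub, coeff_C_zero]; exact N.Kr_le ha
    K_IT := fun {a} h => by
      rw [PE.mem_c0] at h
      have h : (C (N.ι a)).coeff 0 ∈ N.Kw w := h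
      rw [coeff_C_zero] at h
      exact Kw_IT W h
    IT_K := fun {a} h => by
      show (C (N.ι a)).coeff 0 ∈ N.Kw w
      rw [coeff_C_zero]
      exact IT_Kw W h
    K_ac := fun z hz hD => by
      rw [PE.mem_c0] at hz
      have hcast : ∀ n : ℕ, ((n : N.E) + 1) = ((n : ℚ) + 1) • (1 : N.E) := by
        intro n; rw [add_smul, one_smul]; simp [Nat.cast_smul_eq_nsmul]
      have hD' : ∀ n, N.S.D (z.coeff n) + ((n : ℚ) + 1) • (N.S.τ (z.coeff (n+1)) * w) = 0 := by
        intro n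
        have := congrArg (fun p => p.coeff n) hD
        simp only [PE.sda_D, hcast, coeff_zero, mul_smul_comm, smul_mul_assoc, mul_one] at this
        exact this
      classical
      choose f hf using N.K_sur
      set α : ℕ → A := fun n => if z.coeff n = 0 then 0 else f (z.coeff n) with hα
      have hαK : ∀ n, z.coeff n - N.ι (α n) ∈ N.Kr := by
        intro n
        by_cases h : z.coeff n = 0
        · simp [hα, h]
        · simp only [hα, h, if_false]; exact hf _
      have hwr : ∀ x : A, N.ι x * w - N.ι (x * F.gen (Sum.inr j)) ∈ N.Kr := by
        intro x
        have := Submodule.neg_mem _ (N.K_mr (z := N.ι x) W.rep)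
        rw [map_mul]; convert this using 1; rw [mul_sub]; abel
      obtain ⟨β, M, hβ0, hβM, hβ⟩ := exists_beta hT hv α (z.natDegree + 1)
        (fun n hn => by simp [hα, coeff_eq_zero_of_natDegree_lt (show z.natDegree < n by omega)])
        (by
          refine Kw_IT W ?_
          have := Submodule.sub_mem _ hz (N.Kr_le (w := w) (hαK 0))
          simpa using this)
        (by
          intro n
          refine N.K_IT ?_
          have h1 := N.K_D (hαK n)
          have h2 := N.K_ml (z := w) (N.K_τ (hαK (n+1)))
          have h3 := Submodule.smul_mem _ ((n : ℚ) + 1)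
            (Submodule.add_mem _ h2 (hwr (F.τ (α (n+1)))))
          have h4 := Submodule.neg_mem _ (Submodule.add_mem _ h1 h3)
          convert h4 using 1
          have h5 := hD' n
          rw [map_add, map_smul, N.ι_d, map_sub, map_sub, sub_mul, N.ι_τ, smul_add, smul_sub, smul_sub,
            eq_neg_of_add_eq_zero_left h5]
          abel)
      set b : N.E[X] := ∑ n ∈ Finset.range (M + 1), monomial n (N.ι (β n)) with hb
      have hbc : ∀ n, b.coeff n = N.ι (β n) := by
        intro n
        rw [hb, finsetSum_coeff]
        simp only [coeff_monomial, Finset.sum_ite_eq', Finset.mem_range]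
        split_ifs with h
        · rfl
        · rw [hβM n (by omega), map_zero]
      obtain ⟨u, hu, hu'⟩ := PE.cs_ac N.S w hτ W.Dw N.Kr N.K_ml N.K_τ N.K_ac
        (z - (PE.sda N.S w hτ W.Dw).D b) (by
          intro n
          rw [coeff_sub, PE.sda_D, hbc, hbc, hcast]
          have h1 := Submodule.sub_mem _ (Submodule.add_mem _ (hαK n) (N.IT_K (hβ n)))
            (Submodule.smul_mem _ ((n : ℚ) + 1) (hwr (F.τ (β (n+1)))))
          convert h1 using 1
          simp only [map_sub, map_smul, N.ι_d, N.ι_τ, mul_smul_comm, smul_mul_assoc, mul_one, smul_sub]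
          abel) (by rw [map_sub, hD, (PE.sda N.S w hτ W.Dw).DD, sub_zero])
      refine ⟨b + u, ?_, by rw [map_add, hu']; abel⟩
      rw [PE.mem_c0, coeff_add, hbc, hβ0, map_zero, zero_add]
      exact N.Kr_le (hu 0)
    Q := fun Ψ hΨ => by
      have hcast : ∀ n : ℕ, ((n : N.E) + 1) = ((n : ℚ) + 1) • (1 : N.E) := by
        intro n; rw [add_smul, one_smul]; simp [Nat.cast_smul_eq_nsmul]
      have h : ∀ n, N.S.D (Ψ.coeff n) + ((n : ℚ) + 1) • (N.S.τ (Ψ.coeff (n+1)) * w) ∈ N.P 2 := by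
        intro n
        have := hΨ n
        simpa only [PE.sda_D, hcast, mul_smul_comm, smul_mul_assoc, mul_one] using this
      have hdown : ∀ n, Ψ.coeff (n+1) ∈ N.P 1 → ∃ q : ℚ, Ψ.coeff n - q • 1 ∈ N.P 1 := by
        intro n hn
        refine N.Q _ ?_
        have := Submodule.sub_mem _ (h n) (Submodule.smul_mem _ ((n : ℚ) + 1) (N.P_mul (N.P_τ hn) W.Pw))
        simpa using this
      have key : ∀ k n, Ψ.natDegree < n + k → Ψ.coeff (n+1) ∈ N.P 1 := by
        intro k
        induction k with
        | zero =>
          intro n hn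
          rw [coeff_eq_zero_of_natDegree_lt (by omega)]; exact Submodule.zero_mem _
        | succ k ih =>
          intro n hn
          obtain ⟨q, hq⟩ := hdown (n+1) (ih (n+1) (by omega))
          have h2 := Submodule.smul_mem _ ((n : ℚ) + 1) (N.P_mul (N.P_τ hq) W.Pw)
          have hq0 : ((n : ℚ) + 1) * q = 0 := by
            refine N.q_zero W.nv W.rep (x := Ψ.coeff n) ?_
            have := Submodule.sub_mem _ (h n) h2
            convert this using 1
            rw [map_sub, map_smul, map_one, sub_mul, smul_mul_assoc, one_mul, smul_sub, smul_smul]; abel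
          have : q = 0 := by
            rcases mul_eq_zero.1 hq0 with h | h
            · exact absurd h (by positivity)
            · exact h
          simpa [this] using hq
      have key' : ∀ n, Ψ.coeff (n+1) ∈ N.P 1 := fun n => key (Ψ.natDegree + 1) n (by omega)
      obtain ⟨q, hq⟩ := hdown 0 (key' 0)
      refine ⟨q, fun n => ?_⟩
      rw [coeff_sub, coeff_smul, coeff_one]
      cases n with
      | zero => simpa using hq
      | succ n => simpa using key' n
    one_nm := fun x hx hc => by
      have := hc 0
      rw [coeff_sub, coeff_one_zero] at this
      exact Kw_one W _ hx this
    P2 := fun x hx => by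
      obtain ⟨l, hl, hl'⟩ := N.P2 _ (hx 0)
      refine ⟨l, hl, ?_⟩
      rw [PE.mem_c0]
      show (x - C (N.ι l)).coeff 0 ∈ _
      rw [coeff_sub, coeff_C_zero]; exact N.Kr_le hl'
    ε_K := fun {x} hx => Kw_ε W hx
    ε_D := fun x => by
      show N.ε' (((PE.sda N.S w hτ W.Dw).D x).coeff 0) = 0
      rw [PE.sda_D, map_add, N.ε_D, map_mul, εw]; simp
    ε_ι := fun a => by
      show N.ε' ((C (N.ι a)).coeff 0) = _
      rw [coeff_C_zero]; exact N.ε_ι a }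

end NSt
end FA

namespace FA
variable {X Y A : Type} [Fintype X] [DecidableEq X] [Fintype Y] [DecidableEq Y]
    [Ring A] [Algebra ℚ A] (F : FA X Y A)

/-- weight component -/
noncomputable def pw (m : ℕ) : A →ₗ[ℚ] A := F.pr {b | F.wt b = m}

lemma pw_mem (m : ℕ) (x : A) : F.pw m x ∈ F.Gr m := F.pr_mem _ _

lemma pw_self {m : ℕ} {x : A} (h : x ∈ F.Gr m) : F.pw m x = x := F.pr_eq_self h

lemma pw_ne {m k : ℕ} (hk : k ≠ m) {x : A} (h : x ∈ F.Gr m) : F.pw k x = 0 :=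
  F.pr_eq_zero h (fun b hb hb' => hk (hb'.symm.trans hb))

lemma d_pw (m : ℕ) (x : A) : F.d (F.pw m x) = F.pw (m+1) (F.d x) := by
  refine F.ext_B (f := F.d ∘ₗ F.pw m) (g := F.pw (m+1) ∘ₗ F.d) ?_ x
  intro b
  simp only [LinearMap.comp_apply]
  by_cases h : F.wt b = m
  · rw [pw, F.pr_B_mem h, F.pw_self]
    rw [← h]; exact F.d_B b
  · rw [pw, F.pr_B_not_mem h, map_zero, F.pw_ne (by omega) (F.d_B b)]

lemma pw_zero_d (x : A) : F.pw 0 (F.d x) = 0 := by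
  refine F.pr_eq_zero (t := {b | 1 ≤ F.wt b}) ?_ ?_
  · have h : x ∈ F.sp {b | True} := by
      have : x ∈ F.sp Set.univ := by rw [F.sp_univ]; trivial
      exact this
    exact F.d_sp_wt (P := fun _ => True) (Q := fun m => 1 ≤ m) (by simp) h
  · intro b hb hb'
    simp only [Set.mem_ofPred_eq] at hb hb'
    omega

/-- the vanishing hypothesis on cohomology -/
def Van (n : ℕ) : Prop := ∀ m, n < m → ∀ z ∈ F.Gr m, F.d z = 0 → ∃ u, F.d u = z

lemma Van.hom {n : ℕ} (h : F.Van n) {m : ℕ} (hm : n < m) {z : A} (hz : z ∈ F.Gr m) (hd : F.d z = 0) :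
    ∃ k, k + 1 = m ∧ ∃ u ∈ F.Gr k, F.d u = z := by
  obtain ⟨u, hu⟩ := h m hm z hz hd
  obtain ⟨k, rfl⟩ : ∃ k, m = k + 1 := ⟨m - 1, by omega⟩
  refine ⟨k, rfl, F.pw k u, F.pw_mem _ _, ?_⟩
  rw [d_pw, hu, F.pw_self hz]

lemma len_le_wt (b : Idx X Y) : len b ≤ F.wt b := by
  rw [len, wt]
  refine Nat.add_le_add (Finset.sum_le_sum fun i _ => ?_) ?_
  · have := F.a_pos i; nlinarith
  · rw [Finset.card_eq_sum_ones]
    exact Finset.sum_le_sum fun j _ => by have := F.c_pos j; omega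

lemma exists_sub_one (x : A) : ∃ q : ℚ, x - q • 1 ∈ F.L 1 := by
  refine ⟨F.B.repr x (0, ∅), ?_⟩
  rw [L, mem_sp]
  intro b hb
  by_contra hc
  have : b = (0, ∅) := by
    rw [Set.mem_ofPred_eq, not_le, Nat.lt_one_iff] at hc
    simp only [len, Nat.add_eq_zero_iff, Finset.sum_eq_zero_iff, Finset.card_eq_zero,
          Finset.mem_univ, true_imp_iff] at hc
    exact Prod.ext (Finsupp.ext hc.1) hc.2
  apply hb
  rw [this, ← F.B_one]
  simp

variable {F}
variable {K : Type} [CommRing K] [IsDomain K] [Algebra ℚ K]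

lemma exists_base {n : ℕ} (hV : F.Van n) (ε : A →ₐ[ℚ] K) (hε : ∀ x, ε (F.d x) = 0) :
    Nonempty (NSt F ε ∅) := by
  obtain ⟨C, hC⟩ := Submodule.exists_isCompl (LinearMap.ker F.d ⊓ F.Gr n)
  set W := C ⊓ F.Gr n with hW
  have hW1 : ∀ x ∈ W, F.d x = 0 → x = 0 := by
    intro x hx hd
    exact Submodule.disjoint_def.1 hC.disjoint x ⟨hd, hx.2⟩ hx.1
  have hW2 : ∀ x ∈ F.Gr n, ∃ w ∈ W, F.d w = F.d x := by
    intro x hx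
    obtain ⟨k, hk, c, hc, rfl⟩ := Submodule.mem_sup.1 (show x ∈ _ ⊔ C by rw [hC.sup_eq_top]; trivial)
    refine ⟨c, ⟨hc, ?_⟩, ?_⟩
    · have := Submodule.sub_mem _ hx hk.2
      simpa using this
    · have : F.d k = 0 := hk.1
      rw [map_add, this, zero_add]
  set H := F.sp {b | n + 1 ≤ F.wt b} with hH
  have hWH : ∀ x ∈ W, ∀ h ∈ H, F.d (x + h) = 0 → x = 0 := by
    intro x hx h hh hd
    refine hW1 x hx ?_
    have h1 : F.d x ∈ F.Gr (n+1) := F.d_Gr hx.2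
    have h2 : F.d h ∈ F.sp {b | n + 2 ≤ F.wt b} :=
      F.d_sp_wt (P := fun k => n + 1 ≤ k) (Q := fun k => n + 2 ≤ k) (by intros; omega) hh
    rw [map_add] at hd
    have h3 := congrArg (F.pw (n+1)) hd
    rw [map_add, F.pw_self h1, map_zero] at h3
    have h4 : F.pw (n+1) (F.d h) = 0 := F.pr_eq_zero h2 (fun b hb hb' => by
      simp only [Set.mem_ofPred_eq] at hb hb'; omega)
    simpa [h4] using h3
  have hac : ∀ N, ∀ h ∈ F.sp {b | n + 1 ≤ F.wt b ∧ F.wt b ≤ N}, F.d h = 0 → ∃ u ∈ W ⊔ H, F.d u = h := by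
    intro N
    induction N with
    | zero =>
      intro h hh _
      have : {b | n + 1 ≤ F.wt b ∧ F.wt b ≤ 0} = (∅ : Set (Idx X Y)) := by
        ext b; simp; omega
      rw [this, F.sp_empty] at hh
      have hh : h = 0 := by simpa using hh
      exact ⟨0, Submodule.zero_mem _, by rw [map_zero, hh]⟩
    | succ N ih =>
      intro h hh hd
      have hrest : h - F.pw (N+1) h ∈ F.sp {b | n + 1 ≤ F.wt b ∧ F.wt b ≤ N} := by
        refine F.sp_mono ?_ (F.mem_sp_inter (Submodule.sub_mem _ hh (F.pr_mem_of_mem _ hh)) (F.pr_sub_mem _ h))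
        rintro b ⟨hb1, hb2⟩
        simp only [Set.mem_ofPred_eq, Set.mem_compl_iff] at hb1 hb2 ⊢
        omega
      have hd1 : F.d (F.pw (N+1) h) = 0 := by rw [d_pw, hd, map_zero]
      obtain ⟨u, hu, hu'⟩ := ih _ hrest (by rw [map_sub, hd, hd1, sub_zero])
      by_cases hn : n < N + 1
      · obtain ⟨k, hk, e, he, he'⟩ := Van.hom F hV hn (F.pw_mem (N+1) h) hd1
        have : ∃ e' ∈ W ⊔ H, F.d e' = F.pw (N+1) h := by
          by_cases hkn : k = n
          · obtain ⟨w, hw, hw'⟩ := hW2 e (hkn ▸ he)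
            exact ⟨w, Submodule.mem_sup_left hw, hw'.trans he'⟩
          · refine ⟨e, Submodule.mem_sup_right (F.sp_mono ?_ he), he'⟩
            intro b hb
            simp only [Set.mem_ofPred_eq] at hb ⊢
            omega
        obtain ⟨e', he1, he2⟩ := this
        exact ⟨u + e', Submodule.add_mem _ hu he1, by rw [map_add, hu', he2]; abel⟩
      · have : F.pw (N+1) h = 0 := F.pr_eq_zero hh (fun b hb hb' => by
          simp only [Set.mem_ofPred_eq] at hb hb'; omega)
        exact ⟨u, hu, by rw [hu', this, sub_zero]⟩
  refine ⟨{
    E := A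
    S := ⟨F.τ, F.d, F.τ_τ, F.d_sq, F.d_τ, F.leib, fun x hx => F.comm_even hx, fun x hx => F.comm_odd hx⟩
    ι := AlgHom.id ℚ A
    P := F.L
    I := W ⊔ H
    Kr := ⊥
    M := n + 1
    ε' := ε
    ι_d := fun _ => rfl
    ι_τ := fun _ => rfl
    ι_L := fun _ _ hx => hx
    P_zero := F.L_zero
    P_mul := fun hx hz => F.L_mul hx hz
    P_τ := fun hx => F.τ_sp hx
    P_I := fun {x} hx => Submodule.mem_sup_right (F.sp_mono (fun b hb => le_trans hb (F.len_le_wt b)) hx)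
    I_mul := ?_
    I_τ := ?_
    I_ac := ?_
    K_ml := fun {x z} hx => by
      rw [Submodule.mem_bot] at hx ⊢; rw [hx, zero_mul]
    K_mr := fun {x z} hx => by
      rw [Submodule.mem_bot] at hx ⊢; rw [hx, mul_zero]
    K_τ := fun {x} hx => by
      rw [Submodule.mem_bot] at hx ⊢; rw [hx, map_zero]
    K_D := fun {x} hx => by
      rw [Submodule.mem_bot] at hx ⊢; rw [hx, map_zero]
    K_sur := fun x => ⟨x, by simp⟩
    K_IT := fun {a} h => by rw [F.IT_empty]; exact h
    IT_K := fun {a} h => by rw [F.IT_empty] at h; exact h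
    K_ac := fun z hz _ => ⟨0, Submodule.zero_mem _, by
      rw [Submodule.mem_bot] at hz; rw [hz, map_zero]⟩
    Q := fun Ψ _ => F.exists_sub_one Ψ
    one_nm := fun x hx => by
      rw [Submodule.mem_bot] at hx; rw [hx, sub_zero]; exact F.one_not_mem_L1
    P2 := fun x hx => ⟨x, hx, by simp⟩
    ε_K := fun {x} hx => by
      rw [Submodule.mem_bot] at hx; rw [hx, map_zero]
    ε_D := hε
    ε_ι := fun _ => rfl }⟩
  · intro x z hx
    obtain ⟨w, hw, h, hh, rfl⟩ := Submodule.mem_sup.1 hx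
    rw [add_mul]
    refine Submodule.add_mem _ ?_ (Submodule.mem_sup_right ?_)
    · obtain ⟨q, hq⟩ := F.exists_sub_one z
      have : w * z = q • w + w * (z - q • 1) := by
        rw [mul_sub, mul_smul_comm, mul_one]; abel
      rw [this]
      refine Submodule.add_mem _ (Submodule.mem_sup_left (Submodule.smul_mem _ _ hw))
        (Submodule.mem_sup_right (F.sp_mul ?_ hw.2 hq))
      rintro ⟨m, I⟩ hb ⟨m', J⟩ hb' hd
      have := F.len_le_wt (m', J)
      simp only [Set.mem_ofPred_eq] at *
      rw [F.wt_add _ _ _ _ hd]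
      omega
    · refine F.sp_mul ?_ hh (show z ∈ F.sp Set.univ by rw [F.sp_univ]; trivial)
      rintro ⟨m, I⟩ hb ⟨m', J⟩ hb' hd
      simp only [Set.mem_ofPred_eq] at *
      rw [F.wt_add _ _ _ _ hd]
      omega
  · intro x hx
    obtain ⟨w, hw, h, hh, rfl⟩ := Submodule.mem_sup.1 hx
    show F.τ (w + h) ∈ _
    rw [map_add, F.τ_Gr hw.2]
    exact Submodule.add_mem _ (Submodule.mem_sup_left (Submodule.smul_mem _ _ hw))
      (Submodule.mem_sup_right (F.τ_sp hh))
  · intro z hz hD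
    have hD : F.d z = 0 := hD
    obtain ⟨w, hw, h, hh, rfl⟩ := Submodule.mem_sup.1 hz
    have := hWH w hw h hh hD
    subst this
    rw [zero_add] at hD ⊢
    obtain ⟨N, hN⟩ := F.exists_wt_bound h
    exact hac N h (F.mem_sp_inter hh hN) hD

lemma ε_gen_zero {n : ℕ} (hV : F.Van n) (ε : A →ₐ[ℚ] K) (hε : ∀ x, ε (F.d x) = 0) (v : X ⊕ Y) :
    ε (F.gen v) = 0 := by
  have := F.low_induction (P := fun T => Nonempty (NSt F ε T) ∧ ∀ v ∈ T, ε (F.gen v) = 0)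
    ⟨exists_base hV ε hε, by simp⟩ (by
      rintro T v hT hv ⟨⟨N⟩, h⟩
      obtain ⟨w, W⟩ := N.exists_isW hT hv
      refine ⟨?_, ?_⟩
      · cases v with
        | inl i => exact ⟨NSt.stepEven W⟩
        | inr j => exact ⟨NSt.stepOdd hT hv W⟩
      · intro u hu
        rcases Finset.mem_insert.1 hu with rfl | hu
        · exact (N.ε_gen W.rep W.Dw W.Pw).1
        · exact h u hu) Finset.univ F.Low_univ
  exact this.2 v (Finset.mem_univ _)

end FA

namespace FA
variable {X Y A : Type} [Fintype X] [DecidableEq X] [Fintype Y] [DecidableEq Y]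
    [Ring A] [Algebra ℚ A] (F : FA X Y A)

lemma mem_univ_sp (x : A) : x ∈ F.sp Set.univ := by rw [F.sp_univ]; trivial

/-- filtration by word length in the odd generators -/
def YG (l : ℕ) : Submodule ℚ A := F.sp {b | l ≤ b.2.card}
def YL (l : ℕ) : Submodule ℚ A := F.sp {b | b.2.card = l}

lemma mem_sp_zero {s : Set (Idx X Y)} {x : A} (h : x ∈ F.sp s) (hs : ∀ b, b ∉ s) : x = 0 := by
  have : s = ∅ := by ext b; simp [hs b]
  rw [this, F.sp_empty] at h
  simpa using h

/-- monomial induction -/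
lemma mono_induction {P : Idx X Y → Prop} (h0 : P (0, ∅))
    (hs : ∀ v b, Disjoint (gi v).2 b.2 → P b → P ((gi v).1 + b.1, (gi v).2 ∪ b.2)) (b : Idx X Y) : P b := by
  have key : ∀ k, ∀ b : Idx X Y, len b = k → P b := by
    intro k
    induction k with
    | zero =>
      intro b hb
      have : b = (0, ∅) := by
        simp only [len, Nat.add_eq_zero_iff, Finset.sum_eq_zero_iff, Finset.card_eq_zero,
          Finset.mem_univ, true_imp_iff] at hb
        exact Prod.ext (Finsupp.ext hb.1) hb.2
      rw [this]; exact h0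
    | succ k ih =>
      intro b hb
      obtain ⟨v, hv⟩ := exists_dv (b := b) (by omega)
      obtain ⟨b', hd, rfl⟩ := exists_of_dv hv
      have h1 := len_add (gi v).1 b'.1 (gi v).2 b'.2 hd
      simp only [Prod.mk.eta, len_gi] at h1
      exact hs v b' hd (ih b' (by omega))
  exact key _ b rfl

lemma d_par (b : Idx X Y) : F.d (F.B b) ∈ F.sp {b' | Odd (b'.2.card + b.2.card)} := by
  refine F.sp_mono ?_ (F.d_B b)
  intro b' hb'
  have hb' : F.wt b' = F.wt b + 1 := hb'
  have h1 := F.wt_parity b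
  have h2 := F.wt_parity b'
  rw [hb', pow_succ, h1] at h2
  rw [Set.mem_ofPred_eq, ← Nat.not_even_iff_odd]
  intro he
  have h3 : (-1 : ℚ) ^ (b'.2.card + b.2.card) = 1 := he.neg_one_pow
  rw [pow_add, ← h2] at h3
  have h4 : ((-1 : ℚ) ^ b.2.card) * (-1) ^ b.2.card = 1 := by rw [← mul_pow]; simp
  nlinarith

lemma card_gi (v : X ⊕ Y) : (gi v).2.card ≤ 1 := by cases v <;> simp [gi]

lemma d_low (b : Idx X Y) : F.d (F.B b) ∈ F.sp {b' | b.2.card ≤ b'.2.card + 1} := by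
  refine mono_induction (P := fun b => F.d (F.B b) ∈ F.sp {b' | b.2.card ≤ b'.2.card + 1}) ?_ ?_ b
  · rw [F.B_one, d_one]; exact Submodule.zero_mem _
  · intro v b hd ih
    rw [F.B_eq_gen_mul hd, F.leib, F.τ_gen, map_smul, Finset.card_union_of_disjoint hd]
    refine Submodule.add_mem _ ?_ ?_
    · rw [mul_smul_comm]
      refine Submodule.smul_mem _ _ (F.sp_mul (s := {b' | (gi v).2.card ≤ b'.2.card + 1}) (t := {b' | b' = b})
        ?_ ?_ (F.B_mem_sp rfl))
      · rintro b1 h1 b2 rfl hdd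
        simp only [Set.mem_ofPred_eq] at *
        rw [Finset.card_union_of_disjoint hdd]; omega
      · refine F.sp_mono ?_ (F.mem_univ_sp _)
        intro b' _
        have := card_gi v
        simp only [Set.mem_ofPred_eq]; omega
    · rw [smul_mul_assoc, mul_smul_comm]
      refine Submodule.smul_mem _ _ (Submodule.smul_mem _ _ (F.sp_mul (s := {b' | b' = gi v}) 
        ?_ (F.B_mem_sp rfl) ih))
      rintro b1 rfl b2 h2 hdd
      simp only [Set.mem_ofPred_eq] at *
      rw [Finset.card_union_of_disjoint hdd]; omega

lemma d_terms (b : Idx X Y) : F.d (F.B b) ∈ F.sp {b' | b'.2.card + 1 = b.2.card ∨ b.2.card + 1 ≤ b'.2.card} := by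
  refine F.sp_mono ?_ (F.mem_sp_inter (F.d_par b) (F.d_low b))
  rintro b' ⟨h1, h2⟩
  simp only [Set.mem_ofPred_eq] at *
  rcases h1 with ⟨k, hk⟩
  omega

/-- the pure part of the differential -/
noncomputable def ds : A →ₗ[ℚ] A :=
  F.B.constr ℚ (fun b => F.pr {b' | b'.2.card + 1 = b.2.card} (F.d (F.B b)))

lemma ds_B (b : Idx X Y) : F.ds (F.B b) = F.pr {b' | b'.2.card + 1 = b.2.card} (F.d (F.B b)) := by
  rw [ds, Module.Basis.constr_basis]

lemma ds_YL {l : ℕ} {x : A} (h : x ∈ F.YL l) : F.ds x ∈ F.sp {b' | b'.2.card + 1 = l} := by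
  refine F.sp_map_le F.ds ?_ h
  rintro b rfl
  rw [ds_B]; exact F.pr_mem _ _

lemma ds_YL0 {x : A} (h : x ∈ F.YL 0) : F.ds x = 0 :=
  F.mem_sp_zero (F.ds_YL h) (by intro b hb; simp only [Set.mem_ofPred_eq] at hb; omega)

lemma d_sub_ds_B (b : Idx X Y) : F.d (F.B b) - F.ds (F.B b) ∈ F.YG (b.2.card + 1) := by
  rw [ds_B]
  refine F.sp_mono ?_ (F.mem_sp_inter (F.pr_sub_mem _ _) (Submodule.sub_mem _ (F.d_terms b)
    (F.pr_mem_of_mem _ (F.d_terms b))))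
  rintro b' ⟨h1, h2⟩
  simp only [Set.mem_ofPred_eq, Set.mem_compl_iff] at *
  omega

lemma YG_mono {k l : ℕ} (h : k ≤ l) : F.YG l ≤ F.YG k := F.sp_mono (fun _ hb => le_trans h hb)

lemma d_sub_ds {l : ℕ} {x : A} (h : x ∈ F.YG l) : F.d x - F.ds x ∈ F.YG (l + 1) := by
  refine F.sp_map_le (F.d - F.ds) ?_ h
  intro b hb
  exact F.YG_mono (Nat.succ_le_succ hb) (F.d_sub_ds_B b)

lemma d_YG {l : ℕ} {x : A} (h : x ∈ F.YG (l+1)) : F.d x ∈ F.YG l := by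
  refine F.sp_map_le F.d ?_ h
  intro b hb
  refine F.sp_mono ?_ (F.d_low b)
  intro b' hb'
  simp only [Set.mem_ofPred_eq] at *
  omega

lemma YL_le (l : ℕ) : F.YL l ≤ F.YG l := F.sp_mono (fun _ hb => le_of_eq (Eq.symm hb))

lemma ds_Gr {m : ℕ} {x : A} (hx : x ∈ F.Gr m) : F.ds x ∈ F.Gr (m + 1) := by
  refine F.sp_map_le F.ds ?_ hx
  rintro b rfl
  rw [ds_B]; exact F.pr_mem_of_mem _ (F.d_B b)

lemma ds_sq (x : A) : F.ds (F.ds x) = 0 := by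
  refine F.ext_B (f := F.ds ∘ₗ F.ds) (g := 0) ?_ x
  intro b
  simp only [LinearMap.comp_apply, LinearMap.zero_apply]
  have hB : F.B b ∈ F.YL b.2.card := F.B_mem_sp rfl
  have h1 := F.ds_YL hB
  have h2 : F.ds (F.ds (F.B b)) ∈ F.sp {b' | b'.2.card + 2 = b.2.card} := by
    refine F.sp_map_le F.ds ?_ h1
    intro b' hb'
    rw [ds_B]
    refine F.sp_mono ?_ (F.pr_mem _ _)
    intro b'' hb''
    simp only [Set.mem_ofPred_eq] at *
    omega
  have h3 : F.ds (F.ds (F.B b)) ∈ F.sp {b' | b.2.card ≤ b'.2.card} := by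
    have e : F.ds (F.ds (F.B b)) = - F.d (F.d (F.B b) - F.ds (F.B b))
        - (F.d (F.ds (F.B b)) - F.ds (F.ds (F.B b))) := by
      rw [map_sub, F.d_sq]; abel
    rw [e]
    refine Submodule.sub_mem _ (Submodule.neg_mem _ (F.d_YG (F.d_sub_ds (F.YL_le _ hB)))) ?_
    refine F.sp_map_le (F.d - F.ds) ?_ h1
    intro b' hb'
    refine F.YG_mono (le_of_eq ?_) (F.d_sub_ds_B b')
    exact hb'.symm
  refine F.mem_sp_zero (F.mem_sp_inter h2 h3) ?_
  rintro b' ⟨h, h'⟩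
  simp only [Set.mem_ofPred_eq] at *
  omega

lemma ds_leib (x z : A) : F.ds (x * z) = F.ds x * z + F.τ x * F.ds z := by
  have key : ∀ b b', F.ds (F.B b * F.B b') - F.ds (F.B b) * F.B b' - F.τ (F.B b) * F.ds (F.B b') = 0 := by
    intro b b'
    have hB : ∀ b, F.B b ∈ F.YL b.2.card := fun b => F.B_mem_sp rfl
    have hG : ∀ b, F.B b ∈ F.YG b.2.card := fun b => F.YL_le _ (hB b)
    have hmul : F.B b * F.B b' ∈ F.YL (b.2.card + b'.2.card) := by
      refine F.sp_mul ?_ (hB b) (hB b')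
      rintro b1 h1 b2 h2 hdd
      simp only [Set.mem_ofPred_eq] at *
      rw [Finset.card_union_of_disjoint hdd]; omega
    have h1 : F.ds (F.B b * F.B b') - F.ds (F.B b) * F.B b' - F.τ (F.B b) * F.ds (F.B b') ∈
        F.sp {c | c.2.card + 1 = b.2.card + b'.2.card} := by
      refine Submodule.sub_mem _ (Submodule.sub_mem _ (F.ds_YL hmul) ?_) ?_
      · refine F.sp_mul ?_ (F.ds_YL (hB b)) (hB b')
        rintro b1 h1 b2 h2 hdd
        simp only [Set.mem_ofPred_eq] at *
        rw [Finset.card_union_of_disjoint hdd]; omega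
      · refine F.sp_mul ?_ (F.τ_sp (hB b)) (F.ds_YL (hB b'))
        rintro b1 h1 b2 h2 hdd
        simp only [Set.mem_ofPred_eq] at *
        rw [Finset.card_union_of_disjoint hdd]; omega
    have h2 : F.ds (F.B b * F.B b') - F.ds (F.B b) * F.B b' - F.τ (F.B b) * F.ds (F.B b') ∈
        F.YG (b.2.card + b'.2.card + 1) := by
      have e : F.ds (F.B b * F.B b') - F.ds (F.B b) * F.B b' - F.τ (F.B b) * F.ds (F.B b') =
        -(F.d (F.B b * F.B b') - F.ds (F.B b * F.B b')) + (F.d (F.B b) - F.ds (F.B b)) * F.B b'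
          + F.τ (F.B b) * (F.d (F.B b') - F.ds (F.B b')) := by
        rw [F.leib, sub_mul, mul_sub]; abel
      rw [e]
      refine Submodule.add_mem _ (Submodule.add_mem _ (Submodule.neg_mem _ (F.d_sub_ds (F.YL_le _ hmul))) ?_) ?_
      · refine F.sp_mul ?_ (F.d_sub_ds (hG b)) (hG b')
        rintro b1 h1 b2 h2 hdd
        simp only [Set.mem_ofPred_eq] at *
        rw [Finset.card_union_of_disjoint hdd]; omega
      · refine F.sp_mul ?_ (F.τ_sp (hG b)) (F.d_sub_ds (hG b'))
        rintro b1 h1 b2 h2 hdd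
        simp only [Set.mem_ofPred_eq] at *
        rw [Finset.card_union_of_disjoint hdd]; omega
    refine F.mem_sp_zero (F.mem_sp_inter h1 h2) ?_
    rintro b' ⟨h, h'⟩
    simp only [Set.mem_ofPred_eq] at *
    omega
  have k1 : ∀ b z, F.ds (F.B b * z) = F.ds (F.B b) * z + F.τ (F.B b) * F.ds z := by
    intro b z
    refine F.ext_B (f := F.ds ∘ₗ LinearMap.mulLeft ℚ (F.B b)) (g := LinearMap.mulLeft ℚ (F.ds (F.B b)) +
      LinearMap.mulLeft ℚ (F.τ (F.B b)) ∘ₗ F.ds) ?_ z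
    intro b'
    have := key b b'
    rw [sub_sub, sub_eq_zero] at this
    simpa using this
  refine F.ext_B (f := F.ds ∘ₗ LinearMap.mulRight ℚ z) (g := LinearMap.mulRight ℚ z ∘ₗ F.ds +
      LinearMap.mulRight ℚ (F.ds z) ∘ₗ F.τ.toLinearMap) ?_ x
  intro b
  simpa using k1 b z

/-- projection to the polynomial part -/
noncomputable def psL : A →ₗ[ℚ] MvPolynomial X ℚ :=
  F.B.constr ℚ (fun b => if b.2 = ∅ then MvPolynomial.monomial b.1 1 else 0)

lemma psL_B (b : Idx X Y) : F.psL (F.B b) = if b.2 = ∅ then MvPolynomial.monomial b.1 1 else 0 := by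
  rw [psL, Module.Basis.constr_basis]

noncomputable def ps : A →ₐ[ℚ] MvPolynomial X ℚ := AlgHom.ofLinearMap F.psL
  (by rw [← F.B_one, psL_B]; simp) (by
    have key : ∀ b b', F.psL (F.B b * F.B b') = F.psL (F.B b) * F.psL (F.B b') := by
      rintro ⟨m, I⟩ ⟨m', J⟩
      rw [F.B_mul, map_smul, psL_B, psL_B, psL_B]
      by_cases h : I = ∅
      · subst h
        rw [F.sg_empty_left, one_smul, Finset.empty_union]
        by_cases hJ : J = ∅ <;> simp [hJ, MvPolynomial.monomial_mul]
      · simp [h, Finset.union_eq_empty]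
    intro x z
    refine F.ext_B (f := F.psL ∘ₗ LinearMap.mulRight ℚ z) (g := LinearMap.mulRight ℚ (F.psL z) ∘ₗ F.psL) ?_ x
    intro b
    refine F.ext_B (f := F.psL ∘ₗ LinearMap.mulLeft ℚ (F.B b)) (g := LinearMap.mulLeft ℚ (F.psL (F.B b)) ∘ₗ F.psL) ?_ z
    intro b'
    simpa using key b b')

lemma ps_B (b : Idx X Y) : F.ps (F.B b) = if b.2 = ∅ then MvPolynomial.monomial b.1 1 else 0 := F.psL_B b

lemma φ_mon (m : X →₀ ℕ) : F.φ (MvPolynomial.monomial m 1) = F.B (m, ∅) := by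
  rw [F.B_eq, F.y_empty, mul_one]

lemma ps_φ (s : MvPolynomial X ℚ) : F.ps (F.φ s) = s := by
  have : F.ps.comp F.φ = AlgHom.id ℚ _ := by
    apply MvPolynomial.algHom_ext
    intro i
    simp only [AlgHom.comp_apply, AlgHom.id_apply]
    rw [MvPolynomial.X, F.φ_mon, ps_B]; simp
  exact DFunLike.congr_fun this s

lemma φ_ps {x : A} (h : x ∈ F.YL 0) : F.φ (F.ps x) = x := by
  refine F.sp_induction (P := fun x => F.φ (F.ps x) = x) (by simp) ?_ ?_ ?_ h
  · intro x z hx hz; rw [map_add, map_add, hx, hz]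
  · intro q x hx; rw [map_smul, map_smul, hx]
  · rintro ⟨m, I⟩ hb
    have : I = ∅ := Finset.card_eq_zero.1 hb
    subst this
    rw [ps_B, if_pos rfl, φ_mon]

lemma ps_YG {x : A} (h : x ∈ F.YG 1) : F.ps x = 0 := by
  refine F.sp_induction (P := fun x => F.ps x = 0) (by simp) ?_ ?_ ?_ h
  · intro x z hx hz; rw [map_add, hx, hz, add_zero]
  · intro q x hx; rw [map_smul, hx, smul_zero]
  · rintro ⟨m, I⟩ hb
    rw [ps_B, if_neg]
    rintro rfl
    simp at hb

lemma φ_YL (s : MvPolynomial X ℚ) : F.φ s ∈ F.YL 0 := by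
  induction s using MvPolynomial.induction_on' with
  | monomial m q =>
    have : MvPolynomial.monomial m q = q • MvPolynomial.monomial m (1 : ℚ) := by
      rw [MvPolynomial.smul_monomial]; simp
    rw [this, map_smul, F.φ_mon]
    exact Submodule.smul_mem _ _ (F.B_mem_sp rfl)
  | add p q hp hq => rw [map_add]; exact Submodule.add_mem _ hp hq

/-- the polynomials of the pure part -/
noncomputable def f (j : Y) : MvPolynomial X ℚ := F.ps (F.ds (F.B (0, {j})))

lemma ds_y (j : Y) : F.ds (F.B (0, {j})) = F.φ (F.f j) := by
  rw [f, F.φ_ps]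
  have h : F.B (0, {j}) ∈ F.YL 1 := F.B_mem_sp (by simp)
  refine F.sp_mono ?_ (F.ds_YL h)
  intro b hb
  simp only [Set.mem_ofPred_eq] at *
  omega

lemma ds_φ (s) : F.ds (F.φ s) = 0 := F.ds_YL0 (F.φ_YL s)

lemma τ_φ (s) : F.τ (F.φ s) = F.φ s := by
  refine F.sp_induction (P := fun x => F.τ x = x) (by simp) ?_ ?_ ?_ (F.φ_YL s)
  · intro x z hx hz; rw [map_add, hx, hz]
  · intro q x hx; rw [map_smul, hx]
  · rintro ⟨m, I⟩ hb
    have : I.card = 0 := hb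
    rw [F.τ_B, this]; simp

lemma ds_φ_mul (s x) : F.ds (F.φ s * x) = F.φ s * F.ds x := by
  rw [ds_leib, ds_φ, zero_mul, zero_add, τ_φ]

lemma τ_y (j : Y) : F.τ (F.B (0, {j})) = - F.B (0, {j}) := by
  rw [F.τ_B]; simp

lemma ds_y_mul (j x) : F.ds (F.B (0, {j}) * x) = F.φ (F.f j) * x - F.B (0, {j}) * F.ds x := by
  rw [ds_leib, ds_y, τ_y, neg_mul, sub_eq_add_neg]

lemma ps_d_mem (x : A) : F.ps (F.d x) ∈ Ideal.span (Set.range F.f) := by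
  have key : ∀ b, F.ps (F.d (F.B b)) ∈ Ideal.span (Set.range F.f) := by
    intro b
    refine mono_induction (P := fun b => F.ps (F.d (F.B b)) ∈ Ideal.span (Set.range F.f)) ?_ ?_ b
    · rw [F.B_one, d_one, map_zero]; exact Ideal.zero_mem _
    · intro v b hd ih
      rw [F.B_eq_gen_mul hd, F.leib, map_add, map_mul, map_mul, map_smul, map_smul]
      refine Ideal.add_mem _ ?_ (Ideal.mul_mem_left _ _ ?_)
      · refine Ideal.mul_mem_right _ _ ?_
        have h := F.d_sub_ds_B (gi v)
        have h2 := F.ps_YG (F.YG_mono (by omega) h)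
        rw [map_sub, sub_eq_zero] at h2
        rw [gen, h2]
        cases v with
        | inl i =>
          rw [F.ds_YL0 (F.B_mem_sp (by simp [gi])), map_zero]; exact Ideal.zero_mem _
        | inr j => exact Ideal.subset_span ⟨j, rfl⟩
      · rw [map_smul, MvPolynomial.smul_eq_C_mul]; exact Ideal.mul_mem_left _ _ ih
  refine F.sp_induction (P := fun x => F.ps (F.d x) ∈ Ideal.span (Set.range F.f)) (by simp) ?_ ?_ (fun b _ => key b) (F.mem_univ_sp x)
  · intro x z hx hz; rw [map_add, map_add]; exact Ideal.add_mem _ hx hz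
  · intro q x hx; rw [map_smul, map_smul, MvPolynomial.smul_eq_C_mul]; exact Ideal.mul_mem_left _ _ hx

theorem X_mem_radical {n : ℕ} (hV : F.Van n) (i : X) :
    MvPolynomial.X i ∈ (Ideal.span (Set.range F.f)).radical := by
  rw [Ideal.radical_eq_sInf]
  refine Ideal.mem_sInf.2 ?_
  intro P hPP
  obtain ⟨hP, hPp⟩ := hPP
  have hPp' : Ideal.IsPrime P := hPp
  have := ε_gen_zero hV ((Ideal.Quotient.mkₐ ℚ P).comp F.ps) (by
    intro x
    rw [AlgHom.comp_apply, Ideal.Quotient.mkₐ_eq_mk, Ideal.Quotient.eq_zero_iff_mem]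
    exact hP (F.ps_d_mem x)) (Sum.inl i)
  rw [AlgHom.comp_apply, Ideal.Quotient.mkₐ_eq_mk, Ideal.Quotient.eq_zero_iff_mem, gen, ps_B] at this
  simpa [gi, MvPolynomial.X] using this

end FA

/-- `Z ≤ W + E` with `W` of dimension at most `k` -/
def HB {M : Type} [AddCommGroup M] [Module ℚ M] (Z E : Submodule ℚ M) (k : ℕ) : Prop :=
  ∃ W : Submodule ℚ M, FiniteDimensional ℚ W ∧ Module.finrank ℚ W ≤ k ∧ Z ≤ W ⊔ E

lemma HB.mapLemma {M N : Type} [AddCommGroup M] [Module ℚ M] [AddCommGroup N] [Module ℚ N]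
    (f : M →ₗ[ℚ] N) {Z : Submodule ℚ M} {E' : Submodule ℚ N} {k : ℕ}
    (h : HB (Z.map f) E' k) : HB Z (Z ⊓ E'.comap f) k := by
  obtain ⟨W, hW, hk, hle⟩ := h
  let g : Z →ₗ[ℚ] (N ⧸ E') := E'.mkQ ∘ₗ f ∘ₗ Z.subtype
  obtain ⟨C, hC⟩ := Submodule.exists_isCompl (LinearMap.ker g)
  have hr : LinearMap.range g ≤ W.map E'.mkQ := by
    rintro _ ⟨z, rfl⟩
    have : f z ∈ W ⊔ E' := hle ⟨z, z.2, rfl⟩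
    obtain ⟨w, hw, e, he, hwe⟩ := Submodule.mem_sup.1 this
    refine ⟨w, hw, ?_⟩
    simp only [g, LinearMap.comp_apply, Submodule.subtype_apply, ← hwe, map_add]
    rw [(by simpa using he : E'.mkQ e = 0), add_zero]
  have hfd : FiniteDimensional ℚ (W.map E'.mkQ) := inferInstance
  have hfr : FiniteDimensional ℚ (LinearMap.range g) := Submodule.finiteDimensional_of_le hr
  have e1 : C ≃ₗ[ℚ] LinearMap.range g :=
    (Submodule.quotientEquivOfIsCompl _ _ hC).symm.trans g.quotKerEquivRange
  have hCf : FiniteDimensional ℚ C := e1.symm.finiteDimensional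
  refine ⟨C.map Z.subtype, inferInstance, ?_, ?_⟩
  · calc _ ≤ Module.finrank ℚ C := Submodule.finrank_map_le _ _
      _ = Module.finrank ℚ (LinearMap.range g) := e1.finrank_eq
      _ ≤ Module.finrank ℚ (W.map E'.mkQ) := Submodule.finrank_mono hr
      _ ≤ Module.finrank ℚ W := Submodule.finrank_map_le _ _
      _ ≤ k := hk
  · intro z hz
    have : (⟨z, hz⟩ : Z) ∈ C ⊔ LinearMap.ker g := by
      rw [sup_comm, hC.sup_eq_top]; trivial
    obtain ⟨c, hc, e, he, hce⟩ := Submodule.mem_sup.1 this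
    refine Submodule.mem_sup.2 ⟨c, ⟨c, hc, rfl⟩, e, ⟨e.2, ?_⟩, congrArg Subtype.val hce⟩
    have h2 : E'.mkQ (f e) = 0 := he
    simpa using h2

lemma HB.mono {M : Type} [AddCommGroup M] [Module ℚ M] {Z E Z' E' : Submodule ℚ M} {k k' : ℕ}
    (h : HB Z E k) (hZ : Z' ≤ Z) (hE : E ≤ E') (hk : k ≤ k') : HB Z' E' k' := by
  obtain ⟨W, a, b, c⟩ := h
  exact ⟨W, a, b.trans hk, hZ.trans (c.trans (sup_le_sup_left hE _))⟩

lemma HB.trans {M : Type} [AddCommGroup M] [Module ℚ M] {Z E E' : Submodule ℚ M} {k k' : ℕ}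
    (h : HB Z E k) (h' : HB E E' k') : HB Z E' (k + k') := by
  obtain ⟨W, a, b, c⟩ := h
  obtain ⟨W', a', b', c'⟩ := h'
  refine ⟨W ⊔ W', inferInstance, (Submodule.finrank_add_le_finrank_add_finrank W W').trans (by omega), ?_⟩
  rw [sup_assoc]
  exact c.trans (sup_le_sup_left c' _)

namespace FA

variable {X Y A : Type} [Fintype X] [DecidableEq X] [Fintype Y] [DecidableEq Y]
    [Ring A] [Algebra ℚ A] (F : FA X Y A)

/-- the coefficient of `y_J` -/
noncomputable def co (J : Finset Y) : A →ₗ[ℚ] MvPolynomial X ℚ :=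
  F.B.constr ℚ (fun b => if b.2 = J then MvPolynomial.monomial b.1 1 else 0)

lemma co_B (J : Finset Y) (b : Idx X Y) :
    F.co J (F.B b) = if b.2 = J then MvPolynomial.monomial b.1 1 else 0 := by
  rw [co, Module.Basis.constr_basis]

lemma co_coeff (J : Finset Y) (m : X →₀ ℕ) (x : A) :
    MvPolynomial.coeff m (F.co J x) = F.B.repr x (m, J) := by
  refine F.ext_B (f := MvPolynomial.lcoeff ℚ m ∘ₗ F.co J)
    (g := (Finsupp.lapply (m, J)) ∘ₗ F.B.repr.toLinearMap) ?_ x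
  rintro ⟨m', J'⟩
  simp only [LinearMap.comp_apply, co_B, LinearEquiv.coe_coe, Module.Basis.repr_self, Finsupp.lapply_apply,
    MvPolynomial.lcoeff_apply]
  by_cases h : J' = J
  · simp [h, MvPolynomial.coeff_monomial, Finsupp.single_apply]
  · simp [h, Finsupp.single_apply]

lemma ext_co {x z : A} (h : ∀ J, F.co J x = F.co J z) : x = z := by
  apply F.B.repr.injective
  ext ⟨m, J⟩
  rw [← co_coeff, ← co_coeff, h]

lemma φ_monomial_mul_B (m : X →₀ ℕ) (q : ℚ) (b : Idx X Y) :
    F.φ (MvPolynomial.monomial m q) * F.B b = q • F.B (m + b.1, b.2) := by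
  have : MvPolynomial.monomial m q = q • MvPolynomial.monomial m (1 : ℚ) := by
    rw [MvPolynomial.smul_monomial]; simp
  rw [this, map_smul, F.φ_mon, smul_mul_assoc]
  obtain ⟨m', J⟩ := b
  rw [F.B_mul, sg_empty_left, one_smul, Finset.empty_union]

lemma co_φ_mul (J : Finset Y) (s : MvPolynomial X ℚ) (x : A) : F.co J (F.φ s * x) = s * F.co J x := by
  induction s using MvPolynomial.induction_on' with
  | monomial m q =>
    refine F.ext_B (f := F.co J ∘ₗ LinearMap.mulLeft ℚ (F.φ (MvPolynomial.monomial m q))) (g := LinearMap.mulLeft ℚ (MvPolynomial.monomial m q) ∘ₗ F.co J) ?_ x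
    intro b
    simp only [LinearMap.comp_apply, LinearMap.mulLeft_apply]
    rw [φ_monomial_mul_B, map_smul, co_B, co_B]
    by_cases h : b.2 = J
    · simp [h, MvPolynomial.monomial_mul, MvPolynomial.smul_monomial]
    · simp [h]
  | add p q hp hq => rw [map_add, add_mul, map_add, hp, hq, add_mul]

lemma co_B0 (J J' : Finset Y) : F.co J (F.B (0, J')) = if J' = J then 1 else 0 := by
  rw [co_B]; rfl

/-- element with given coefficients -/
noncomputable def mkA (u : Finset Y → MvPolynomial X ℚ) : A := ∑ J, F.φ (u J) * F.B (0, J)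

lemma co_mk (u : Finset Y → MvPolynomial X ℚ) (J : Finset Y) : F.co J (F.mkA u) = u J := by
  rw [mkA, map_sum]
  simp [co_φ_mul, co_B0]

lemma mk_co (x : A) : F.mkA (fun J => F.co J x) = x := F.ext_co (fun J => F.co_mk _ J)

/-- `I·A` -/
def IA (I : Ideal (MvPolynomial X ℚ)) : Submodule ℚ A where
  carrier := {x | ∀ J, F.co J x ∈ I}
  add_mem' {x z} hx hz J := by rw [map_add]; exact I.add_mem (hx J) (hz J)
  zero_mem' J := by rw [map_zero]; exact I.zero_mem
  smul_mem' q x hx J := by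
    rw [map_smul, MvPolynomial.smul_eq_C_mul]; exact I.mul_mem_left _ (hx J)

lemma mem_IA {I : Ideal (MvPolynomial X ℚ)} {x : A} : x ∈ F.IA I ↔ ∀ J, F.co J x ∈ I := Iff.rfl

lemma φ_mul_mem_IA {I : Ideal (MvPolynomial X ℚ)} {s} (hs : s ∈ I) (x : A) : F.φ s * x ∈ F.IA I := by
  intro J; rw [co_φ_mul]; exact I.mul_mem_right _ hs

lemma φ_mul_IA {I : Ideal (MvPolynomial X ℚ)} (s) {x : A} (h : x ∈ F.IA I) : F.φ s * x ∈ F.IA I := by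
  intro J; rw [co_φ_mul]; exact I.mul_mem_left _ (h J)

lemma IA_induction {I : Ideal (MvPolynomial X ℚ)} {P : Submodule ℚ A}
    (h : ∀ s ∈ I, ∀ J, F.φ s * F.B (0, J) ∈ P) {x : A} (hx : x ∈ F.IA I) : x ∈ P := by
  rw [← F.mk_co x, mkA]
  exact Submodule.sum_mem _ (fun J _ => h _ (hx J) J)

lemma IA_mul_left {I : Ideal (MvPolynomial X ℚ)} (z : A) {x : A} (h : x ∈ F.IA I) : z * x ∈ F.IA I := by
  refine F.IA_induction (P := (F.IA I).comap (LinearMap.mulLeft ℚ z)) ?_ h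
  intro s hs J
  simp only [Submodule.mem_comap, LinearMap.mulLeft_apply]
  rw [← mul_assoc, ← F.φ_central, mul_assoc]
  exact F.φ_mul_mem_IA hs _

lemma ds_IA {I : Ideal (MvPolynomial X ℚ)} {x : A} (h : x ∈ F.IA I) : F.ds x ∈ F.IA I := by
  refine F.IA_induction (P := (F.IA I).comap F.ds) ?_ h
  intro s hs J
  simp only [Submodule.mem_comap]
  rw [ds_φ_mul]
  exact F.φ_mul_mem_IA hs _

lemma IA_bot : F.IA ⊥ = ⊥ := by
  rw [eq_bot_iff]
  intro x hx
  rw [Submodule.mem_bot]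
  refine F.ext_co (fun J => ?_)
  rw [map_zero]; exact hx J

lemma IA_mono {I I' : Ideal (MvPolynomial X ℚ)} (h : I ≤ I') : F.IA I ≤ F.IA I' := fun _ hx J => h (hx J)

/-- the subalgebra with exterior variables in `L` -/
def AL (L : Finset Y) : Submodule ℚ A := F.sp {b | b.2 ⊆ L}

lemma mem_AL {L : Finset Y} {x : A} : x ∈ F.AL L ↔ ∀ J, ¬ J ⊆ L → F.co J x = 0 := by
  rw [AL, mem_sp]
  constructor
  · intro h J hJ
    ext m
    rw [co_coeff, MvPolynomial.coeff_zero]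
    by_contra hc
    exact hJ (h _ hc)
  · rintro h ⟨m, J⟩ hb
    by_contra hJ
    apply hb
    rw [← co_coeff, h J hJ, MvPolynomial.coeff_zero]

lemma AL_mul {L : Finset Y} {x z : A} (hx : x ∈ F.AL L) (hz : z ∈ F.AL L) : x * z ∈ F.AL L :=
  F.sp_mul (fun _ hb _ hb' _ => Finset.union_subset hb hb') hx hz

lemma φ_mul_AL {L : Finset Y} (s) {x : A} (h : x ∈ F.AL L) : F.φ s * x ∈ F.AL L := by
  rw [mem_AL] at *
  intro J hJ; rw [co_φ_mul, h J hJ, mul_zero]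

lemma AL_mono {L L' : Finset Y} (h : L ⊆ L') : F.AL L ≤ F.AL L' :=
  F.sp_mono (fun _ hb => Finset.Subset.trans hb h)

lemma AL_univ (x : A) : x ∈ F.AL Finset.univ := by
  rw [mem_AL]; intro J hJ; exact absurd (Finset.subset_univ _) hJ

lemma y_mem_AL {L : Finset Y} {j : Y} (h : j ∈ L) : F.B (0, {j}) ∈ F.AL L :=
  F.B_mem_sp (by simpa using h)

/-- contraction with `y_j` -/
noncomputable def ctr (j : Y) : A →ₗ[ℚ] A :=
  F.B.constr ℚ (fun b => if j ∈ b.2 then F.sg {j} (b.2.erase j) • F.B (b.1, b.2.erase j) else 0)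

lemma ctr_B (j : Y) (b : Idx X Y) : F.ctr j (F.B b) =
    if j ∈ b.2 then F.sg {j} (b.2.erase j) • F.B (b.1, b.2.erase j) else 0 := by
  rw [ctr, Module.Basis.constr_basis]

lemma ctr_mem {j : Y} {L : Finset Y} {l : ℕ} {x : A}
    (hx : x ∈ F.sp {b | b.2 ⊆ insert j L ∧ b.2.card = l}) :
    F.ctr j x ∈ F.sp {b | b.2 ⊆ L ∧ b.2.card + 1 = l} := by
  refine F.sp_map_le _ ?_ hx
  rintro ⟨m, J⟩ ⟨h1, h2⟩
  rw [ctr_B]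
  split_ifs with h
  · refine Submodule.smul_mem _ _ (F.B_mem_sp ⟨?_, ?_⟩)
    · intro i hi
      rw [Finset.mem_erase] at hi
      exact (Finset.mem_insert.1 (h1 hi.2)).resolve_left hi.1
    · rw [← h2]; exact Finset.card_erase_add_one h
  · exact Submodule.zero_mem _

lemma sub_ctr_mem {j : Y} {L : Finset Y} {l : ℕ} {x : A}
    (hx : x ∈ F.sp {b | b.2 ⊆ insert j L ∧ b.2.card = l}) :
    x - F.B (0, {j}) * F.ctr j x ∈ F.sp {b | b.2 ⊆ L ∧ b.2.card = l} := by
  refine F.sp_map_le (LinearMap.id - LinearMap.mulLeft ℚ (F.B (0, {j})) ∘ₗ F.ctr j) ?_ hx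
  rintro ⟨m, J⟩ ⟨h1, h2⟩
  simp only [LinearMap.sub_apply, LinearMap.id_apply, LinearMap.comp_apply, LinearMap.mulLeft_apply]
  rw [ctr_B]
  split_ifs with h
  · rw [mul_smul_comm, B_mul, smul_smul, F.sg_disj _ _ (by simp), one_smul, zero_add]
    have : {j} ∪ J.erase j = J := by
      rw [← Finset.insert_eq]; exact Finset.insert_erase h
    simp only at this ⊢
    rw [this, sub_self]; exact Submodule.zero_mem _
  · rw [mul_zero, sub_zero]
    refine F.B_mem_sp ⟨?_, h2⟩
    intro i hi
    refine (Finset.mem_insert.1 (h1 hi)).resolve_left ?_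
    rintro rfl; exact h hi

lemma AL_split {j : Y} {L : Finset Y} {x : A} (hx : x ∈ F.AL (insert j L)) :
    ∃ a ∈ F.AL L, ∃ b ∈ F.AL L, x = a + F.B (0, {j}) * b := by
  refine F.sp_induction (P := fun x => ∃ a ∈ F.AL L, ∃ b ∈ F.AL L, x = a + F.B (0, {j}) * b) ?_ ?_ ?_ ?_ hx
  · exact ⟨0, Submodule.zero_mem _, 0, Submodule.zero_mem _, by simp⟩
  · rintro _ _ ⟨a, ha, b, hb, rfl⟩ ⟨a', ha', b', hb', rfl⟩
    exact ⟨a + a', Submodule.add_mem _ ha ha', b + b', Submodule.add_mem _ hb hb', by rw [mul_add]; abel⟩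
  · rintro q _ ⟨a, ha, b, hb, rfl⟩
    exact ⟨q • a, Submodule.smul_mem _ _ ha, q • b, Submodule.smul_mem _ _ hb, by rw [smul_add, mul_smul_comm]⟩
  · intro b hb
    have h : F.B b ∈ F.sp {b' | b'.2 ⊆ insert j L ∧ b'.2.card = b.2.card} := F.B_mem_sp ⟨hb, rfl⟩
    exact ⟨_, F.sp_mono (fun _ h => h.1) (F.sub_ctr_mem h), _, F.sp_mono (fun _ h => h.1) (F.ctr_mem h),
      by rw [sub_add_cancel]⟩

lemma ds_AL {L : Finset Y} {x : A} (hx : x ∈ F.AL L) : F.ds x ∈ F.AL L := by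
  induction L using Finset.induction_on generalizing x with
  | empty =>
    rw [F.ds_YL0 (F.sp_mono ?_ hx)]
    · exact Submodule.zero_mem _
    · intro b hb
      exact Finset.card_eq_zero.2 (Finset.subset_empty.1 hb)
  | insert j L hj ih =>
    obtain ⟨a, ha, b, hb, rfl⟩ := F.AL_split hx
    have hm := F.AL_mono (Finset.subset_insert j L)
    rw [map_add, ds_y_mul]
    refine Submodule.add_mem _ (hm (ih ha)) (Submodule.sub_mem _ (hm (F.φ_mul_AL _ hb)) ?_)
    exact F.AL_mul (F.y_mem_AL (Finset.mem_insert_self _ _)) (hm (ih hb))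

lemma co_y_mul {j : Y} {J : Finset Y} (hj : j ∉ J) (x : A) :
    F.co (insert j J) (F.B (0, {j}) * x) = F.sg {j} J • F.co J x := by
  refine F.ext_B (f := F.co (insert j J) ∘ₗ LinearMap.mulLeft ℚ (F.B (0, {j}))) (g := F.sg {j} J • F.co J) ?_ x
  rintro ⟨m, J'⟩
  simp only [LinearMap.comp_apply, LinearMap.mulLeft_apply, LinearMap.smul_apply]
  rw [B_mul, map_smul, co_B, co_B, zero_add]
  simp only
  by_cases h : J' = J
  · subst h
    rw [if_pos rfl, if_pos (by rw [Finset.insert_eq])]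
  · rw [if_neg h, smul_zero]
    by_cases h1 : j ∈ J'
    · rw [F.sg_ndisj _ _ (by simpa using h1), zero_smul]
    · rw [if_neg, smul_zero]
      intro h2
      apply h
      rw [← Finset.insert_eq] at h2
      rw [← Finset.erase_insert h1, h2, Finset.erase_insert hj]

lemma IA_split {I : Ideal (MvPolynomial X ℚ)} {j : Y} {L : Finset Y} (hj : j ∉ L) {a b : A}
    (ha : a ∈ F.AL L) (hb : b ∈ F.AL L) (h : a + F.B (0, {j}) * b ∈ F.IA I) :
    a ∈ F.IA I ∧ b ∈ F.IA I := by
  have hbI : b ∈ F.IA I := by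
    intro J
    by_cases hJ : J ⊆ L
    · have hjJ : j ∉ J := fun h => hj (hJ h)
      have := h (insert j J)
      rw [map_add, (F.mem_AL.1 ha) (insert j J) (fun h => hj (h (Finset.mem_insert_self _ _))), zero_add,
        co_y_mul _ hjJ] at this
      have h2 := I.mul_mem_left (MvPolynomial.C (F.sg {j} J)) this
      rw [← MvPolynomial.smul_eq_C_mul, smul_smul, F.sg_disj _ _ (by simpa using hjJ), one_smul] at h2
      exact h2
    · rw [F.mem_AL.1 hb J hJ]; exact I.zero_mem
  refine ⟨?_, hbI⟩
  have := Submodule.sub_mem _ h (F.IA_mul_left (F.B (0, {j})) hbI)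
  simpa using this

lemma IA_sup {I : Ideal (MvPolynomial X ℚ)} {g : MvPolynomial X ℚ} {L : Finset Y} {x : A}
    (hx : x ∈ F.IA (I ⊔ Ideal.span {g})) (hL : x ∈ F.AL L) :
    ∃ i ∈ F.IA I, ∃ e ∈ F.AL L, i ∈ F.AL L ∧ x = i + F.φ g * e := by
  have : ∀ J, ∃ i ∈ I, ∃ e, F.co J x = i + g * e ∧ (¬ J ⊆ L → e = 0) := by
    intro J
    by_cases hJ : J ⊆ L
    · obtain ⟨i, hi, g', hg, h⟩ := Submodule.mem_sup.1 (hx J)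
      obtain ⟨e, rfl⟩ := Ideal.mem_span_singleton'.1 hg
      exact ⟨i, hi, e, by rw [← h, mul_comm], fun h => absurd hJ h⟩
    · exact ⟨0, I.zero_mem, 0, by rw [F.mem_AL.1 hL J hJ]; simp, fun _ => rfl⟩
  choose i hi e he h0 using this
  have hxe : x = F.mkA i + F.φ g * F.mkA e := by
    refine F.ext_co (fun J => ?_)
    rw [map_add, co_φ_mul, co_mk, co_mk, he]
  have hmk : F.mkA e ∈ F.AL L := by
    rw [mem_AL]; intro J hJ; rw [co_mk, h0 J hJ]
  refine ⟨F.mkA i, fun J => by rw [co_mk]; exact hi J, F.mkA e, hmk, ?_, hxe⟩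
  rw [← sub_eq_iff_eq_add] at hxe
  rw [← hxe]; exact Submodule.sub_mem _ hL (F.φ_mul_AL _ hmk)

end FA

def NZD {S : Type} [CommRing S] (I : Ideal S) (a : S) : Prop := ∀ s, a * s ∈ I → s ∈ I

namespace FA

variable {X Y A : Type} [Fintype X] [DecidableEq X] [Fintype Y] [DecidableEq Y]
    [Ring A] [Algebra ℚ A] (F : FA X Y A)

def SL (L : Finset Y) (l : ℕ) : Submodule ℚ A := F.sp {b | b.2 ⊆ L ∧ b.2.card = l}

noncomputable def Zs (I : Ideal (MvPolynomial X ℚ)) (L : Finset Y) (l : ℕ) : Submodule ℚ A :=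
  F.SL L l ⊓ (F.IA I).comap F.ds

noncomputable def Es (I : Ideal (MvPolynomial X ℚ)) (L : Finset Y) : Submodule ℚ A :=
  (F.AL L).map F.ds ⊔ F.IA I

lemma SL_le (L : Finset Y) (l : ℕ) : F.SL L l ≤ F.AL L := F.sp_mono (fun _ h => h.1)

lemma stepA {I : Ideal (MvPolynomial X ℚ)} {L : Finset Y} {j : Y} (hj : j ∉ L) {w : A}
    (hw : w ∈ F.SL L 1) (hτ : F.τ w = - w) {h : MvPolynomial X ℚ} (hh : F.ds w = F.φ h)
    (hg : NZD I (F.f j + h)) {l k : ℕ}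
    (H : HB (F.Zs (I ⊔ Ideal.span {F.f j + h}) L l) (F.Es (I ⊔ Ideal.span {F.f j + h}) L) k) :
    HB (F.Zs I (insert j L) l) (F.Es I (insert j L)) k := by
  set g := F.f j + h with hgdef
  set y' := F.B (0, {j}) + w with hy
  have hwA : w ∈ F.AL L := F.SL_le _ _ hw
  have hds : ∀ x, F.ds (y' * x) = F.φ g * x - y' * F.ds x := by
    intro x
    rw [hy, add_mul, map_add, ds_y_mul, ds_leib, hτ, hh, hgdef, map_add, add_mul, add_mul]
    simp only [neg_mul]; abel
  have hmono := F.AL_mono (Finset.subset_insert j L)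
  have hy' : y' ∈ F.AL (insert j L) :=
    Submodule.add_mem _ (F.y_mem_AL (Finset.mem_insert_self _ _)) (hmono hwA)
  have hIle : I ≤ I ⊔ Ideal.span {g} := le_sup_left
  have hgI : g ∈ I ⊔ Ideal.span {g} := Ideal.mem_sup_right (Ideal.mem_span_singleton_self g)
  let fm : A →ₗ[ℚ] A := LinearMap.id - LinearMap.mulLeft ℚ y' ∘ₗ F.ctr j
  have hf : ∀ z, fm z = z - y' * F.ctr j z := fun z => rfl
  have key : ∀ z ∈ F.Zs I (insert j L) l, F.ctr j z ∈ F.AL L ∧ fm z ∈ F.SL L l ∧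
      F.ds (fm z) + F.φ g * F.ctr j z ∈ F.IA I := by
    rintro z ⟨hz1, hz2⟩
    have hb := F.ctr_mem hz1
    have hbA : F.ctr j z ∈ F.AL L := F.sp_mono (fun _ h => h.1) hb
    have ha : fm z ∈ F.SL L l := by
      rw [hf, hy, add_mul, ← sub_sub]
      refine Submodule.sub_mem _ (F.sub_ctr_mem hz1) ?_
      refine F.sp_mul ?_ hw hb
      rintro b ⟨h1, h2⟩ b' ⟨h3, h4⟩ hd
      refine ⟨Finset.union_subset h1 h3, ?_⟩
      simp only
      rw [Finset.card_union_of_disjoint hd]; omega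
    refine ⟨hbA, ha, ?_⟩
    have hz : z = fm z + y' * F.ctr j z := by rw [hf]; abel
    have e : F.ds z = (F.ds (fm z) + F.φ g * F.ctr j z - w * F.ds (F.ctr j z)) +
        F.B (0, {j}) * (- F.ds (F.ctr j z)) := by
      conv_lhs => rw [hz, map_add, hds, hy, add_mul]
      rw [mul_neg]; abel
    have hz2' : F.ds z ∈ F.IA I := hz2
    rw [e] at hz2'
    have h3 := F.IA_split hj (Submodule.sub_mem _ (Submodule.add_mem _ (F.ds_AL (F.SL_le _ _ ha))
      (F.φ_mul_AL _ hbA)) (F.AL_mul hwA (F.ds_AL hbA))) (Submodule.neg_mem _ (F.ds_AL hbA)) hz2'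
    have h4 : F.ds (F.ctr j z) ∈ F.IA I := by simpa using h3.2
    have := Submodule.add_mem _ h3.1 (F.IA_mul_left w h4)
    simpa using this
  have H2 : HB ((F.Zs I (insert j L) l).map fm) (F.Es (I ⊔ Ideal.span {g}) L) k := by
    refine H.mono ?_ le_rfl le_rfl
    rintro _ ⟨z, hz, rfl⟩
    obtain ⟨hb, ha, hc⟩ := key z hz
    refine ⟨ha, ?_⟩
    have := Submodule.sub_mem _ (F.IA_mono hIle hc) (F.φ_mul_mem_IA hgI (F.ctr j z))
    simpa using this
  refine (HB.mapLemma fm H2).mono le_rfl ?_ le_rfl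
  rintro z ⟨hz, hz'⟩
  obtain ⟨hb, ha, hc⟩ := key z hz
  obtain ⟨_, ⟨u, hu, rfl⟩, x, hx, hux⟩ := Submodule.mem_sup.1 hz'
  have hxA : x ∈ F.AL L := by
    have : x = fm z - F.ds u := by rw [← hux]; abel
    rw [this]; exact Submodule.sub_mem _ (F.SL_le _ _ ha) (F.ds_AL hu)
  obtain ⟨i, hi, e, he, hiA, rfl⟩ := F.IA_sup hx hxA
  have hb' : F.ctr j z + F.ds e ∈ F.IA I := by
    have h1 : F.φ g * (F.ctr j z + F.ds e) ∈ F.IA I := by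
      rw [← hux, map_add, map_add, F.ds_sq, ds_φ_mul] at hc
      have := Submodule.sub_mem _ hc (F.ds_IA hi)
      convert this using 1
      rw [mul_add]; abel
    intro J
    apply hg
    have := h1 J
    rwa [co_φ_mul] at this
  have hz3 : z = F.ds (u + y' * e) + (i + y' * (F.ctr j z + F.ds e)) := by
    have hz : z = fm z + y' * F.ctr j z := by rw [hf]; abel
    conv_lhs => rw [hz, ← hux]
    rw [map_add F.ds u, hds, mul_add y']; abel
  rw [hz3]
  refine Submodule.add_mem _ (Submodule.mem_sup_left ⟨_, ?_, rfl⟩) (Submodule.mem_sup_right ?_)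
  · exact Submodule.add_mem _ (hmono hu) (F.AL_mul hy' (hmono he))
  · exact Submodule.add_mem _ hi (F.IA_mul_left _ hb')

lemma baseA {I : Ideal (MvPolynomial X ℚ)} {D : ℕ}
    (h : HB (⊤ : Submodule ℚ (MvPolynomial X ℚ)) (I.restrictScalars ℚ) D) (L : Finset Y) (l : ℕ) :
    HB (F.Zs I L l) (F.Es I L) (L.card.choose l * D) := by
  have key : ∀ T : Finset (Finset Y), ∀ Z : Submodule ℚ A, (∀ x ∈ Z, ∀ J, J ∉ T → F.co J x ∈ I) →
      HB Z (F.IA I) (T.card * D) := by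
    intro T
    induction T using Finset.induction_on with
    | empty =>
      intro Z hZ
      refine ⟨⊥, inferInstance, by simp, ?_⟩
      rw [bot_sup_eq]
      intro x hx J; exact hZ x hx J (by simp)
    | insert J T hJ ih =>
      intro Z hZ
      have h1 : HB (Z.map (F.co J)) (I.restrictScalars ℚ) D := h.mono le_top le_rfl le_rfl
      have h2 := HB.mapLemma (F.co J) h1
      have h3 := ih (Z ⊓ (I.restrictScalars ℚ).comap (F.co J)) (by
        rintro x ⟨hx, hx'⟩ J' hJ'
        by_cases e : J' = J
        · subst e; exact hx'
        · exact hZ x hx J' (by simp [e, hJ']))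
      rw [Finset.card_insert_of_notMem hJ, add_mul, one_mul, add_comm]
      exact h2.trans h3
  have := key (L.powersetCard l) (F.Zs I L l) (by
    rintro x ⟨hx, -⟩ J hJ
    have : F.co J x = 0 := by
      ext m
      rw [co_coeff, MvPolynomial.coeff_zero]
      by_contra hc
      have := (F.mem_sp.1 hx) _ hc
      exact hJ (Finset.mem_powersetCard.2 this)
    rw [this]; exact I.zero_mem)
  rw [Finset.card_powersetCard] at this
  exact this.mono le_rfl le_sup_right le_rfl

lemma pr_ds (l : ℕ) (x : A) :
    F.pr {b | b.2.card = l} (F.ds x) = F.ds (F.pr {b | b.2.card = l + 1} x) := by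
  refine F.ext_B (f := F.pr {b | b.2.card = l} ∘ₗ F.ds) (g := F.ds ∘ₗ F.pr {b | b.2.card = l + 1}) ?_ x
  intro b
  simp only [LinearMap.comp_apply]
  have h : F.ds (F.B b) ∈ F.sp {b' | b'.2.card + 1 = b.2.card} := F.ds_YL (F.B_mem_sp rfl)
  by_cases hb : b.2.card = l + 1
  · rw [F.pr_B_mem (by exact hb), F.pr_eq_self]
    refine F.sp_mono ?_ h
    intro b' hb'
    simp only [Set.mem_ofPred_eq] at *
    omega
  · rw [F.pr_B_not_mem (by exact hb), map_zero]
    refine F.pr_eq_zero h ?_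
    intro b' hb' hb''
    simp only [Set.mem_ofPred_eq] at *
    omega

set_option maxHeartbeats 1000000 in
theorem spectral {k : ℕ → ℕ} (H : ∀ l, HB (F.Zs ⊥ Finset.univ l) (F.Es ⊥ Finset.univ) (k l)) :
    HB (LinearMap.ker F.d) (LinearMap.range F.d) (∑ l ∈ Finset.range (Fintype.card Y + 1), k l) := by
  have key : ∀ t l, l + t = Fintype.card Y + 1 → HB (LinearMap.ker F.d ⊓ F.YG l) (LinearMap.range F.d)
      (∑ i ∈ Finset.range t, k (l + i)) := by
    intro t
    induction t with
    | zero =>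
      intro l hl
      refine ⟨⊥, inferInstance, by simp, ?_⟩
      rintro x ⟨-, hx⟩
      rw [F.mem_sp_zero hx]
      · exact Submodule.zero_mem _
      · rintro b hb
        simp only [Set.mem_ofPred_eq] at hb
        have := Finset.card_le_univ b.2
        omega
    | succ t ih =>
      intro l hl
      have h1 := ih (l + 1) (by omega)
      have hpart : ∀ z ∈ LinearMap.ker F.d ⊓ F.YG l, F.pr {b | b.2.card = l} z ∈ F.YL l ∧
          z - F.pr {b | b.2.card = l} z ∈ F.YG (l + 1) ∧ F.ds (F.pr {b | b.2.card = l} z) = 0 := by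
        rintro z ⟨hz, hzl⟩
        have a1 : F.pr {b | b.2.card = l} z ∈ F.YL l := F.pr_mem _ _
        have a2 : z - F.pr {b | b.2.card = l} z ∈ F.YG (l + 1) := by
          refine F.sp_map_le (LinearMap.id - F.pr {b | b.2.card = l}) ?_ hzl
          intro b hb
          simp only [Set.mem_ofPred_eq] at hb
          simp only [LinearMap.sub_apply, LinearMap.id_apply]
          by_cases h : b.2.card = l
          · rw [F.pr_B_mem (by exact h), sub_self]; exact Submodule.zero_mem _
          · rw [F.pr_B_not_mem (by exact h), sub_zero]
            refine F.B_mem_sp ?_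
            simp only [Set.mem_ofPred_eq]; omega
        refine ⟨a1, a2, ?_⟩
        have b1 := F.d_sub_ds hzl
        rw [LinearMap.mem_ker.1 hz, zero_sub] at b1
        have b2 : F.ds z ∈ F.YG l := F.YG_mono (Nat.le_succ l) (by simpa using b1)
        have b3 : F.ds (z - F.pr {b | b.2.card = l} z) ∈ F.YG l := by
          have := Submodule.sub_mem _ (F.d_YG a2) (F.YG_mono (by omega : l ≤ l + 1 + 1) (F.d_sub_ds a2))
          simpa using this
        have b4 := Submodule.sub_mem _ b2 b3
        rw [map_sub, sub_sub_cancel] at b4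
        refine F.mem_sp_zero (F.mem_sp_inter b4 (F.ds_YL a1)) ?_
        rintro b ⟨h, h'⟩
        simp only [Set.mem_ofPred_eq] at h h'
        omega
      have h2 : HB ((LinearMap.ker F.d ⊓ F.YG l).map (F.pr {b | b.2.card = l})) (LinearMap.range F.ds) (k l) := by
        refine (H l).mono ?_ ?_ le_rfl
        · rintro _ ⟨z, hz, rfl⟩
          obtain ⟨a1, -, a3⟩ := hpart z hz
          refine Submodule.mem_inf.2 ⟨?_, ?_⟩
          · refine F.sp_mono ?_ a1
            intro b hb
            exact ⟨Finset.subset_univ _, hb⟩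
          · rw [Submodule.mem_comap, a3]; exact Submodule.zero_mem _
        · refine sup_le ?_ ?_
          · rintro _ ⟨u, -, rfl⟩; exact ⟨u, rfl⟩
          · rw [IA_bot]; exact bot_le
      have h3 := HB.mapLemma _ h2
      have h4 : LinearMap.ker F.d ⊓ F.YG l ⊓ (LinearMap.range F.ds).comap (F.pr {b | b.2.card = l}) ≤
          (LinearMap.ker F.d ⊓ F.YG (l + 1)) ⊔ LinearMap.range F.d := by
        rintro z ⟨hz, u, hu⟩
        obtain ⟨a1, a2, a3⟩ := hpart z hz
        set u' := F.pr {b | b.2.card = l + 1} u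
        have e : F.ds u' = F.pr {b | b.2.card = l} z := by
          rw [← pr_ds, hu, F.pr_eq_self a1]
        have hu' : u' ∈ F.YG l := F.YG_mono (Nat.le_succ l) (F.YL_le (l + 1) (F.pr_mem _ _))
        refine Submodule.mem_sup.2 ⟨z - F.d u', ⟨?_, ?_⟩, F.d u', ⟨u', rfl⟩, sub_add_cancel _ _⟩
        · refine LinearMap.mem_ker.2 ?_
          rw [map_sub, F.d_sq, LinearMap.mem_ker.1 hz.1, sub_zero]
        · have := Submodule.sub_mem _ a2 (F.d_sub_ds hu')
          rw [e] at this
          have e2 : z - F.pr {b | b.2.card = l} z - (F.d u' - F.pr {b | b.2.card = l} z) = z - F.d u' := by abel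
          rw [e2] at this
          exact this
      rw [Finset.sum_range_succ', add_zero, add_comm]
      refine h3.trans ?_
      obtain ⟨W, w1, w2, w3⟩ := h1
      refine ⟨W, w1, ?_, h4.trans (sup_le w3 le_sup_right)⟩
      refine w2.trans (le_of_eq (Finset.sum_congr rfl fun i _ => by congr 1; omega))
  have := key (Fintype.card Y + 1) 0 (by omega)
  simp only [zero_add] at this
  refine this.mono ?_ le_rfl le_rfl
  intro z hz
  refine ⟨hz, F.sp_mono (fun b _ => Nat.zero_le _) (F.mem_univ_sp z)⟩

end FA

section CA
variable {S : Type} [CommRing S] [IsNoetherianRing S] (m : Ideal S)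

lemma exists_ass (I : Ideal S) : ∃ Ps : Finset (Ideal S),
    (∀ P ∈ Ps, P.IsPrime ∧ I ≤ P ∧ ∃ s, s ∉ I ∧ ∀ c ∈ P, c * s ∈ I) ∧
    (∀ e, (∀ P ∈ Ps, e ∉ P) → NZD I e) ∧ (I ≠ ⊤ → Ps.Nonempty) := by
  have hfin := associatedPrimes.finite S (S ⧸ I)
  refine ⟨hfin.toFinset, ?_, ?_, ?_⟩
  · intro P hP
    rw [Set.Finite.mem_toFinset] at hP
    obtain ⟨hp, x, hx⟩ := isAssociatedPrime_iff.1 hP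
    obtain ⟨s, rfl⟩ := Ideal.Quotient.mk_surjective x
    have key : ∀ c, c ∈ P ↔ c * s ∈ I := by
      intro c
      rw [hx, Submodule.mem_colon_singleton, Submodule.mem_bot, ← Ideal.Quotient.eq_zero_iff_mem, map_mul,
        Algebra.smul_def]
      rfl
    refine ⟨hp, ?_, s, ?_, fun c hc => (key c).1 hc⟩
    · intro i hi; exact (key i).2 (I.mul_mem_right _ hi)
    · intro hs
      apply hp.ne_top
      rw [Ideal.eq_top_iff_one, key, one_mul]; exact hs
  · intro e he s hs
    by_contra hsI
    have : e ∈ ⋃ p ∈ associatedPrimes S (S ⧸ I), (p : Set S) := by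
      rw [biUnion_associatedPrimes_eq_zero_divisors]
      refine ⟨Ideal.Quotient.mk I s, ?_, ?_⟩
      · rwa [Ne, Ideal.Quotient.eq_zero_iff_mem]
      · rw [Algebra.smul_def]
        change Ideal.Quotient.mk I e * _ = 0
        rw [← map_mul, Ideal.Quotient.eq_zero_iff_mem]; exact hs
    simp only [Set.mem_iUnion] at this
    obtain ⟨P, hP, heP⟩ := this
    exact he P (by rwa [Set.Finite.mem_toFinset]) heP
  · intro h
    haveI : Nontrivial (S ⧸ I) := Ideal.Quotient.nontrivial_iff.2 h
    obtain ⟨P, hP⟩ := associatedPrimes.nonempty S (S ⧸ I)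
    exact ⟨P, by rwa [Set.Finite.mem_toFinset]⟩

def Soc0 (I : Ideal S) : Prop := ∀ s, (∀ c ∈ m, c * s ∈ I) → s ∈ I

def Dp : ℕ → Ideal S → Prop
  | 0, _ => True
  | r + 1, I => ∃ a ∈ m, NZD I a ∧ Dp r (I ⊔ Ideal.span {a})

variable {m}

lemma NZD.soc0 {I : Ideal S} {a : S} (ha : a ∈ m) (h : NZD I a) : Soc0 m I :=
  fun s hs => h s (hs a ha)

lemma mem_sup_span {I : Ideal S} {a x : S} :
    x ∈ I ⊔ Ideal.span {a} ↔ ∃ i ∈ I, ∃ t, x = i + a * t := by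
  constructor
  · intro h
    obtain ⟨i, hi, g', hg, h⟩ := Submodule.mem_sup.1 h
    obtain ⟨e, rfl⟩ := Ideal.mem_span_singleton'.1 hg
    exact ⟨i, hi, e, by rw [← h, mul_comm]⟩
  · rintro ⟨i, hi, t, rfl⟩
    exact Ideal.add_mem _ (Ideal.mem_sup_left hi)
      (Ideal.mem_sup_right (Ideal.mul_mem_right _ _ (Ideal.mem_span_singleton_self a)))

lemma soc_exchange {I : Ideal S} {a b : S} (ha : a ∈ m) (hb : b ∈ m) (hna : NZD I a) (hnb : NZD I b)
    (h : Soc0 m (I ⊔ Ideal.span {a})) : Soc0 m (I ⊔ Ideal.span {b}) := by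
  intro s hs
  obtain ⟨i, hi, t, ht⟩ := mem_sup_span.1 (hs a ha)
  have h1 : t ∈ I ⊔ Ideal.span {a} := by
    apply h
    intro c hc
    obtain ⟨i', hi', u, hu⟩ := mem_sup_span.1 (hs c hc)
    have : b * (c * t - a * u) ∈ I := by
      have e : b * (c * t - a * u) = a * i' - c * i := by
        have h2 : b * t = a * s - i := by rw [ht]; ring
        have h3 : b * u = c * s - i' := by rw [hu]; ring
        linear_combination c * h2 - a * h3
      rw [e]
      exact I.sub_mem (I.mul_mem_left _ hi') (I.mul_mem_left _ hi)
    exact mem_sup_span.2 ⟨_, hnb _ this, u, by ring⟩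
  obtain ⟨i', hi', u, hu⟩ := mem_sup_span.1 h1
  have : a * (s - b * u) ∈ I := by
    have e : a * (s - b * u) = i + b * i' := by rw [mul_sub, ht, hu]; ring
    rw [e]; exact I.add_mem hi (I.mul_mem_left _ hi')
  exact mem_sup_span.2 ⟨_, hna _ this, u, by ring⟩

lemma exists_nzd [m.IsMaximal] {I J K : Ideal S} (hI : Soc0 m I) (hJ : Soc0 m J) (hK : Soc0 m K) :
    ∃ e ∈ m, NZD I e ∧ NZD J e ∧ NZD K e := by
  classical
  obtain ⟨P1, a1, b1, -⟩ := exists_ass I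
  obtain ⟨P2, a2, b2, -⟩ := exists_ass J
  obtain ⟨P3, a3, b3, -⟩ := exists_ass K
  have key : ∀ {I P : Ideal S}, Soc0 m I → (P.IsPrime ∧ I ≤ P ∧ ∃ s, s ∉ I ∧ ∀ c ∈ P, c * s ∈ I) → ¬ m ≤ P := by
    rintro I P hI ⟨hp, hle, s, hs, h⟩ hm
    exact hs (hI s (fun c hc => h c (hm hc)))
  have : ¬ ((m : Set S) ⊆ ⋃ i ∈ ((P1 ∪ P2 ∪ P3 : Finset (Ideal S)) : Set (Ideal S)), ((id i : Ideal S) : Set S)) := by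
    rw [Ideal.subset_union_prime ⊥ ⊥]
    · rintro ⟨P, hP, hle⟩
      simp only [Finset.mem_union] at hP
      rcases hP with (hP | hP) | hP
      · exact key hI (a1 P hP) hle
      · exact key hJ (a2 P hP) hle
      · exact key hK (a3 P hP) hle
    · intro P hP _ _
      simp only [Finset.mem_union] at hP
      rcases hP with (hP | hP) | hP
      · exact (a1 P hP).1
      · exact (a2 P hP).1
      · exact (a3 P hP).1
  rw [Set.not_subset] at this
  obtain ⟨e, he, hne⟩ := this
  simp only [Set.mem_iUnion, not_exists] at hne
  refine ⟨e, he, b1 e fun P hP h => hne P (by simp [hP]) h, b2 e fun P hP h => hne P (by simp [hP]) h,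
    b3 e fun P hP h => hne P (by simp [hP]) h⟩

lemma nzd_swap {I : Ideal S} {a e : S} (hna : NZD I a) (he : NZD (I ⊔ Ideal.span {a}) e) :
    NZD (I ⊔ Ideal.span {e}) a := by
  intro s hs
  obtain ⟨i, hi, t, ht⟩ := mem_sup_span.1 hs
  have : e * t ∈ I ⊔ Ideal.span {a} := mem_sup_span.2 ⟨-i, I.neg_mem hi, s, by rw [ht]; ring⟩
  obtain ⟨i', hi', u, hu⟩ := mem_sup_span.1 (he t this)
  have h2 : a * (s - e * u) ∈ I := by
    have e' : a * (s - e * u) = i + e * i' := by rw [mul_sub, ht, hu]; ring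
    rw [e']; exact I.add_mem hi (I.mul_mem_left _ hi')
  exact mem_sup_span.2 ⟨_, hna _ h2, u, by ring⟩

theorem Dp_exchange [m.IsMaximal] (r : ℕ) : ∀ {I : Ideal S} {a b : S}, a ∈ m → b ∈ m → NZD I a → NZD I b →
    Dp m r (I ⊔ Ideal.span {a}) → Dp m r (I ⊔ Ideal.span {b}) := by
  induction r with
  | zero => intros; trivial
  | succ r ih =>
    rintro I a b ha hb hna hnb ⟨a', ha', hna', h⟩
    have s1 := hna'.soc0 ha'
    have s2 := soc_exchange ha hb hna hnb s1
    obtain ⟨e, he, -, e2, e3⟩ := exists_nzd (hna.soc0 ha) s1 s2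
    have h1 := ih ha' he hna' e2 h
    rw [sup_assoc, sup_comm (Ideal.span {a}), ← sup_assoc] at h1
    have h2 := ih ha hb (nzd_swap hna e2) (nzd_swap hnb e3) h1
    rw [sup_assoc, sup_comm (Ideal.span {e}), ← sup_assoc] at h2
    exact ⟨e, he, e3, h2⟩

lemma Dp_step [m.IsMaximal] {r : ℕ} {I : Ideal S} {b : S} (h : Dp m (r + 1) I) (hb : b ∈ m) (hnb : NZD I b) :
    Dp m r (I ⊔ Ideal.span {b}) := by
  obtain ⟨a, ha, hna, h⟩ := h
  exact Dp_exchange r ha hb hna hnb h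

variable [Algebra ℚ S] {Y : Type} [Fintype Y] [DecidableEq Y]

def Good (f : Y → S) (T : Finset Y) : List Y → Ideal S → Ideal S → Prop
  | [], I, I' => I = I'
  | j :: L, I, I' => ∃ c : Y → ℚ, NZD I (f j + ∑ i ∈ L.toFinset ∪ T, c i • f i) ∧
      Good f T L (I ⊔ Ideal.span {f j + ∑ i ∈ L.toFinset ∪ T, c i • f i}) I'

lemma exists_generic (f : Y → S) (j : Y) (T : Finset Y) (hj : j ∉ T) (Ps : Finset (Ideal S))
    (h : ∀ P ∈ Ps, ∃ i ∈ insert j T, f i ∉ P) :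
    ∃ c : Y → ℚ, ∀ P ∈ Ps, f j + ∑ i ∈ T, c i • f i ∉ P := by
  classical
  let g : (Y → ℚ) →ₗ[ℚ] S := ∑ i ∈ insert j T, (LinearMap.toSpanSingleton ℚ S (f i)) ∘ₗ LinearMap.proj i
  have hg : ∀ c, g c = ∑ i ∈ insert j T, c i • f i := by
    intro c; simp [g, LinearMap.sum_apply]
  let V : Ideal S → Subspace ℚ (Y → ℚ) := fun P => (P.restrictScalars ℚ).comap g
  let s : Finset (Subspace ℚ (Y → ℚ)) := insert (LinearMap.ker (LinearMap.proj (R := ℚ) (φ := fun _ : Y => ℚ) j)) (Ps.image V)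
  have htop : ⊤ ∉ s := by
    intro ht
    rw [Finset.mem_insert] at ht
    rcases ht with ht | ht
    · have : (Pi.single j 1 : Y → ℚ) ∈ LinearMap.ker (LinearMap.proj (R := ℚ) (φ := fun _ : Y => ℚ) j) := by
        rw [← ht]; trivial
      simp at this
    · obtain ⟨P, hP, hV⟩ := Finset.mem_image.1 ht
      obtain ⟨i, hi, hf⟩ := h P hP
      have : (Pi.single i 1 : Y → ℚ) ∈ V P := by rw [hV]; trivial
      have h2 : g (Pi.single i 1) ∈ P := this
      rw [hg, Finset.sum_eq_single i (by intro b _ hb; simp [Pi.single_apply, hb]) (by intro h; exact absurd hi h)] at h2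
      simp at h2
      exact hf h2
  have := Subspace.biUnion_ne_univ_of_top_notMem htop
  rw [Ne, Set.eq_univ_iff_forall, not_forall] at this
  obtain ⟨c, hc⟩ := this
  simp only [Set.mem_iUnion, not_exists] at hc
  have hcj : c j ≠ 0 := fun h0 => hc _ (Finset.mem_insert_self _ _) (by simpa using h0)
  refine ⟨fun i => (c j)⁻¹ * c i, fun P hP hmem => hc (V P) (Finset.mem_insert_of_mem (Finset.mem_image_of_mem _ hP)) ?_⟩
  change g c ∈ P
  have e : g c = algebraMap ℚ S (c j) * (f j + ∑ i ∈ T, ((c j)⁻¹ * c i) • f i) := by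
    rw [hg, Finset.sum_insert hj, ← Algebra.smul_def, smul_add, Finset.smul_sum]
    congr 1
    refine Finset.sum_congr rfl fun i _ => ?_
    rw [smul_smul, mul_inv_cancel_left₀ hcj]
  rw [e]
  exact P.mul_mem_left _ hmem

theorem good_exists [m.IsMaximal] (f : Y → S) (r : ℕ) : ∀ (L : List Y) (I : Ideal S), L.Nodup → (∀ j ∈ L, f j ∈ m) →
    I ≤ m → Dp m r I → m ≤ (I ⊔ Ideal.span (f '' {j | j ∈ L})).radical →
    ∃ L1 L2, L = L1 ++ L2 ∧ L1.length = r ∧ ∃ I', Good f L2.toFinset L1 I I' := by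
  classical
  induction r with
  | zero => intro L I _ _ _ _ _; exact ⟨[], L, rfl, rfl, I, rfl⟩
  | succ r ih =>
    intro L I hL hf hI hD hrad
    have hsoc : Soc0 m I := by obtain ⟨a, ha, hna, -⟩ := hD; exact hna.soc0 ha
    obtain ⟨Ps, h1, h2, h3⟩ := exists_ass I
    have hout : ∀ P ∈ Ps, ∃ i ∈ L.toFinset, f i ∉ P := by
      intro P hP
      by_contra hcon
      push Not at hcon
      obtain ⟨hp, hle, s, hs, hc⟩ := h1 P hP
      have : m ≤ P := by
        refine hrad.trans ?_
        rw [hp.radical_le_iff]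
        refine sup_le hle (Ideal.span_le.2 ?_)
        rintro _ ⟨j, hj, rfl⟩
        exact hcon j (List.mem_toFinset.2 hj)
      exact hs (hsoc s (fun c hc' => hc c (this hc')))
    have hItop : I ≠ ⊤ := fun h => Ideal.IsMaximal.ne_top (I := m) inferInstance (top_le_iff.1 (h ▸ hI))
    cases L with
    | nil =>
      obtain ⟨P, hP⟩ := h3 hItop
      obtain ⟨i, hi, -⟩ := hout P hP
      simp at hi
    | cons j L =>
      rw [List.nodup_cons] at hL
      have hj : j ∉ L.toFinset := fun h => hL.1 (List.mem_toFinset.1 h)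
      obtain ⟨c, hc⟩ := exists_generic f j L.toFinset hj Ps (by simpa using hout)
      set g := f j + ∑ i ∈ L.toFinset, c i • f i with hg
      have hgm : g ∈ m := by
        refine m.add_mem (hf j (by simp)) (Ideal.sum_mem _ fun i hi => ?_)
        rw [Algebra.smul_def]
        exact m.mul_mem_left _ (hf i (by simp [List.mem_toFinset.1 hi]))
      have hgn : NZD I g := h2 g hc
      obtain ⟨L1, L2, rfl, hlen, I', hgood⟩ := ih L (I ⊔ Ideal.span {g}) hL.2
        (fun i hi => hf i (by simp [hi])) (sup_le hI ((Ideal.span_singleton_le_iff_mem _).2 hgm))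
        (Dp_step hD hgm hgn) (by
          refine hrad.trans (Ideal.radical_mono (sup_le (le_sup_left.trans le_sup_left) (Ideal.span_le.2 ?_)))
          have hin : ∀ i ∈ L, f i ∈ (I ⊔ Ideal.span {g} ⊔ Ideal.span (f '' {j | j ∈ L})) := fun i hi =>
            Ideal.mem_sup_right (Ideal.subset_span ⟨i, hi, rfl⟩)
          rintro _ ⟨i, hi, rfl⟩
          rcases List.mem_cons.1 hi with rfl | hi
          · have e : f i = g - ∑ i ∈ L.toFinset, c i • f i := by rw [hg]; abel
            rw [e]
            refine Ideal.sub_mem _ (Ideal.mem_sup_left (Ideal.mem_sup_right (Ideal.mem_span_singleton_self g)))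
              (Ideal.sum_mem _ fun i hi => ?_)
            rw [Algebra.smul_def]
            exact Ideal.mul_mem_left _ _ (hin i (List.mem_toFinset.1 hi))
          · exact hin i hi)
      refine ⟨j :: L1, L2, rfl, by simp [hlen], I', c, ?_, ?_⟩
      · rw [← List.toFinset_append]; exact hgn
      · rw [← List.toFinset_append]; exact hgood

end CA

section vars
variable {X : Type} [Fintype X] [DecidableEq X]

/-- the augmentation ideal -/
noncomputable def mm (X : Type) : Ideal (MvPolynomial X ℚ) := RingHom.ker (MvPolynomial.constantCoeff (σ := X) (R := ℚ))

instance mm_max : (mm X).IsMaximal :=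
  RingHom.ker_isMaximal_of_surjective _ (fun q => ⟨MvPolynomial.C q, by simp⟩)

lemma mem_mm {s : MvPolynomial X ℚ} : s ∈ mm X ↔ MvPolynomial.coeff 0 s = 0 := Iff.rfl

lemma X_mem_mm (i : X) : MvPolynomial.X i ∈ mm X := by
  rw [mem_mm]; simp

noncomputable def IX (T : Finset X) : Ideal (MvPolynomial X ℚ) := Ideal.span (MvPolynomial.X '' (T : Set X))

lemma mem_IX {T : Finset X} {s : MvPolynomial X ℚ} :
    s ∈ IX T ↔ ∀ m, MvPolynomial.coeff m s ≠ 0 → ∃ i ∈ T, m i ≠ 0 := by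
  rw [IX, MvPolynomial.mem_ideal_span_X_image]; simp

lemma IX_le (T : Finset X) : IX T ≤ mm X := by
  rw [IX, Ideal.span_le]; rintro _ ⟨i, -, rfl⟩; exact X_mem_mm i

lemma mm_eq : mm X = IX Finset.univ := by
  apply le_antisymm
  · intro s hs
    rw [mem_IX]
    intro m hm
    by_contra hcon
    push Not at hcon
    have : m = 0 := by ext i; simpa using hcon i (Finset.mem_univ i)
    subst this
    exact hm hs
  · exact IX_le _

lemma IX_insert (T : Finset X) (i : X) : IX T ⊔ Ideal.span {MvPolynomial.X i} = IX (insert i T) := by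
  rw [IX, IX, ← Ideal.span_union, Finset.coe_insert, Set.image_insert_eq, Set.union_singleton]

lemma IX_empty : IX (∅ : Finset X) = ⊥ := by simp [IX]

lemma NZD_IX {T : Finset X} {i : X} (hi : i ∉ T) : NZD (IX T) (MvPolynomial.X i) := by
  intro s hs
  rw [mem_IX] at *
  intro m hm
  obtain ⟨k, hk, h⟩ := hs (Finsupp.single i 1 + m) (by rwa [MvPolynomial.coeff_X_mul])
  refine ⟨k, hk, ?_⟩
  have : k ≠ i := fun e => hi (e ▸ hk)
  simpa [Finsupp.single_apply, this.symm] using h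

lemma Dp_IX (r : ℕ) : ∀ T : Finset X, Tᶜ.card = r → Dp (mm X) r (IX T) := by
  induction r with
  | zero => intro T _; trivial
  | succ r ih =>
    intro T hT
    have : Tᶜ.Nonempty := by rw [← Finset.card_pos]; omega
    obtain ⟨i, hi⟩ := this
    have hi' : i ∉ T := Finset.mem_compl.1 hi
    refine ⟨_, X_mem_mm i, NZD_IX hi', ?_⟩
    rw [IX_insert]
    apply ih
    rw [Finset.compl_insert, Finset.card_erase_of_mem hi]; omega

end vars

namespace FA

variable {X Y A : Type} [Fintype X] [DecidableEq X] [Fintype Y] [DecidableEq Y]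
    [Ring A] [Algebra ℚ A] (F : FA X Y A)

lemma ps_eq_co (x : A) : F.ps x = F.co ∅ x := by
  refine F.ext_B (f := F.ps.toLinearMap) (g := F.co ∅) ?_ x
  intro b
  rw [AlgHom.toLinearMap_apply, ps_B, co_B]

lemma f_coeff {j : Y} {m : X →₀ ℕ} (h : MvPolynomial.coeff m (F.f j) ≠ 0) :
    ∑ i, m i * F.a i = F.c j + 1 ∧ 2 ≤ ∑ i, m i := by
  rw [f, ps_eq_co, co_coeff, ds_B] at h
  have h1 := F.pr_mem_of_mem {b' : Idx X Y | b'.2.card + 1 = ({j} : Finset Y).card} (F.d_wt (0, {j}))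
  have h2 := F.pr_mem_of_mem {b' : Idx X Y | b'.2.card + 1 = ({j} : Finset Y).card} (F.minY j)
  have h1 := F.mem_sp.1 h1 _ h
  have h2 := F.mem_sp.1 h2 _ h
  simp at h1 h2
  exact ⟨h1, h2⟩

lemma f_mem_mm (j : Y) : F.f j ∈ mm X := by
  rw [mem_mm]
  by_contra h
  have := (F.f_coeff h).2
  simp at this

/-- weight filtration on polynomials -/
def Sle (m : ℕ) : Submodule ℚ (MvPolynomial X ℚ) where
  carrier := {s | ∀ e, MvPolynomial.coeff e s ≠ 0 → ∑ i, e i * F.a i ≤ m}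
  add_mem' {s t} hs ht e he := by
    by_cases h : MvPolynomial.coeff e s = 0
    · refine ht e ?_
      intro h2; apply he; rw [MvPolynomial.coeff_add, h, h2, add_zero]
    · exact hs e h
  zero_mem' e he := by simp at he
  smul_mem' q s hs e he := hs e (by
    intro h; apply he; rw [MvPolynomial.coeff_smul, h, smul_zero])

lemma mem_Sle {m : ℕ} {s : MvPolynomial X ℚ} :
    s ∈ F.Sle m ↔ ∀ e, MvPolynomial.coeff e s ≠ 0 → ∑ i, e i * F.a i ≤ m := Iff.rfl

lemma f_Sle (j : Y) : F.f j ∈ F.Sle (F.c j + 1) := fun _ he => le_of_eq (F.f_coeff he).1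

lemma good_HB {T : Finset Y} {l k : ℕ} (L : List Y) : ∀ (I I' : Ideal (MvPolynomial X ℚ)), L.Nodup →
    (∀ j ∈ L, j ∉ T) → Good F.f T L I I' → HB (F.Zs I' T l) (F.Es I' T) k →
    HB (F.Zs I (L.toFinset ∪ T) l) (F.Es I (L.toFinset ∪ T)) k := by
  induction L with
  | nil =>
    intro I I' _ _ hG H
    have : I = I' := hG
    subst this
    simpa using H
  | cons j L ih =>
    rintro I I' hL hT ⟨c, hn, hG⟩ H
    rw [List.nodup_cons] at hL
    have h1 := ih _ _ hL.2 (fun i hi => hT i (by simp [hi])) hG H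
    have hj : j ∉ L.toFinset ∪ T := by
      simp [hL.1, hT j (by simp)]
    rw [List.toFinset_cons, Finset.insert_union]
    refine F.stepA hj (w := ∑ i ∈ L.toFinset ∪ T, c i • F.B (0, {i})) ?_ ?_ ?_ hn h1
    · refine Submodule.sum_mem _ fun i hi => Submodule.smul_mem _ _ (F.B_mem_sp ⟨?_, ?_⟩)
      · simpa using hi
      · simp
    · rw [map_sum, ← Finset.sum_neg_distrib]
      refine Finset.sum_congr rfl fun i _ => ?_
      rw [map_smul, τ_y, smul_neg]
    · rw [map_sum, map_sum]
      refine Finset.sum_congr rfl fun i _ => ?_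
      rw [map_smul, map_smul, ds_y]

lemma mm_le_radical {n : ℕ} (hV : F.Van n) : mm X ≤ (Ideal.span (Set.range F.f)).radical := by
  rw [mm_eq, IX, Ideal.span_le]
  rintro _ ⟨i, -, rfl⟩
  exact F.X_mem_radical hV i

/-- the Friedlander–Halperin condition -/
theorem FH {n : ℕ} (hV : F.Van n) (α : ℕ) :
    (Finset.univ.filter fun i => α ≤ F.a i).card ≤ (Finset.univ.filter fun j => 2 * α ≤ F.c j + 1).card := by
  set T := Finset.univ.filter fun i => ¬ (α ≤ F.a i) with hT
  have hTc : Tᶜ = Finset.univ.filter fun i => α ≤ F.a i := by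
    ext i; simp [hT]
  set L := (Finset.univ.filter fun j => 2 * α ≤ F.c j + 1) with hL
  obtain ⟨L1, L2, h, hl, -⟩ := good_exists (m := mm X) F.f Tᶜ.card L.toList (IX T) (Finset.nodup_toList _)
    (fun j _ => F.f_mem_mm j) (IX_le T) (Dp_IX _ T rfl) (by
      refine (F.mm_le_radical hV).trans (Ideal.radical_mono (Ideal.span_le.2 ?_))
      rintro _ ⟨j, rfl⟩
      by_cases hj : j ∈ L
      · exact Ideal.mem_sup_right (Ideal.subset_span ⟨j, by simpa using hj, rfl⟩)
      · refine Ideal.mem_sup_left ?_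
        rw [mem_IX]
        intro m hm
        by_contra hcon
        push Not at hcon
        apply hj
        obtain ⟨h1, h2⟩ := F.f_coeff hm
        rw [hL, Finset.mem_filter]
        refine ⟨Finset.mem_univ _, ?_⟩
        rw [← h1]
        calc 2 * α ≤ (∑ i, m i) * α := Nat.mul_le_mul_right _ h2
          _ = ∑ i, m i * α := by rw [Finset.sum_mul]
          _ ≤ ∑ i, m i * F.a i := by
            refine Finset.sum_le_sum fun i _ => ?_
            by_cases hi : i ∈ T
            · rw [hcon i hi]; simp
            · have : α ≤ F.a i := by simpa [hT] using hi
              exact Nat.mul_le_mul_left _ this)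
  rw [← hTc, ← hl, ← Finset.length_toList L, h, List.length_append]
  omega

end FA

section num

lemma pow_up (k : ℕ) {u a : ℝ} (hu : 0 ≤ u) (ha : 0 ≤ a) :
    u ^ (k + 1) + (k + 1) * a * u ^ k ≤ (u + a) ^ (k + 1) := by
  induction k with
  | zero => simp
  | succ k ih =>
    have h1 : (u + a) * (u ^ (k + 1) + (k + 1) * a * u ^ k) ≤ (u + a) * (u + a) ^ (k + 1) :=
      mul_le_mul_of_nonneg_left ih (by positivity)
    have h2 : 0 ≤ (k + 1) * a * u ^ k * a := by positivity
    rw [pow_succ' (u + a) (k + 1)]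
    push_cast
    refine le_trans ?_ h1
    have h3 : u ^ (k + 1 + 1) = u * u ^ (k + 1) := pow_succ' _ _
    have h4 : u ^ (k + 1) = u * u ^ k := pow_succ' _ _
    rw [h3, h4]
    nlinarith

lemma pow_lo (k : ℕ) {v b : ℝ} (hv : 0 ≤ v) (hb : 0 ≤ b) :
    (v + b) ^ (k + 1) ≤ v ^ (k + 1) + (k + 1) * b * (v + b) ^ k := by
  induction k with
  | zero => simp
  | succ k ih =>
    have h1 : (v + b) * (v + b) ^ (k + 1) ≤ (v + b) * (v ^ (k + 1) + (k + 1) * b * (v + b) ^ k) :=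
      mul_le_mul_of_nonneg_left ih (by positivity)
    have h2 : v ^ (k + 1) ≤ (v + b) ^ (k + 1) := pow_le_pow_left₀ hv (by linarith) _
    have h3 := mul_le_mul_of_nonneg_left h2 hb
    rw [pow_succ' (v + b) (k + 1), pow_succ' v (k + 1)]
    push_cast
    refine le_trans h1 ?_
    have h4 : (v + b) ^ (k + 1) = (v + b) * (v + b) ^ k := pow_succ' _ _
    rw [h4] at h3 ⊢
    nlinarith

lemma num_upper {h h' : ℕ → ℝ} {a : ℕ} (ha : 0 < a) {D K : ℝ} (hD : 0 ≤ D) (hK : 0 ≤ K) (k : ℕ)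
    (h1 : ∀ m, m < a → h m ≤ h' m) (h2 : ∀ m, h (m + a) ≤ h' (m + a) + h m)
    (h3 : ∀ m : ℕ, h' m ≤ D * (m + K) ^ k) (m : ℕ) :
    h m ≤ D / ((k + 1) * a) * (m + (K + a)) ^ (k + 1) := by
  have ha' : (0 : ℝ) < a := by exact_mod_cast ha
  have key : ∀ m : ℕ, D * (m + K) ^ k + D / ((k + 1) * a) * (m + K) ^ (k + 1) ≤
      D / ((k + 1) * a) * (m + (K + a)) ^ (k + 1) := by
    intro m
    have := pow_up k (u := m + K) (a := a) (by positivity) ha'.le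
    have h5 := mul_le_mul_of_nonneg_left this (show 0 ≤ D / ((k + 1) * a) by positivity)
    rw [← add_assoc]
    refine le_trans (le_of_eq ?_) h5
    field_simp
    ring
  induction m using Nat.strong_induction_on with
  | _ m ih =>
    by_cases hm : m < a
    · refine (h1 m hm).trans ((h3 m).trans (le_trans ?_ (key m)))
      have : 0 ≤ D / ((k + 1) * a) * (m + K) ^ (k + 1) := by positivity
      linarith
    · obtain ⟨t, rfl⟩ : ∃ t, m = t + a := ⟨m - a, by omega⟩
      refine (h2 t).trans (le_trans ?_ (key (t + a)))
      have := ih t (by omega)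
      have h4 := h3 (t + a)
      have e : ((t : ℝ) + (K + a)) = ((t + a : ℕ) : ℝ) + K := by push_cast; ring
      rw [e] at this
      linarith

lemma num_lower {h h' : ℕ → ℝ} {b : ℕ} (hb : 0 < b) {C : ℝ} (hC : 0 ≤ C) (M k : ℕ)
    (h1 : ∀ m, h' m ≤ h m) (h2 : ∀ m, h' (m + b) + h m ≤ h (m + b))
    (h3 : ∀ t : ℕ, C * (t : ℝ) ^ k ≤ h' (M + t)) (t : ℕ) :
    C / ((k + 1) * b) * (t : ℝ) ^ (k + 1) ≤ h (M + t) := by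
  have hb' : (0 : ℝ) < b := by exact_mod_cast hb
  induction t using Nat.strong_induction_on with
  | _ t ih =>
    by_cases hm : t < b
    · refine le_trans ?_ ((h3 t).trans (h1 _))
      have h4 : (t : ℝ) ≤ b := by exact_mod_cast hm.le
      have h5 : (t : ℝ) ≤ (k + 1) * b := by nlinarith [(Nat.cast_nonneg k : (0 : ℝ) ≤ k)]
      rw [pow_succ, div_mul_eq_mul_div, div_le_iff₀ (by positivity)]
      have h6 : 0 ≤ C * (t : ℝ) ^ k := by positivity
      calc C * ((t : ℝ) ^ k * t) = C * (t : ℝ) ^ k * t := by ring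
        _ ≤ _ := mul_le_mul_of_nonneg_left h5 h6
    · obtain ⟨s, rfl⟩ : ∃ s, t = s + b := ⟨t - b, by omega⟩
      have h4 := ih s (by omega)
      have h5 := h2 (M + s)
      have h6 := h3 (s + b)
      rw [← add_assoc] at h6 ⊢
      refine le_trans ?_ h5
      have := pow_lo k (v := s) (b := b) (by positivity) hb'.le
      have h7 := mul_le_mul_of_nonneg_left this (show 0 ≤ C / ((k + 1) * b) by positivity)
      push_cast at h6 ⊢
      refine h7.trans ?_
      have e : C / ((k + 1) * b) * ((s : ℝ) ^ (k + 1) + (k + 1) * b * (s + b) ^ k) =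
        C / ((k + 1) * b) * (s : ℝ) ^ (k + 1) + C * (s + b) ^ k := by
        field_simp
      rw [e]; linarith

lemma num_limit {C D K : ℝ} (q : ℕ) (h : ∀ t : ℕ, C * (t : ℝ) ^ q ≤ D * (t + K) ^ q) : C ≤ D := by
  have h1 : Filter.Tendsto (fun t : ℕ => D * (1 + K / (t : ℝ)) ^ q) Filter.atTop (nhds (D * (1 + 0) ^ q)) := by
    refine Filter.Tendsto.const_mul _ (Filter.Tendsto.pow (Filter.Tendsto.const_add _ ?_) _)
    exact tendsto_const_div_atTop_nhds_zero_nat K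
  simp only [add_zero, one_pow, mul_one] at h1
  refine ge_of_tendsto h1 ?_
  filter_upwards [Filter.eventually_gt_atTop 0] with t ht
  have ht' : (0 : ℝ) < t := by exact_mod_cast ht
  have := h t
  have e : (1 + K / (t : ℝ)) ^ q = (t + K) ^ q / (t : ℝ) ^ q := by
    rw [← div_pow]; congr 1; field_simp
  rw [e, mul_div_assoc', le_div_iff₀ (by positivity)]
  exact this

end num

namespace FA

variable {X Y A : Type} [Fintype X] [DecidableEq X] [Fintype Y] [DecidableEq Y]
    [Ring A] [Algebra ℚ A] (F : FA X Y A)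

lemma finrank_map_inj {M N : Type} [AddCommGroup M] [Module ℚ M] [AddCommGroup N] [Module ℚ N] {f : M →ₗ[ℚ] N}
    (hf : Function.Injective f) (p : Submodule ℚ M) : Module.finrank ℚ (p.map f) = Module.finrank ℚ p :=
  (LinearEquiv.finrank_eq (Submodule.equivMapOfInjective f hf p)).symm

instance Sle_fd (m : ℕ) : FiniteDimensional ℚ (F.Sle m) := by
  have hfin : ({e : X →₀ ℕ | e ≤ Finsupp.equivFunOnFinite.symm (fun _ => m)}).Finite := Set.finite_Iic _
  have hsub : F.Sle m ≤ Submodule.span ℚ ((fun e => MvPolynomial.monomial e (1 : ℚ)) ''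
      {e : X →₀ ℕ | e ≤ Finsupp.equivFunOnFinite.symm (fun _ => m)}) := by
    intro s hs
    rw [← MvPolynomial.support_sum_monomial_coeff s]
    refine Submodule.sum_mem _ fun e he => ?_
    have he' := hs e (MvPolynomial.mem_support_iff.1 he)
    have : MvPolynomial.monomial e (MvPolynomial.coeff e s) =
      MvPolynomial.coeff e s • MvPolynomial.monomial e (1 : ℚ) := by
      rw [MvPolynomial.smul_monomial, smul_eq_mul, mul_one]
    rw [this]
    refine Submodule.smul_mem _ _ (Submodule.subset_span ⟨e, ?_, rfl⟩)
    intro i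
    have h2 := F.a_pos i
    have h3 : e i * F.a i ≤ ∑ i, e i * F.a i :=
      Finset.single_le_sum (f := fun i => e i * F.a i) (fun _ _ => Nat.zero_le _) (Finset.mem_univ i)
    simp
    nlinarith
  haveI := FiniteDimensional.span_of_finite ℚ (hfin.image (fun e => MvPolynomial.monomial e (1 : ℚ)))
  exact Submodule.finiteDimensional_of_le hsub

/-- the image of `Sle m` in the quotient -/
noncomputable def Pm (I : Ideal (MvPolynomial X ℚ)) (m : ℕ) :
    Submodule ℚ (MvPolynomial X ℚ ⧸ I.restrictScalars ℚ) :=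
  (F.Sle m).map (I.restrictScalars ℚ).mkQ

instance Pm_fd (I : Ideal (MvPolynomial X ℚ)) (m : ℕ) : FiniteDimensional ℚ (F.Pm I m) := by
  unfold Pm; infer_instance

noncomputable def hh (I : Ideal (MvPolynomial X ℚ)) (m : ℕ) : ℕ := Module.finrank ℚ (F.Pm I m)

lemma Sle_mono {m m' : ℕ} (h : m ≤ m') : F.Sle m ≤ F.Sle m' := fun _ hs e he => (hs e he).trans h

lemma Sle_mul {m m' : ℕ} {s t} (hs : s ∈ F.Sle m) (ht : t ∈ F.Sle m') : s * t ∈ F.Sle (m + m') := by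
  intro e he
  rw [MvPolynomial.coeff_mul] at he
  obtain ⟨p, hp, hp'⟩ := Finset.exists_ne_zero_of_sum_ne_zero he
  rw [Finset.HasAntidiagonal.mem_antidiagonal] at hp
  have h1 := hs p.1 (left_ne_zero_of_mul hp')
  have h2 := ht p.2 (right_ne_zero_of_mul hp')
  rw [← hp]
  simp only [Finsupp.add_apply, add_mul, Finset.sum_add_distrib]
  omega

lemma Pm_mono (I : Ideal (MvPolynomial X ℚ)) {m m' : ℕ} (h : m ≤ m') : F.Pm I m ≤ F.Pm I m' :=
  Submodule.map_mono (F.Sle_mono h)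

lemma hh_mono (I : Ideal (MvPolynomial X ℚ)) {m m' : ℕ} (h : m ≤ m') : F.hh I m ≤ F.hh I m' :=
  Submodule.finrank_mono (F.Pm_mono I h)

/-- restriction of the projection between quotients -/
lemma factor_ex {I J : Ideal (MvPolynomial X ℚ)} (h : I ≤ J) (m : ℕ) :
    ∃ ψ : F.Pm I m →ₗ[ℚ] (MvPolynomial X ℚ ⧸ J.restrictScalars ℚ), LinearMap.range ψ = F.Pm J m ∧
      ∀ s (hs : s ∈ F.Sle m), ψ ⟨(I.restrictScalars ℚ).mkQ s, Submodule.mem_map_of_mem hs⟩ = (J.restrictScalars ℚ).mkQ s := by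
  have h' : I.restrictScalars ℚ ≤ J.restrictScalars ℚ := h
  refine ⟨(Submodule.factor h').domRestrict (F.Pm I m), ?_, ?_⟩
  · ext x
    constructor
    · rintro ⟨⟨_, s, hs, rfl⟩, rfl⟩
      exact ⟨s, hs, rfl⟩
    · rintro ⟨s, hs, rfl⟩
      exact ⟨⟨_, s, hs, rfl⟩, rfl⟩
  · intro s hs; rfl

lemma hh_anti {I J : Ideal (MvPolynomial X ℚ)} (h : I ≤ J) (m : ℕ) : F.hh J m ≤ F.hh I m := by
  obtain ⟨ψ, h1, -⟩ := F.factor_ex h m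
  rw [hh, ← h1]
  exact LinearMap.finrank_range_le ψ

lemma hh_nzd {I : Ideal (MvPolynomial X ℚ)} {g : MvPolynomial X ℚ} (hg : NZD I g) {b : ℕ} (hb : g ∈ F.Sle b) (m : ℕ) :
    F.hh (I ⊔ Ideal.span {g}) (m + b) + F.hh I m ≤ F.hh I (m + b) := by
  obtain ⟨ψ, h1, h2⟩ := F.factor_ex (J := I ⊔ Ideal.span {g}) (le_sup_left : I ≤ _) (m + b)
  have h3 := LinearMap.finrank_range_add_finrank_ker ψ
  rw [h1] at h3
  change F.hh _ _ + _ = F.hh _ _ at h3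
  rw [← h3]
  refine Nat.add_le_add_left ?_ _
  -- multiplication by g
  have hle : I.restrictScalars ℚ ≤ (I.restrictScalars ℚ).comap (LinearMap.mulLeft ℚ g) := fun s hs =>
    I.mul_mem_left g hs
  let μ := Submodule.mapQ (I.restrictScalars ℚ) (I.restrictScalars ℚ) (LinearMap.mulLeft ℚ g) hle
  have hμ : Function.Injective μ := by
    rw [injective_iff_map_eq_zero]
    intro x hx
    obtain ⟨s, rfl⟩ := Submodule.mkQ_surjective _ x
    rw [Submodule.mkQ_apply, Submodule.mapQ_apply, Submodule.Quotient.mk_eq_zero] at hx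
    rw [Submodule.mkQ_apply, Submodule.Quotient.mk_eq_zero]
    exact hg s hx
  have e1 : F.hh I m = Module.finrank ℚ ((F.Pm I m).map μ) :=
    (finrank_map_inj hμ _).symm
  have e2 : Module.finrank ℚ (LinearMap.ker ψ) = Module.finrank ℚ ((LinearMap.ker ψ).map (F.Pm I (m+b)).subtype) :=
    (finrank_map_inj (Submodule.injective_subtype _) _).symm
  rw [e1, e2]
  apply Submodule.finrank_mono
  rintro _ ⟨_, ⟨s, hs, rfl⟩, rfl⟩
  have hs2 : g * s ∈ F.Sle (m + b) := by rw [add_comm]; exact F.Sle_mul hb hs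
  refine ⟨⟨(I.restrictScalars ℚ).mkQ (g * s), Submodule.mem_map_of_mem hs2⟩, ?_, rfl⟩
  refine LinearMap.mem_ker.2 ?_
  rw [h2 _ hs2, Submodule.mkQ_apply, Submodule.Quotient.mk_eq_zero]
  exact Ideal.mem_sup_right (Ideal.mul_mem_right _ _ (Ideal.mem_span_singleton_self g))

lemma IX_div {T : Finset X} {i : X} {s : MvPolynomial X ℚ} (hs : s ∈ IX (insert i T)) :
    ∃ u, s - MvPolynomial.X i * u ∈ IX T ∧ ∀ e, MvPolynomial.coeff e u = MvPolynomial.coeff (Finsupp.single i 1 + e) s := by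
  refine ⟨MvPolynomial.divMonomial s (Finsupp.single i 1), ?_, fun e => MvPolynomial.coeff_divMonomial _ _ _⟩
  rw [mem_IX] at *
  intro e he
  have hm : s - MvPolynomial.X i * MvPolynomial.divMonomial s (Finsupp.single i 1) =
      MvPolynomial.modMonomial s (Finsupp.single i 1) := by
    have := MvPolynomial.divMonomial_add_modMonomial_single s i
    rw [sub_eq_iff_eq_add', this]
  rw [hm] at he
  by_cases hle : Finsupp.single i 1 ≤ e
  · rw [MvPolynomial.coeff_modMonomial_of_le _ hle] at he; exact absurd rfl he
  · rw [MvPolynomial.coeff_modMonomial_of_not_le _ hle] at he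
    obtain ⟨k, hk, h⟩ := hs e he
    rw [Finset.mem_insert] at hk
    rcases hk with rfl | hk
    · exfalso; apply hle
      rw [Finsupp.single_le_iff]; omega
    · exact ⟨k, hk, h⟩

lemma sum_single_add (i : X) (e : X →₀ ℕ) : ∑ k, ((Finsupp.single i 1 + e : X →₀ ℕ)) k * F.a k = F.a i + ∑ k, e k * F.a k := by
  simp [Finsupp.single_apply, add_mul, Finset.sum_add_distrib]

lemma hh_X (T : Finset X) (i : X) (m : ℕ) :
    F.hh (IX T) (m + F.a i) ≤ F.hh (IX (insert i T)) (m + F.a i) + F.hh (IX T) m := by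
  have hle0 : IX T ≤ IX (insert i T) := by rw [← IX_insert]; exact le_sup_left
  obtain ⟨ψ, h1, h2⟩ := F.factor_ex hle0 (m + F.a i)
  have h3 := LinearMap.finrank_range_add_finrank_ker ψ
  rw [h1] at h3
  change F.hh _ _ + _ = F.hh _ _ at h3
  rw [← h3]
  refine Nat.add_le_add_left ?_ _
  have hle : (IX T).restrictScalars ℚ ≤ ((IX T).restrictScalars ℚ).comap (LinearMap.mulLeft ℚ (MvPolynomial.X i)) := fun s hs =>
    (IX T).mul_mem_left (MvPolynomial.X i) hs
  let μ := Submodule.mapQ ((IX T).restrictScalars ℚ) ((IX T).restrictScalars ℚ) (LinearMap.mulLeft ℚ (MvPolynomial.X i)) hle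
  have e2 : Module.finrank ℚ (LinearMap.ker ψ) = Module.finrank ℚ ((LinearMap.ker ψ).map (F.Pm (IX T) (m+F.a i)).subtype) :=
    (finrank_map_inj (Submodule.injective_subtype _) _).symm
  rw [e2]
  refine le_trans (Submodule.finrank_mono (t := (F.Pm (IX T) m).map μ) ?_) (Submodule.finrank_map_le μ _)
  rintro _ ⟨⟨_, s, hs, rfl⟩, hk, rfl⟩
  have hk := LinearMap.mem_ker.1 hk
  rw [h2 s hs, Submodule.mkQ_apply, Submodule.Quotient.mk_eq_zero] at hk
  obtain ⟨u, hu1, hu2⟩ := IX_div (T := T) (i := i) hk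
  refine ⟨_, ⟨u, ?_, rfl⟩, ?_⟩
  · intro e he
    rw [hu2] at he
    have := hs _ he
    rw [F.sum_single_add] at this
    omega
  · rw [Submodule.mkQ_apply, Submodule.mapQ_apply]
    symm
    exact (Submodule.Quotient.eq _).2 hu1

lemma hh_X_lt (T : Finset X) (i : X) {m : ℕ} (hm : m < F.a i) : F.hh (IX T) m ≤ F.hh (IX (insert i T)) m := by
  have hle0 : IX T ≤ IX (insert i T) := by rw [← IX_insert]; exact le_sup_left
  obtain ⟨ψ, h1, h2⟩ := F.factor_ex hle0 m
  rw [hh, hh, ← h1]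
  refine le_of_eq (LinearMap.finrank_range_of_inj ?_).symm
  rw [injective_iff_map_eq_zero]
  rintro ⟨_, s, hs, rfl⟩ hk
  rw [h2 s hs, Submodule.mkQ_apply, Submodule.Quotient.mk_eq_zero] at hk
  obtain ⟨u, hu1, hu2⟩ := IX_div (T := T) (i := i) hk
  have : u = 0 := by
    ext e
    rw [hu2, MvPolynomial.coeff_zero]
    by_contra he
    have := hs _ he
    rw [F.sum_single_add] at this
    omega
  rw [this, mul_zero, sub_zero] at hu1
  apply Subtype.ext
  change (Submodule.mkQ _ s) = 0
  rw [Submodule.mkQ_apply, Submodule.Quotient.mk_eq_zero]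
  exact hu1

lemma hh_mm (m : ℕ) : F.hh (mm X) m ≤ 1 := by
  rw [hh]
  refine finrank_le_one (⟨Submodule.mkQ _ 1, Submodule.mem_map_of_mem ?_⟩) ?_
  · intro e he
    rw [MvPolynomial.coeff_one] at he
    split_ifs at he with h
    · subst h; simp
    · exact absurd rfl he
  · rintro ⟨_, s, hs, rfl⟩
    refine ⟨MvPolynomial.coeff 0 s, Subtype.ext ?_⟩
    change MvPolynomial.coeff 0 s • Submodule.mkQ _ 1 = Submodule.mkQ _ s
    rw [← map_smul]
    refine (Submodule.Quotient.eq _).2 ?_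
    rw [Submodule.restrictScalars_mem, mem_mm]
    simp

lemma hh_upper (r : ℕ) : ∀ T : Finset X, Tᶜ.card = r → ∃ K : ℝ, 0 ≤ K ∧
    ∀ m, (F.hh (IX T) m : ℝ) ≤ 1 / (r.factorial * ∏ i ∈ Tᶜ, (F.a i : ℝ)) * (m + K) ^ r := by
  induction r with
  | zero =>
    intro T hT
    have hT' : T = Finset.univ := by simpa using hT
    refine ⟨0, le_rfl, fun m => ?_⟩
    rw [hT', ← mm_eq]
    simpa using F.hh_mm m
  | succ r ih =>
    intro T hT
    have : Tᶜ.Nonempty := by rw [← Finset.card_pos]; omega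
    obtain ⟨i, hi⟩ := this
    have hi' : i ∉ T := Finset.mem_compl.1 hi
    obtain ⟨K, hK, h⟩ := ih (insert i T) (by
      rw [Finset.compl_insert, Finset.card_erase_of_mem hi]; omega)
    refine ⟨K + F.a i, by positivity, fun m => ?_⟩
    have hp : 0 < F.a i := by have := F.a_pos i; omega
    have := num_upper (h := fun m => F.hh (IX T) m) (h' := fun m => F.hh (IX (insert i T)) m) (a := F.a i) hp
      (D := 1 / (r.factorial * ∏ i ∈ (insert i T)ᶜ, (F.a i : ℝ))) (by positivity) hK r
      (fun m hm => by exact_mod_cast F.hh_X_lt T i hm) (fun m => by exact_mod_cast F.hh_X T i m) h m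
    refine this.trans (le_of_eq ?_)
    congr 1
    rw [Finset.compl_insert, ← Finset.mul_prod_erase _ _ hi, Nat.factorial_succ]
    push_cast
    rw [div_div]
    congr 1
    ring

lemma hh_lower {T : Finset Y} (M : ℕ) (L : List Y) : ∀ (I I' : Ideal (MvPolynomial X ℚ)),
    L.Pairwise (fun j i => F.c i ≤ F.c j) → (∀ j ∈ L, ∀ i ∈ T, F.c i ≤ F.c j) →
    Good F.f T L I I' → ∀ t : ℕ,
    (F.hh I' M : ℝ) / (L.length.factorial * (L.map fun j => ((F.c j + 1 : ℕ) : ℝ)).prod) * (t : ℝ) ^ L.length ≤ F.hh I (M + t) := by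
  induction L with
  | nil =>
    intro I I' _ _ hG t
    have : I = I' := hG
    subst this
    simp
    exact F.hh_mono _ (Nat.le_add_right _ _)
  | cons j L ih =>
    rintro I I' hL hT ⟨c, hn, hG⟩ t
    rw [List.pairwise_cons] at hL
    have h1 := ih _ _ hL.2 (fun i hi => hT i (by simp [hi])) hG
    have hg : (F.f j + ∑ i ∈ L.toFinset ∪ T, c i • F.f i) ∈ F.Sle (F.c j + 1) := by
      refine Submodule.add_mem _ (F.f_Sle j) (Submodule.sum_mem _ fun i hi => Submodule.smul_mem _ _ ?_)
      refine F.Sle_mono ?_ (F.f_Sle i)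
      rw [Finset.mem_union, List.mem_toFinset] at hi
      rcases hi with hi | hi
      · exact Nat.succ_le_succ (hL.1 i hi)
      · exact Nat.succ_le_succ (hT j (by simp) i hi)
    have hp : (0 : ℝ) ≤ (L.map fun j => ((F.c j + 1 : ℕ) : ℝ)).prod := by
      refine List.prod_nonneg ?_
      simp only [List.mem_map]
      rintro _ ⟨j, -, rfl⟩
      positivity
    have := num_lower (h := fun m => F.hh I m)
      (h' := fun m => F.hh (I ⊔ Ideal.span {F.f j + ∑ i ∈ L.toFinset ∪ T, c i • F.f i}) m) (b := F.c j + 1) (Nat.succ_pos _)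
      (C := (F.hh I' M : ℝ) / (L.length.factorial * (L.map fun j => ((F.c j + 1 : ℕ) : ℝ)).prod))
      (by positivity) M L.length 
      (fun m => by exact_mod_cast F.hh_anti (J := I ⊔ Ideal.span {F.f j + ∑ i ∈ L.toFinset ∪ T, c i • F.f i}) le_sup_left m)
      (fun m => by exact_mod_cast F.hh_nzd hn hg m) h1 t
    refine le_trans (le_of_eq ?_) this
    simp only [List.length_cons, List.map_cons, List.prod_cons]
    congr 1
    rw [div_div, Nat.factorial_succ]
    push_cast
    congr 1
    ring

lemma hh_bound {T : Finset Y} (L : List Y) (I' : Ideal (MvPolynomial X ℚ))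
    (h1 : L.Pairwise (fun j i => F.c i ≤ F.c j)) (h2 : ∀ j ∈ L, ∀ i ∈ T, F.c i ≤ F.c j)
    (hG : Good F.f T L ⊥ I') (hl : L.length = Fintype.card X) (M : ℕ) :
    (F.hh I' M : ℝ) * ∏ i, (F.a i : ℝ) ≤ (L.map fun j => ((F.c j + 1 : ℕ) : ℝ)).prod := by
  obtain ⟨K, hK, hu⟩ := F.hh_upper (Fintype.card X) ∅ (by simp)
  have hlo := F.hh_lower M L ⊥ I' h1 h2 hG
  rw [IX_empty] at hu
  have := num_limit (C := (F.hh I' M : ℝ) / (L.length.factorial * (L.map fun j => ((F.c j + 1 : ℕ) : ℝ)).prod))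
    (D := 1 / ((Fintype.card X).factorial * ∏ i ∈ (∅ : Finset X)ᶜ, (F.a i : ℝ))) (K := M + K) (Fintype.card X) (fun t => by
      have e1 := hlo t
      have e2 := hu (M + t)
      rw [hl] at e1
      rw [hl]
      refine e1.trans (e2.trans (le_of_eq ?_))
      push_cast
      congr 2
      ring)
  have hp : (0 : ℝ) < (L.map fun j => ((F.c j + 1 : ℕ) : ℝ)).prod := by
    refine List.prod_pos ?_
    simp only [List.mem_map]
    rintro _ ⟨j, -, rfl⟩
    positivity
  have ha : (0 : ℝ) < ∏ i, (F.a i : ℝ) := Finset.prod_pos fun i _ => by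
    have := F.a_pos i
    exact_mod_cast (by omega : 0 < F.a i)
  rw [hl, Finset.compl_empty, div_le_div_iff₀ (by positivity) (by positivity)] at this
  have hf : (0 : ℝ) < (Fintype.card X).factorial := by exact_mod_cast Nat.factorial_pos _
  have h5 : ((Fintype.card X).factorial : ℝ) * ((F.hh I' M : ℝ) * ∏ i, (F.a i : ℝ)) ≤
    (Fintype.card X).factorial * (L.map fun j => ((F.c j + 1 : ℕ) : ℝ)).prod := by linarith
  exact le_of_mul_le_mul_left h5 hf

lemma Sle_ex (s : MvPolynomial X ℚ) : ∃ m, s ∈ F.Sle m := by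
  refine ⟨s.support.sup fun e => ∑ i, e i * F.a i, fun e he => ?_⟩
  exact Finset.le_sup (f := fun e : X →₀ ℕ => ∑ i, e i * F.a i) (MvPolynomial.mem_support_iff.2 he)

/-- finite colength with the Bezout bound -/
theorem colength {T : Finset Y} (L : List Y) (I' : Ideal (MvPolynomial X ℚ))
    (h1 : L.Pairwise (fun j i => F.c i ≤ F.c j)) (h2 : ∀ j ∈ L, ∀ i ∈ T, F.c i ≤ F.c j)
    (hG : Good F.f T L ⊥ I') (hl : L.length = Fintype.card X) :
    ∃ D : ℕ, (D : ℝ) * ∏ i, (F.a i : ℝ) ≤ (L.map fun j => ((F.c j + 1 : ℕ) : ℝ)).prod ∧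
      HB ⊤ (I'.restrictScalars ℚ) D := by
  have hb := F.hh_bound L I' h1 h2 hG hl
  have ha : (1 : ℝ) ≤ ∏ i, (F.a i : ℝ) := by
    have : 1 ≤ ∏ i, F.a i := Finset.one_le_prod' fun i _ => by have := F.a_pos i; omega
    exact_mod_cast this
  obtain ⟨M0, hM0⟩ : ∃ M0, ∀ M, F.hh I' M ≤ F.hh I' M0 := by
    have hbd : ∀ M, F.hh I' M ≤ ⌊(L.map fun j => ((F.c j + 1 : ℕ) : ℝ)).prod⌋₊ := fun M =>
      Nat.le_floor (le_trans (le_mul_of_one_le_right (Nat.cast_nonneg _) ha) (hb M))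
    have hne : (Set.range fun M => F.hh I' M).Nonempty := ⟨_, 0, rfl⟩
    have hbdd : BddAbove (Set.range fun M => F.hh I' M) := ⟨_, by rintro _ ⟨M, rfl⟩; exact hbd M⟩
    obtain ⟨M0, h⟩ := Nat.sSup_mem hne hbdd
    refine ⟨M0, fun M => ?_⟩
    have h : F.hh I' M0 = sSup (Set.range fun M => F.hh I' M) := h
    rw [h]
    exact le_csSup hbdd ⟨M, rfl⟩
  refine ⟨F.hh I' M0, hb M0, ?_⟩
  obtain ⟨σ, hσ⟩ := (I'.restrictScalars ℚ).mkQ.exists_rightInverse_of_surjective (Submodule.range_mkQ _)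
  refine ⟨(F.Pm I' M0).map σ, inferInstance, Submodule.finrank_map_le _ _, ?_⟩
  intro s _
  have hs : (I'.restrictScalars ℚ).mkQ s ∈ F.Pm I' M0 := by
    obtain ⟨m, hm⟩ := F.Sle_ex s
    have e : F.Pm I' M0 = F.Pm I' (max m M0) :=
      Submodule.eq_of_le_of_finrank_le (F.Pm_mono _ (le_max_right _ _)) (hM0 _)
    rw [e]
    exact Submodule.mem_map_of_mem (F.Sle_mono (le_max_left _ _) hm)
  rw [Submodule.mem_sup]
  refine ⟨σ ((I'.restrictScalars ℚ).mkQ s), Submodule.mem_map_of_mem hs, s - σ ((I'.restrictScalars ℚ).mkQ s), ?_, by abel⟩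
  refine (Submodule.Quotient.mk_eq_zero _).1 ?_
  change (I'.restrictScalars ℚ).mkQ (s - σ ((I'.restrictScalars ℚ).mkQ s)) = 0
  rw [map_sub]
  have := LinearMap.congr_fun hσ ((I'.restrictScalars ℚ).mkQ s)
  simp only [LinearMap.comp_apply, LinearMap.id_apply] at this
  rw [this, sub_self]

end FA

namespace FA

variable {X Y A : Type} [Fintype X] [DecidableEq X] [Fintype Y] [DecidableEq Y]
    [Ring A] [Algebra ℚ A] (F : FA X Y A)

lemma ds_pw_B (m : ℕ) (b : Idx X Y) : F.ds (F.pw m (F.B b)) = F.pw (m+1) (F.ds (F.B b)) := by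
  have h : F.ds (F.B b) ∈ F.Gr (F.wt b + 1) := F.ds_Gr (F.B_mem_sp (s := {b' | F.wt b' = F.wt b}) rfl)
  by_cases hb : F.wt b = m
  · have hB : F.B b ∈ F.Gr m := F.B_mem_sp hb
    rw [hb] at h
    rw [F.pw_self h, F.pw_self hB]
  · have hB : F.B b ∈ F.Gr (F.wt b) := F.B_mem_sp (s := {b' | F.wt b' = F.wt b}) rfl
    rw [F.pw_ne (fun e => hb (by omega)) h, F.pw_ne (fun e => hb e.symm) hB, map_zero]

lemma ds_pw (m : ℕ) (x : A) : F.ds (F.pw m x) = F.pw (m+1) (F.ds x) := by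
  have key : F.ds ∘ₗ F.pw m = F.pw (m+1) ∘ₗ F.ds := F.B.ext (fun b => by
   rw [LinearMap.comp_apply, LinearMap.comp_apply]
   exact F.ds_pw_B m b)
  have := LinearMap.congr_fun key x
  rwa [LinearMap.comp_apply, LinearMap.comp_apply] at this

/-- the ideal of null-homotopic polynomials -/
def KI (T : Finset (X ⊕ Y)) : Ideal (MvPolynomial X ℚ) where
  carrier := {s | ∀ a, F.ds a ∈ F.IT T → ∃ u, F.φ s * a - F.ds u ∈ F.IT T}
  add_mem' {s t} hs ht a ha := by
    obtain ⟨u, hu⟩ := hs a ha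
    obtain ⟨v, hv⟩ := ht a ha
    refine ⟨u + v, ?_⟩
    have : F.φ (s + t) * a - F.ds (u + v) = (F.φ s * a - F.ds u) + (F.φ t * a - F.ds v) := by
      rw [map_add, map_add, add_mul]; abel
    rw [this]; exact Submodule.add_mem _ hu hv
  zero_mem' a _ := ⟨0, by simp⟩
  smul_mem' s t ht a ha := by
    obtain ⟨v, hv⟩ := ht a ha
    refine ⟨F.φ s * v, ?_⟩
    rw [smul_eq_mul, map_mul, ds_φ_mul, mul_assoc, ← mul_sub]
    exact F.IT_mul_right hv

lemma f_mem_KI (T : Finset (X ⊕ Y)) (j : Y) : F.f j ∈ F.KI T := by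
  intro a ha
  refine ⟨F.B (0, {j}) * a, ?_⟩
  rw [ds_y_mul]
  have : F.φ (F.f j) * a - (F.φ (F.f j) * a - F.B (0, {j}) * F.ds a) = F.B (0, {j}) * F.ds a := by abel
  rw [this]
  exact F.IT_mul_right ha

lemma monomial_mem_pow (e : X →₀ ℕ) : MvPolynomial.monomial e (1 : ℚ) ∈ mm X ^ (∑ i, e i) := by
  rw [MvPolynomial.monomial_eq, map_one, one_mul, Finsupp.prod_fintype _ _ (by simp), ← Finset.prod_pow_eq_pow_sum]
  exact Ideal.prod_mem_prod fun i _ => Ideal.pow_mem_pow (X_mem_mm i) _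

lemma KI_split {n : ℕ} (hV : F.Van n) (T : Finset (X ⊕ Y)) :
    ∃ N, ∀ s, ∃ s0 ∈ F.Sle N, s - s0 ∈ F.KI T := by
  have h1 : mm X ≤ (F.KI T).radical := by
    refine (F.mm_le_radical hV).trans (Ideal.radical_mono (Ideal.span_le.2 ?_))
    rintro _ ⟨j, rfl⟩
    exact F.f_mem_KI T j
  obtain ⟨p, hp⟩ := Ideal.exists_radical_pow_le_of_fg (F.KI T) (IsNoetherian.noetherian _)
  have hp' : mm X ^ p ≤ F.KI T := (Ideal.pow_right_mono h1 p).trans hp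
  refine ⟨p * ∑ i, F.a i, fun s => ?_⟩
  induction s using MvPolynomial.induction_on' with
  | monomial e q =>
    by_cases he : ∑ i, e i < p
    · refine ⟨MvPolynomial.monomial e q, ?_, by simp⟩
      intro e' he'
      rw [MvPolynomial.coeff_monomial] at he'
      split_ifs at he' with h
      · subst h
        rw [Finset.mul_sum]
        refine Finset.sum_le_sum fun i _ => Nat.mul_le_mul_right _ ?_
        have : e i ≤ ∑ i, e i := Finset.single_le_sum (f := fun i => e i) (fun _ _ => Nat.zero_le _) (Finset.mem_univ i)
        omega
      · exact absurd rfl he'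
    · refine ⟨0, Submodule.zero_mem _, ?_⟩
      rw [sub_zero]
      apply hp'
      have : MvPolynomial.monomial e q = MvPolynomial.C q * MvPolynomial.monomial e 1 := by
        rw [MvPolynomial.C_mul_monomial, mul_one]
      rw [this]
      exact Ideal.mul_mem_left _ _ (Ideal.pow_le_pow_right (not_lt.1 he) (monomial_mem_pow e))
  | add s t hs ht =>
    obtain ⟨s0, h1, h2⟩ := hs
    obtain ⟨t0, h3, h4⟩ := ht
    refine ⟨s0 + t0, Submodule.add_mem _ h1 h3, ?_⟩
    rw [add_sub_add_comm]
    exact Ideal.add_mem _ h2 h4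

lemma exists_gens (Z : Submodule ℚ A) (hZ : ∀ s, ∀ z ∈ Z, F.φ s * z ∈ Z) :
    ∃ G : Finset A, (∀ g ∈ G, g ∈ Z) ∧ ∀ z ∈ Z, ∃ s : A → MvPolynomial X ℚ, z = ∑ g ∈ G, F.φ (s g) * g := by
  classical
  let _ : Module (MvPolynomial X ℚ) A := Module.compHom A (F.φ : MvPolynomial X ℚ →+* A)
  have hsm : ∀ (s : MvPolynomial X ℚ) (a : A), s • a = F.φ s * a := fun s a => rfl
  have hfin : Module.Finite (MvPolynomial X ℚ) A := by
    refine ⟨⟨Finset.univ.image F.y, ?_⟩⟩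
    rw [eq_top_iff]
    intro x _
    refine F.sp_induction (P := fun x => x ∈ Submodule.span (MvPolynomial X ℚ) (↑(Finset.univ.image F.y) : Set A))
      (Submodule.zero_mem _) (fun _ _ => Submodule.add_mem _) ?_ ?_ (F.mem_univ_sp x)
    · intro q x hx
      have : q • x = (MvPolynomial.C q : MvPolynomial X ℚ) • x := by
        rw [hsm, ← MvPolynomial.algebraMap_eq, AlgHom.commutes, Algebra.smul_def]
      rw [this]; exact Submodule.smul_mem _ _ hx
    · rintro ⟨m, I⟩ _
      rw [F.B_eq, ← hsm]
      exact Submodule.smul_mem _ _ (Submodule.subset_span (by simp))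
  let Z' : Submodule (MvPolynomial X ℚ) A :=
    { carrier := Z
      add_mem' := fun h h' => Z.add_mem h h'
      zero_mem' := Z.zero_mem
      smul_mem' := fun s z hz => hZ s z hz }
  have hN : IsNoetherian (MvPolynomial X ℚ) A := isNoetherian_of_isNoetherianRing_of_finite _ _
  obtain ⟨G, hG⟩ := (IsNoetherian.noetherian Z')
  refine ⟨G, fun g hg => ?_, fun z hz => ?_⟩
  · have : g ∈ Z' := by rw [← hG]; exact Submodule.subset_span hg
    exact this
  · have : z ∈ Submodule.span (MvPolynomial X ℚ) (G : Set A) := by rw [hG]; exact hz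
    obtain ⟨s, -, h⟩ := Submodule.mem_span_finset.1 this
    exact ⟨s, h.symm⟩

lemma φ_wt {N : ℕ} {s : MvPolynomial X ℚ} (hs : s ∈ F.Sle N) : F.φ s ∈ F.sp {b | F.wt b ≤ N} := by
  rw [← MvPolynomial.support_sum_monomial_coeff s, map_sum]
  refine Submodule.sum_mem _ fun e he => ?_
  have : MvPolynomial.monomial e (MvPolynomial.coeff e s) =
      MvPolynomial.coeff e s • MvPolynomial.monomial e (1 : ℚ) := by
      rw [MvPolynomial.smul_monomial, smul_eq_mul, mul_one]
  rw [this, map_smul, φ_mon]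
  refine Submodule.smul_mem _ _ (F.B_mem_sp ?_)
  have := hs e (MvPolynomial.mem_support_iff.1 he)
  simpa [wt] using this

lemma sp_wt_mul {N M : ℕ} {x z : A} (hx : x ∈ F.sp {b | F.wt b ≤ N}) (hz : z ∈ F.sp {b | F.wt b ≤ M}) :
    x * z ∈ F.sp {b | F.wt b ≤ N + M} := by
  refine F.sp_mul ?_ hx hz
  rintro ⟨m, I⟩ hb ⟨m', J⟩ hb' hd
  simp only [Set.mem_ofPred_eq] at *
  rw [F.wt_add _ _ _ _ hd]; omega

lemma ds_bounded {n : ℕ} (hV : F.Van n) (T : Finset (X ⊕ Y)) :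
    ∃ N, ∀ z, F.ds z ∈ F.IT T → ∃ w ∈ F.sp {b | F.wt b ≤ N}, ∃ u, z - w - F.ds u ∈ F.IT T := by
  obtain ⟨N0, hN0⟩ := F.KI_split hV T
  obtain ⟨G, hG1, hG2⟩ := F.exists_gens ((F.IT T).comap F.ds) (by
    intro s z hz
    rw [Submodule.mem_comap, ds_φ_mul]
    exact F.IT_mul_right hz)
  choose M hM using fun x => F.exists_wt_bound x
  refine ⟨N0 + G.sup M, fun z hz => ?_⟩
  obtain ⟨s, rfl⟩ := hG2 z hz
  choose s0 h1 h2 using hN0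
  have h3 : ∀ g, ∃ u, g ∈ G → F.φ (s g - s0 (s g)) * g - F.ds u ∈ F.IT T := by
    intro g
    by_cases hg : g ∈ G
    · obtain ⟨u, hu⟩ := h2 (s g) g (hG1 g hg)
      exact ⟨u, fun _ => hu⟩
    · exact ⟨0, fun h => absurd h hg⟩
  choose u hu using h3
  refine ⟨∑ g ∈ G, F.φ (s0 (s g)) * g, ?_, ∑ g ∈ G, u g, ?_⟩
  · refine Submodule.sum_mem _ fun g hg => ?_
    refine F.sp_wt_mul (F.φ_wt (h1 _)) (F.sp_mono ?_ (hM g))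
    intro b hb
    exact le_trans hb (Finset.le_sup (f := M) hg)
  · rw [map_sum, ← Finset.sum_sub_distrib, ← Finset.sum_sub_distrib]
    refine Submodule.sum_mem _ fun g hg => ?_
    have := hu g hg
    rwa [map_sub, sub_mul] at this

lemma IT_pr {T : Finset (X ⊕ Y)} (s : Set (Idx X Y)) {x : A} (hx : x ∈ F.IT T) : F.pr s x ∈ F.IT T :=
  F.pr_mem_of_mem s hx

/-- cohomology of quotients is bounded -/
theorem bounded {n : ℕ} (hV : F.Van n) {T : Finset (X ⊕ Y)} (hT : F.Low T) :
    ∃ N, ∀ m, N < m → ∀ z ∈ F.Gr m, F.d z ∈ F.IT T → ∃ u, z - F.d u ∈ F.IT T := by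
  obtain ⟨N, hN⟩ := F.ds_bounded hV T
  refine ⟨N, fun m hm => ?_⟩
  have key : ∀ k l, l + k = Fintype.card Y + 1 → ∀ z ∈ F.Gr m, z ∈ F.YG l → F.d z ∈ F.IT T →
      ∃ u, z - F.d u ∈ F.IT T := by
    intro k
    induction k with
    | zero =>
      intro l hl z _ hz _
      have : z = 0 := F.mem_sp_zero hz (by
        intro b hb
        have : b.2.card ≤ Fintype.card Y := Finset.card_le_univ _
        simp only [Set.mem_ofPred_eq] at hb
        omega)
      exact ⟨0, by simp [this]⟩
    | succ k ih =>
      intro l hl z hzm hz hd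
      set zl := F.pr {b | b.2.card = l} z with hzl
      have h1 : zl ∈ F.YL l := F.pr_mem _ _
      have h2 : z - zl ∈ F.YG (l + 1) := by
        refine F.sp_mono ?_ (F.mem_sp_inter (F.pr_sub_mem {b | b.2.card = l} z)
          (Submodule.sub_mem _ hz (F.YL_le l h1)))
        rintro b ⟨hb1, hb2⟩
        simp only [Set.mem_compl_iff, Set.mem_ofPred_eq] at *
        omega
      have h3 : F.ds zl ∈ F.IT T := by
        have e1 : F.d z - F.ds zl ∈ F.YG l := by
          have a1 := F.YG_mono (Nat.le_succ l) (F.d_sub_ds (F.YL_le l h1))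
          have a2 := F.d_YG h2
          have : F.d z - F.ds zl = (F.d zl - F.ds zl) + F.d (z - zl) := by rw [map_sub]; abel
          rw [this]
          exact Submodule.add_mem _ a1 a2
        have e2 : F.pr {b | b.2.card + 1 = l} (F.d z - F.ds zl) = 0 := F.pr_eq_zero e1 (by
          intro b hb hb'
          simp only [Set.mem_ofPred_eq] at *
          omega)
        rw [map_sub, F.pr_eq_self (F.ds_YL h1), sub_eq_zero] at e2
        rw [← e2]
        exact F.IT_pr _ hd
      obtain ⟨w, hw, u, hu⟩ := hN zl h3
      obtain ⟨m', rfl⟩ : ∃ m', m = m' + 1 := ⟨m - 1, by omega⟩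
      have h4 : zl ∈ F.Gr (m' + 1) := F.pr_mem_of_mem _ hzm
      -- project
      have h5 := F.IT_pr {b | b.2.card = l} (F.IT_pr {b | F.wt b = m' + 1} hu)
      change F.pr _ (F.pw (m' + 1) _) ∈ _ at h5
      have h6 : F.pw (m' + 1) w = 0 := F.pr_eq_zero hw (by
        intro b hb hb'
        simp only [Set.mem_ofPred_eq] at *
        omega)
      rw [map_sub (F.pw (m' + 1)), map_sub (F.pw (m' + 1)), h6, sub_zero, F.pw_self h4, ← ds_pw, map_sub, F.pr_eq_self h1, pr_ds] at h5
      set u' := F.pr {b | b.2.card = l + 1} (F.pw m' u)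
      set i := zl - F.ds u' with hi
      have hu'm : u' ∈ F.Gr m' := F.pr_mem_of_mem _ (F.pw_mem _ _)
      have hu'Y : u' ∈ F.YG l := F.YG_mono (Nat.le_succ l) (F.YL_le (l + 1) (F.pr_mem _ _))
      have e : z - F.d u' - i = (z - zl) - (F.d u' - F.ds u') := by rw [hi]; abel
      obtain ⟨v, hv⟩ := ih (l + 1) (by omega) (z - F.d u' - i) (by
          refine Submodule.sub_mem _ (Submodule.sub_mem _ hzm (F.d_Gr hu'm)) ?_
          exact Submodule.sub_mem _ h4 (F.ds_Gr hu'm))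
        (by rw [e]; exact Submodule.sub_mem _ h2 (F.d_sub_ds hu'Y))
        (by
          rw [map_sub, map_sub, F.d_sq, sub_zero]
          exact Submodule.sub_mem _ hd (F.d_IT hT h5))
      refine ⟨u' + v, ?_⟩
      have e3 : z - F.d (u' + v) = (z - F.d u' - i - F.d v) + i := by rw [map_add]; abel
      rw [e3]
      exact Submodule.add_mem _ hv h5
  intro z hz hd
  exact key (Fintype.card Y + 1) 0 (by omega) z hz (F.sp_mono (fun _ _ => Nat.zero_le _) (F.mem_univ_sp z)) hd

end FA

namespace FA

variable {X Y A : Type} [Fintype X] [DecidableEq X] [Fintype Y] [DecidableEq Y]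
    [Ring A] [Algebra ℚ A] (F : FA X Y A)

def VT (T : Finset (X ⊕ Y)) (n : ℤ) : Prop :=
  ∀ m : ℕ, n < m → ∀ z ∈ F.Gr m, F.d z ∈ F.IT T → ∃ u, z - F.d u ∈ F.IT T

lemma VT.hom {T : Finset (X ⊕ Y)} {n : ℤ} (h : F.VT T n) {m : ℕ} (hm : n < m) {z : A} (hz : z ∈ F.Gr m)
    (hd : F.d z ∈ F.IT T) : ∃ u, (m = 0 → u = 0) ∧ (∀ k, k + 1 = m → u ∈ F.Gr k) ∧ z - F.d u ∈ F.IT T := by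
  obtain ⟨u, hu⟩ := h m hm z hz hd
  have h2 : F.pw m (z - F.d u) ∈ F.IT T := F.IT_pr _ hu
  rw [map_sub, F.pw_self hz] at h2
  cases m with
  | zero =>
    refine ⟨0, fun _ => rfl, fun k hk => by omega, ?_⟩
    rw [F.pw_zero_d, sub_zero] at h2
    simpa using h2
  | succ k =>
    refine ⟨F.pw k u, fun h => by omega, fun k' hk' => ?_, ?_⟩
    · have : k' = k := by omega
      subst this; exact F.pw_mem _ _
    · rwa [d_pw]

lemma VT_even {T : Finset (X ⊕ Y)} {n : ℤ} {i : X} (hT : F.Low T) (hv : F.MinLive T (Sum.inl i)) (h : F.VT T n) :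
    F.VT (insert (Sum.inl i) T) (n + (F.a i - 1)) := by
  intro m hm z hz hd
  set x := F.gen (Sum.inl i) with hx
  have hdx : F.d x ∈ F.IT T := F.d_gen_IT hv.2
  have hxτ : F.τ x = x := by rw [hx, τ_gen]; simp [sn]
  obtain ⟨q, hq, w, hw, -, hqw⟩ := F.IT_insert hd (F.d_Gr hz)
  rw [← hx] at hqw
  have hqw2 : ∀ b ∈ ({b | Disjoint (gi (Sum.inl i : X ⊕ Y)).2 b.2 ∧
      ((gi (Sum.inl i : X ⊕ Y)).1 + b.1, (gi (Sum.inl i : X ⊕ Y)).2 ∪ b.2) ∈ {b | F.wt b = m + 1}} : Set (Idx X Y)),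
      F.a i + F.wt b = m + 1 := by
    rintro b ⟨h1, h2⟩
    simp only [Set.mem_ofPred_eq] at h2
    rw [F.wt_add _ _ _ _ h1] at h2
    have := F.wt_gi (Sum.inl i : X ⊕ Y)
    rw [show F.wt ((gi (Sum.inl i : X ⊕ Y)).1, (gi (Sum.inl i : X ⊕ Y)).2) = F.deg (Sum.inl i) from this] at h2
    exact h2
  have hdq : F.d q ∈ F.IT T := by
    refine F.regular_even hv.1 ?_
    rw [← hx]
    have e := F.d_sq z
    rw [hqw, map_add, F.leib, hxτ] at e
    have e2 : x * F.d q = - (F.d x * q) - F.d w := by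
      rw [eq_sub_iff_add_eq, eq_neg_iff_add_eq_zero, ← e]; abel
    rw [e2]
    exact Submodule.sub_mem _ (Submodule.neg_mem _ (F.IT_mul_left hdx)) (F.d_IT hT hw)
  obtain ⟨p, hp1, hp2⟩ : ∃ p, x * p ∈ F.Gr m ∧ q - F.d p ∈ F.IT T := by
    by_cases hle : F.a i ≤ m + 1
    · obtain ⟨k, hk⟩ : ∃ k, F.a i + k = m + 1 := ⟨m + 1 - F.a i, by omega⟩
      have hqk : q ∈ F.Gr k := F.sp_mono (fun b hb => by
        have := hqw2 b hb
        simp only [Set.mem_ofPred_eq]; omega) hq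
      obtain ⟨p, h1, h2, h3⟩ := VT.hom F h (m := k) (by omega) hqk hdq
      refine ⟨p, ?_, h3⟩
      cases k with
      | zero => rw [h1 rfl, mul_zero]; exact Submodule.zero_mem _
      | succ k =>
        have := F.Gr_mul (F.gen_Gr (Sum.inl i)) (h2 k rfl)
        have e : F.deg (Sum.inl i : X ⊕ Y) + k = m := by simp only [deg]; omega
        rwa [e] at this
    · refine ⟨0, by rw [mul_zero]; exact Submodule.zero_mem _, ?_⟩
      have : q = 0 := F.mem_sp_zero hq (fun b hb => by have := hqw2 b hb; omega)
      rw [this]; simp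
  obtain ⟨u, hu⟩ := h m (by have := F.a_pos i; omega) (z - x * p) (Submodule.sub_mem _ hz hp1) (by
    have : F.d (z - x * p) = x * (q - F.d p) + w - F.d x * p := by
      rw [map_sub, hqw, F.leib, hxτ, mul_sub]; abel
    rw [this]
    exact Submodule.sub_mem _ (Submodule.add_mem _ (F.IT_mul_right hp2) hw) (F.IT_mul_left hdx))
  refine ⟨u, ?_⟩
  have : z - F.d u = x * p + (z - x * p - F.d u) := by abel
  rw [this]
  exact Submodule.add_mem _ (F.IT_mul_left (F.gen_mem_IT (Finset.mem_insert_self _ _)))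
    (F.IT_mono (Finset.subset_insert _ _) hu)

lemma gen_odd_sq (j : Y) : F.gen (Sum.inr j) * F.gen (Sum.inr j : X ⊕ Y) = 0 := by
  have hτ : F.τ (F.gen (Sum.inr j)) = - F.gen (Sum.inr j : X ⊕ Y) := by rw [τ_gen]; simp [sn]
  have h := F.comm_odd hτ (F.gen (Sum.inr j))
  rw [hτ, neg_mul] at h
  have h2 : (2 : ℚ) • (F.gen (Sum.inr j) * F.gen (Sum.inr j : X ⊕ Y)) = 0 := by
    rw [two_smul]; nth_rewrite 1 [h]; exact neg_add_cancel _
  exact (smul_eq_zero.1 h2).resolve_left two_ne_zero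

lemma odd_mul_IT {T : Finset (X ⊕ Y)} {j : Y} {x : A} (hx : x ∈ F.IT (insert (Sum.inr j) T)) :
    F.gen (Sum.inr j) * x ∈ F.IT T := by
  obtain ⟨z, -, w, hw, -, rfl⟩ := F.IT_insert hx (F.mem_univ_sp x)
  rw [mul_add, ← mul_assoc, gen_odd_sq, zero_mul, zero_add]
  exact F.IT_mul_right hw

lemma VT_odd {n0 : ℕ} (hV : F.Van n0) {T : Finset (X ⊕ Y)} {n : ℤ} {j : Y} (hT : F.Low T)
    (hv : F.MinLive T (Sum.inr j)) (h : F.VT T n) : F.VT (insert (Sum.inr j) T) (n - F.c j) := by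
  have hT' := F.Low_insert hT hv
  obtain ⟨N, hN⟩ := F.bounded hV hT'
  set y := F.gen (Sum.inr j) with hy
  have hdy : F.d y ∈ F.IT T := F.d_gen_IT hv.2
  have hyτ : F.τ y = -y := by rw [hy, τ_gen]; simp [sn]
  have hsub : F.IT T ≤ F.IT (insert (Sum.inr j) T) := F.IT_mono (Finset.subset_insert _ _)
  have hc := F.c_pos j
  suffices key : ∀ k m : ℕ, N < m + k → n - F.c j < m → ∀ z ∈ F.Gr m, F.d z ∈ F.IT (insert (Sum.inr j) T) →
      ∃ u, z - F.d u ∈ F.IT (insert (Sum.inr j) T) from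
    fun m hm => key (N + 1) m (by omega) hm
  intro k
  induction k with
  | zero => intro m hm _; exact hN m hm
  | succ k ih =>
    intro m hm hm2 z hz hd
    have h1 : F.d (y * z) ∈ F.IT T := by
      rw [F.leib, hyτ, neg_mul]
      exact Submodule.add_mem _ (F.IT_mul_left hdy) (Submodule.neg_mem _ (F.odd_mul_IT hd))
    obtain ⟨q, -, hq1, hq2⟩ := VT.hom F h (m := F.c j + m) (by push_cast; omega) (F.Gr_mul (F.gen_Gr (Sum.inr j)) hz) h1
    have hq1 := hq1 (F.c j + m - 1) (by omega)
    have hyT : y * z ∈ F.IT (insert (Sum.inr j) T) := F.IT_mul_left (F.gen_mem_IT (Finset.mem_insert_self _ _))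
    have hdq : F.d q ∈ F.IT (insert (Sum.inr j) T) := by
      have : F.d q = y * z - (y * z - F.d q) := by abel
      rw [this]
      exact Submodule.sub_mem _ hyT (hsub hq2)
    obtain ⟨p, hp⟩ := ih (F.c j + m - 1) (by omega) (by omega) q hq1 hdq
    obtain ⟨s, -, w, hw, -, hsw⟩ := F.IT_insert hp (F.mem_univ_sp _)
    rw [← hy] at hsw
    have hdq2 : F.d q = F.d y * s - y * F.d s + F.d w := by
      have := congrArg F.d hsw
      rw [map_sub, F.d_sq, sub_zero, map_add, F.leib, hyτ, neg_mul, ← sub_eq_add_neg] at this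
      exact this
    refine ⟨-s, F.regular_odd hv.1 ?_⟩
    rw [← hy]
    have : y * (z - F.d (-s)) = (y * z - F.d q) + (F.d y * s + F.d w) := by
      rw [hdq2, map_neg, sub_neg_eq_add, mul_add]; abel
    rw [this]
    exact Submodule.add_mem _ hq2 (Submodule.add_mem _ (F.IT_mul_left hdy) (F.d_IT hT hw))

def sh : X ⊕ Y → ℤ
  | Sum.inl i => -((F.a i : ℤ) - 1)
  | Sum.inr j => F.c j

/-- formal dimension bound -/
theorem fdim {n : ℕ} (hV : F.Van n) : ∑ j, (F.c j : ℤ) - ∑ i, ((F.a i : ℤ) - 1) ≤ n := by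
  have key := F.low_induction (P := fun T => F.VT T ((n : ℤ) - ∑ v ∈ T, F.sh v)) (by
      intro m hm z hz hd
      rw [IT_empty] at *
      simp at hm hd
      obtain ⟨u, hu⟩ := hV m hm z hz hd
      exact ⟨u, by rw [hu, sub_self]; exact Submodule.zero_mem _⟩)
    (by
      intro T v hT hv h
      rw [Finset.sum_insert hv.1]
      cases v with
      | inl i =>
        have := F.VT_even hT hv h
        convert this using 1
        simp only [sh]; ring
      | inr j =>
        have := F.VT_odd hV hT hv h
        convert this using 1
        simp only [sh]; ring) Finset.univ F.Low_univ
  by_contra hcon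
  push Not at hcon
  have hsum : ∑ v : X ⊕ Y, F.sh v = ∑ j, (F.c j : ℤ) - ∑ i, ((F.a i : ℤ) - 1) := by
    rw [Fintype.sum_sum_type]
    simp only [sh, Finset.sum_neg_distrib]
    ring
  have h1 : (1 : A) ∈ F.Gr 0 := by rw [← F.B_one]; exact F.B_mem_sp (by simp [wt])
  have hd1 : F.d 1 = 0 := F.d_one
  obtain ⟨u, hu1, -, hu⟩ := VT.hom F key (m := 0) (by rw [hsum, Nat.cast_zero]; omega) h1 (by
    rw [hd1]; exact Submodule.zero_mem _)
  rw [hu1 rfl, map_zero, sub_zero, IT_univ_L] at hu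
  exact F.one_not_mem_L1 hu

end FA

lemma le_two_rpow_sub_one (x : ℝ) (hx : 2 ≤ x) : x ≤ 2 ^ (x - 1) := by
  have h := one_add_mul_self_le_rpow_one_add (s := 1) (by norm_num) (p := x - 1) (by linarith)
  norm_num at h
  linarith

lemma num_step (r : ℝ) (a β : ℝ) (hr : 0 < r) (ha : r ≤ a) (h : 2 * a ≤ β) :
    β ≤ 2 ^ ((β - a) / r) * a := by
  have ha0 : 0 < a := lt_of_lt_of_le hr ha
  have h1 := le_two_rpow_sub_one (β / a) (by rw [le_div_iff₀ ha0]; exact h)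
  have h2 : (2:ℝ) ^ (β / a - 1) ≤ 2 ^ ((β - a) / r) := by
    apply Real.rpow_le_rpow_of_exponent_le (by norm_num)
    have : β / a - 1 = (β - a) / a := by field_simp
    rw [this]
    apply div_le_div_of_nonneg_left _ hr ha
    linarith
  have := h1.trans h2
  rwa [div_le_iff₀ ha0] at this

lemma num_list {X Y : Type} (r : ℝ) (hr : 0 < r) (a : X → ℝ) (β : Y → ℝ) (Lx : List X) (L1 : List Y)
    (h : List.Forall₂ (fun i j => r ≤ a i ∧ 2 * a i ≤ β j) Lx L1) :
    (L1.map β).prod ≤ 2 ^ (((L1.map β).sum - (Lx.map a).sum) / r) * (Lx.map a).prod := by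
  induction h with
  | nil => simp
  | @cons i j l1 l2 hij hrest ih =>
    have hpos : 0 ≤ (l1.map a).prod := by
      clear ih
      induction hrest with
      | nil => simp
      | @cons i' j' l1' l2' hij' _ ih' =>
        rw [List.map_cons, List.prod_cons]
        exact mul_nonneg (hr.le.trans hij'.1) ih'
    simp only [List.map_cons, List.prod_cons, List.sum_cons]
    have h1 := num_step r (a i) (β j) hr hij.1 hij.2
    have ha : 0 < a i := lt_of_lt_of_le hr hij.1
    have e : (β j + (l2.map β).sum - (a i + (l1.map a).sum)) / r
      = (β j - a i) / r + ((l2.map β).sum - (l1.map a).sum) / r := by ring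
    rw [e, Real.rpow_add (by norm_num)]
    have h0 : 0 ≤ β j := by linarith [hij.2]
    have h3 : 0 ≤ 2 ^ ((β j - a i) / r) * a i := by positivity
    calc _ ≤ β j * (2 ^ (((l2.map β).sum - (l1.map a).sum) / r) * (l1.map a).prod) :=
          mul_le_mul_of_nonneg_left ih h0
      _ ≤ (2 ^ ((β j - a i) / r) * a i) * (2 ^ (((l2.map β).sum - (l1.map a).sum) / r) * (l1.map a).prod) := by
          refine mul_le_mul_of_nonneg_right h1 ?_
          positivity
      _ = _ := by ring

lemma num_list2 {Y : Type} (r : ℝ) (hr : 0 < r) (c : Y → ℝ) (L : List Y)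
    (h : ∀ j ∈ L, r ≤ c j) : (2:ℝ) ^ L.length ≤ 2 ^ ((L.map c).sum / r) := by
  induction L with
  | nil => simp
  | cons j l ih =>
    simp only [List.map_cons, List.sum_cons, List.length_cons, add_div]
    rw [Real.rpow_add (by norm_num), pow_succ, mul_comm]
    have h1 : (2:ℝ) ≤ 2 ^ (c j / r) := by
      conv_lhs => rw [← Real.rpow_one 2]
      apply Real.rpow_le_rpow_of_exponent_le (by norm_num)
      rw [le_div_iff₀ hr]; simpa using h j (by simp)
    exact mul_le_mul h1 (ih fun j hj => h j (by simp [hj])) (by positivity) (by positivity)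

lemma exists_sorted {X : Type} [Fintype X] [DecidableEq X] (a : X → ℕ) : ∃ L : List X,
    L.Nodup ∧ (∀ x, x ∈ L) ∧ L.Pairwise (fun j i => a i ≤ a j) := by
  let R : X → X → Prop := fun j i => a i ≤ a j
  haveI : Std.Total R := ⟨fun x y => le_total _ _⟩
  haveI : IsTrans X R := ⟨fun x y z h h' => le_trans h' h⟩
  haveI : DecidableRel R := fun x y => inferInstanceAs (Decidable (a y ≤ a x))
  refine ⟨List.insertionSort R Finset.univ.toList, ?_, ?_, ?_⟩
  · exact (List.perm_insertionSort R _).nodup_iff.2 (Finset.nodup_toList _)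
  · intro x; rw [List.mem_insertionSort]; simp
  · exact List.pairwise_insertionSort R _

namespace FA
variable {X Y A : Type} [Fintype X] [DecidableEq X] [Fintype Y] [DecidableEq Y]
    [Ring A] [Algebra ℚ A] (F : FA X Y A)

lemma FH_list {n : ℕ} (hV : F.Van n) (Lx : List X) (L1 L2 : List Y)
    (hx : Lx.Nodup) (hx' : Lx.Pairwise (fun j i => F.a i ≤ F.a j)) (hl : L1.length = Lx.length)
    (hy : ∀ j, j ∈ L1 ++ L2) (hy' : (L1 ++ L2).Pairwise (fun j i => F.c i ≤ F.c j)) :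
    List.Forall₂ (fun i j => 2 * F.a i ≤ F.c j + 1) Lx L1 := by
  rw [List.forall₂_iff_get]
  refine ⟨hl.symm, fun k h1 h2 => ?_⟩
  by_contra hcon
  have hF := F.FH hV (F.a (Lx.get ⟨k, h1⟩))
  have hA : (Lx.take (k+1)).toFinset ⊆ Finset.univ.filter fun i => F.a (Lx.get ⟨k, h1⟩) ≤ F.a i := by
    intro i hi
    rw [List.mem_toFinset, List.mem_take_iff_getElem] at hi
    obtain ⟨s, hs, rfl⟩ := hi
    simp only [Finset.mem_filter, Finset.mem_univ, true_and, List.get_eq_getElem]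
    rcases Nat.lt_or_ge s k with h | h
    · exact (List.pairwise_iff_getElem.1 hx') s k (by omega) h1 h
    · have : s = k := by omega
      subst this; exact le_rfl
  have hB : (Finset.univ.filter fun j => 2 * F.a (Lx.get ⟨k, h1⟩) ≤ F.c j + 1) ⊆ (L1.take k).toFinset := by
    intro j hj
    simp only [Finset.mem_filter, Finset.mem_univ, true_and] at hj
    rw [List.mem_toFinset, List.mem_take_iff_getElem]
    obtain ⟨s, hs, rfl⟩ := List.mem_iff_getElem.1 (hy j)
    have hk : (L1 ++ L2)[k]'(by simp; omega) = L1[k] := List.getElem_append_left h2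
    have hsk : s < k := by
      by_contra hsk
      apply hcon
      refine hj.trans ?_
      simp only [List.get_eq_getElem]
      rw [← hk]
      rcases Nat.lt_or_ge k s with h | h
      · have := (List.pairwise_iff_getElem.1 hy') k s (by simp; omega) hs h
        omega
      · have : s = k := by omega
        subst this; exact le_rfl
    exact ⟨s, by omega, (List.getElem_append_left (by omega)).symm⟩
  have h3 := Finset.card_le_card hA
  have h4 := Finset.card_le_card hB
  rw [List.toFinset_card_of_nodup (hx.sublist (List.take_sublist _ _))] at h3
  have h5 := (L1.take k).toFinset_card_le
  simp only [List.length_take] at h3 h5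
  omega

theorem main {n : ℕ} (hV : F.Van n) (r : ℕ) (hr : 1 ≤ r) (ha : ∀ i, r ≤ F.a i) (hc : ∀ j, r ≤ F.c j) :
    ∃ k : ℕ, (k : ℝ) ≤ 2 ^ ((n : ℝ) / r) ∧ HB (LinearMap.ker F.d) (LinearMap.range F.d) k := by
  obtain ⟨L, hLn, hLm, hLs⟩ := exists_sorted F.c
  obtain ⟨Lx, hxn, hxm, hxs⟩ := exists_sorted F.a
  have hxl : Lx.length = Fintype.card X := by
    rw [← List.toFinset_card_of_nodup hxn, ← Finset.card_univ]; congr 1; ext; simp [hxm]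
  obtain ⟨L1, L2, h, hl, I', hG⟩ := good_exists (m := mm X) F.f (Fintype.card X) L ⊥ hLn
    (fun j _ => F.f_mem_mm j) bot_le (by
      have := Dp_IX (X := X) (Fintype.card X) ∅ (by simp)
      rwa [IX_empty] at this) (by
      refine (F.mm_le_radical hV).trans (Ideal.radical_mono (Ideal.span_le.2 ?_))
      rintro _ ⟨j, rfl⟩
      exact Ideal.mem_sup_right (Ideal.subset_span ⟨j, hLm j, rfl⟩))
  subst h
  have hFo := F.FH_list hV Lx L1 L2 hxn hxs (hl.trans hxl.symm) hLm hLs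
  rw [List.pairwise_append] at hLs
  have hLn' := List.nodup_append.1 hLn
  obtain ⟨D, hD1, hD2⟩ := F.colength (T := L2.toFinset) L1 I' hLs.1
    (fun j hj i hi => hLs.2.2 j hj i (by simpa using hi)) hG hl
  have hU : L1.toFinset ∪ L2.toFinset = Finset.univ := by
    ext j; simpa using hLm j
  have key := F.spectral (k := fun l => L2.toFinset.card.choose l * D) (fun l => by
    have := F.good_HB L1 ⊥ I' hLn'.1 (fun j hj hj' => hLn'.2.2 j hj j (by simpa using hj') rfl) hG
      (F.baseA (I := I') hD2 L2.toFinset l)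
    rwa [hU] at this)
  refine ⟨_, ?_, key⟩
  have hcY : L2.toFinset.card ≤ Fintype.card Y := Finset.card_le_univ _
  have hsum : ∑ l ∈ Finset.range (Fintype.card Y + 1), L2.toFinset.card.choose l * D = 2 ^ L2.length * D := by
    rw [← Finset.sum_mul]
    congr 1
    rw [← List.toFinset_card_of_nodup hLn'.2.1, ← Nat.sum_range_choose]
    symm
    apply Finset.sum_subset
    · intro x; simp; omega
    · intro x _ hx
      apply Nat.choose_eq_zero_of_lt
      simpa using hx
  rw [hsum]
  have hr0 : (0:ℝ) < r := by exact_mod_cast hr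
  have hP : ∏ i, (F.a i : ℝ) = (Lx.map fun i => (F.a i : ℝ)).prod := by
    rw [← List.prod_toFinset _ hxn]; congr 1; ext; simp [hxm]
  have hS : ∑ i, (F.a i : ℝ) = (Lx.map fun i => (F.a i : ℝ)).sum := by
    rw [← List.sum_toFinset _ hxn]; congr 1; ext; simp [hxm]
  have hPpos : 0 < ∏ i, (F.a i : ℝ) := Finset.prod_pos fun i _ => by
    have := F.a_pos i; positivity
  have hN := num_list (r : ℝ) hr0 (fun i => (F.a i : ℝ)) (fun j => ((F.c j + 1 : ℕ) : ℝ)) Lx L1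
    (hFo.imp fun i j hij => ⟨by exact_mod_cast ha i, by exact_mod_cast hij⟩)
  have hDle : (D : ℝ) ≤ 2 ^ (((L1.map fun j => ((F.c j + 1 : ℕ) : ℝ)).sum - (Lx.map fun i => (F.a i : ℝ)).sum) / (r:ℝ)) := by
    rw [← hP] at hN
    exact le_of_mul_le_mul_right (hD1.trans hN) hPpos
  have hL2 := num_list2 (r : ℝ) hr0 (fun j => (F.c j : ℝ)) L2 (fun j _ => by exact_mod_cast hc j)
  push_cast
  refine (mul_le_mul hL2 hDle (by positivity) (by positivity)).trans ?_
  rw [← Real.rpow_add (by norm_num)]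
  apply Real.rpow_le_rpow_of_exponent_le (by norm_num)
  rw [← add_div]
  apply div_le_div_of_nonneg_right _ hr0.le
  have hfd := F.fdim hV
  have hfd' : ∑ j, (F.c j : ℝ) - ∑ i, ((F.a i : ℝ) - 1) ≤ n := by exact_mod_cast hfd
  have hcs : ∑ j, (F.c j : ℝ) = (L1.map fun j => (F.c j : ℝ)).sum + (L2.map fun j => (F.c j : ℝ)).sum := by
    rw [← List.sum_append, ← List.map_append, ← List.sum_toFinset _ hLn]; congr 1; ext j; simpa using hLm j
  have hb : (L1.map fun j => ((F.c j + 1 : ℕ) : ℝ)).sum = (L1.map fun j => (F.c j : ℝ)).sum + Fintype.card X := by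
    rw [← hl]; push_cast; rw [List.sum_map_add]; simp
  rw [Finset.sum_sub_distrib] at hfd'
  simp only [Finset.sum_const, Finset.card_univ, nsmul_eq_mul, mul_one] at hfd'
  rw [hb, ← hS]
  linarith
end FA

structure Dat (A : CDGA) (ι : Type) [Fintype ι] [lo : LinearOrder ι] where
  deg : ι → ℤ
  g : ι → A.carrier
  hg : ∀ x, g x ∈ A.grading (deg x)
  h2 : ∀ x, 2 ≤ deg x
  hli : LinearIndependent ℚ (fun e : {e : ι →₀ ℕ // ∀ x : ι, Odd (deg x) → e x ≤ 1} =>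
        monomialIn lo g e.1)
  hsp : ⊤ ≤ Submodule.span ℚ
      (Set.range fun e : {e : ι →₀ ℕ // ∀ x : ι, Odd (deg x) → e x ≤ 1} =>
        monomialIn lo g e.1)
  hdec : ∀ x, A.d (g x) ∈ A.decomposables

namespace Dat
variable {A : CDGA} {ι : Type} [Fintype ι] [lo : LinearOrder ι] (D : Dat A ι)

abbrev Xt := {x : ι // Even (D.deg x)}
abbrev Yt := {x : ι // ¬ Even (D.deg x)}

lemma central {i : ℤ} (hi : Even i) {a : A.carrier} (ha : a ∈ A.grading i) (x : A.carrier) :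
    a * x = x * a := by
  have hx : x ∈ ⨆ j, A.grading j := by
    rw [A.internal.submodule_iSup_eq_top]; trivial
  induction hx using Submodule.iSup_induction' with
  | mem j x hx =>
    rw [A.gcomm ha hx, Even.neg_one_zpow (hi.mul_right j), one_smul]
  | zero => simp
  | add x y _ _ h1 h2 => rw [mul_add, add_mul, h1, h2]

lemma odd_anti {x y : ι} (hx : ¬ Even (D.deg x)) (hy : ¬ Even (D.deg y)) :
    D.g x * D.g y = (-1 : ℚ) • (D.g y * D.g x) := by
  rw [A.gcomm (D.hg x) (D.hg y), Odd.neg_one_zpow]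
  rw [Int.not_even_iff_odd] at hx hy
  exact hx.mul hy

lemma odd_sq {x : ι} (hx : ¬ Even (D.deg x)) : D.g x * D.g x = 0 := by
  have h := D.odd_anti hx hx
  rw [neg_one_smul, eq_neg_iff_add_eq_zero, ← two_smul ℚ] at h
  simpa using h

noncomputable def φ : MvPolynomial D.Xt ℚ →ₐ[ℚ] A.carrier :=
  (Subalgebra.center ℚ A.carrier).val.comp
    (MvPolynomial.aeval fun i : D.Xt => (⟨D.g i, by
      rw [Subalgebra.mem_center_iff]
      exact fun b => (central i.2 (D.hg i) b).symm⟩ : Subalgebra.center ℚ A.carrier))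

lemma φ_X (i : D.Xt) : D.φ (MvPolynomial.X i) = D.g i := by simp [φ]

lemma φ_central (s : MvPolynomial D.Xt ℚ) (x : A.carrier) : D.φ s * x = x * D.φ s := by
  have := (MvPolynomial.aeval (fun i : D.Xt => (⟨D.g i, by
      rw [Subalgebra.mem_center_iff]
      exact fun b => (central i.2 (D.hg i) b).symm⟩ : Subalgebra.center ℚ A.carrier)) s).2
  rw [Subalgebra.mem_center_iff] at this
  exact (this x).symm

/-- product of odd generators in a list -/
def yl (l : List D.Yt) : A.carrier := (l.map fun j : D.Yt => D.g j.1).prod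

lemma yl_append (l l' : List D.Yt) : D.yl (l ++ l') = D.yl l * D.yl l' := by simp [yl]
lemma yl_cons (j) (l : List D.Yt) : D.yl (j :: l) = D.g j * D.yl l := by simp [yl]

lemma yl_perm {l l' : List D.Yt} (h : l.Perm l') : ∃ s : ℚ, s * s = 1 ∧ D.yl l = s • D.yl l' := by
  induction h with
  | nil => exact ⟨1, by simp, by simp⟩
  | cons j _ ih =>
    obtain ⟨s, h1, h2⟩ := ih
    exact ⟨s, h1, by rw [yl_cons, yl_cons, h2, mul_smul_comm]⟩
  | swap i j l =>
    refine ⟨-1, by norm_num, ?_⟩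
    rw [yl_cons, yl_cons, yl_cons, yl_cons, ← mul_assoc, ← mul_assoc, D.odd_anti j.2 i.2, smul_mul_assoc]
  | trans _ _ ih1 ih2 =>
    obtain ⟨s, h1, h2⟩ := ih1
    obtain ⟨t, h3, h4⟩ := ih2
    refine ⟨s * t, ?_, by rw [h2, h4, smul_smul]⟩
    calc s * t * (s * t) = (s * s) * (t * t) := by ring
      _ = 1 := by rw [h1, h3, one_mul]

lemma yl_dup {l : List D.Yt} (j) (l') (h : l.Perm (j :: j :: l')) : D.yl l = 0 := by
  obtain ⟨s, -, h2⟩ := D.yl_perm h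
  rw [h2, yl_cons, yl_cons, ← mul_assoc, D.odd_sq j.2]; simp

lemma yl_mem (l : List D.Yt) : D.yl l ∈ A.grading (l.map fun j : D.Yt => D.deg j.1).sum := by
  induction l with
  | nil => simpa [yl] using A.one_mem
  | cons j l ih => rw [yl_cons]; simpa using A.mul_mem (D.hg j) ih

def y (I : Finset D.Yt) : A.carrier := D.yl (I.sort (· ≤ ·))

def a (i : D.Xt) : ℕ := (D.deg i).toNat
def c (j : D.Yt) : ℕ := (D.deg j).toNat

lemma a_cast (i : D.Xt) : (D.a i : ℤ) = D.deg i := Int.toNat_of_nonneg (by have := D.h2 i; omega)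
lemma c_cast (i : D.Yt) : (D.c i : ℤ) = D.deg i := Int.toNat_of_nonneg (by have := D.h2 i; omega)

lemma y_mem (I : Finset D.Yt) : D.y I ∈ A.grading ((∑ j ∈ I, D.c j : ℕ) : ℤ) := by
  have := D.yl_mem (I.sort (· ≤ ·))
  rw [← List.sum_toFinset _ (Finset.sort_nodup _ _), Finset.sort_toFinset] at this
  push_cast
  simpa [c_cast, y] using this

lemma pow_mem {i : ℤ} {x : A.carrier} (hx : x ∈ A.grading i) (k : ℕ) : x ^ k ∈ A.grading (k * i) := by
  induction k with
  | zero => simpa using A.one_mem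
  | succ k ih => rw [pow_succ]; convert A.mul_mem ih hx using 2; push_cast; ring

lemma monomial_mem (m : D.Xt →₀ ℕ) : D.φ (MvPolynomial.monomial m 1) ∈
    A.grading ((∑ i, m i * D.a i : ℕ) : ℤ) := by
  have key : ∀ s : Finset D.Xt, D.φ (∏ i ∈ s, MvPolynomial.X i ^ m i) ∈
      A.grading ((∑ i ∈ s, m i * D.a i : ℕ) : ℤ) := by
    intro s
    induction s using Finset.induction_on with
    | empty => simpa using A.one_mem
    | insert i s hi ih =>
      rw [Finset.prod_insert hi, Finset.sum_insert hi, map_mul, map_pow, φ_X]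
      push_cast
      rw [a_cast]
      exact A.mul_mem (pow_mem (D.hg i) _) (by exact_mod_cast ih)
  have := key Finset.univ
  rwa [show ∏ i, MvPolynomial.X i ^ m i = (MvPolynomial.monomial m 1 : MvPolynomial D.Xt ℚ) by
    rw [MvPolynomial.monomial_eq, map_one, one_mul, Finsupp.prod_fintype]; simp] at this

lemma sort_filter (p : ι → Prop) [DecidablePred p] (S : Finset ι) :
    (S.sort (· ≤ ·)).filter p = ((S.subtype p).sort (· ≤ ·)).map Subtype.val := by
  apply List.Perm.eq_of_pairwise (le := (· ≤ ·))
  · intro a b _ _ h1 h2; exact le_antisymm h1 h2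
  · exact (Finset.pairwise_sort _ _).filter _
  · rw [List.pairwise_map]; exact (Finset.pairwise_sort _ _)
  · rw [List.perm_ext_iff_of_nodup]
    · intro x; simp; tauto
    · exact (Finset.sort_nodup _ _).filter _
    · exact (Finset.sort_nodup _ _).map Subtype.val_injective

lemma prod_split (e : ι → ℕ) (l : List ι) : (l.map fun x => D.g x ^ e x).prod =
    ((l.filter fun x => Even (D.deg x)).map fun x => D.g x ^ e x).prod *
    ((l.filter fun x => ¬ Even (D.deg x)).map fun x => D.g x ^ e x).prod := by
  induction l with
  | nil => simp
  | cons x l ih =>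
    by_cases h : Even (D.deg x)
    · simp only [List.map_cons, List.prod_cons, ih, h, List.filter_cons]
      simp [mul_assoc]
    · have hc : ∀ l : List ι, ∀ z, z * ((l.filter fun x => Even (D.deg x)).map fun x => D.g x ^ e x).prod
        = ((l.filter fun x => Even (D.deg x)).map fun x => D.g x ^ e x).prod * z := by
        intro l z
        induction l with
        | nil => simp
        | cons x l ih =>
          by_cases h : Even (D.deg x)
          · simp only [List.filter_cons, h, decide_true, if_true, List.map_cons, List.prod_cons]
            rw [mul_assoc, ← ih, ← mul_assoc, ← mul_assoc]
            congr 1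
            have := central (i := e x * D.deg x) (h.mul_left _) (pow_mem (D.hg x) (e x)) z
            exact this.symm
          · simpa only [List.filter_cons, h, decide_false, if_false, Bool.false_eq_true] using ih
      simp only [List.map_cons, List.prod_cons, ih, h, List.filter_cons]
      simp only [decide_false, Bool.false_eq_true, if_false, not_false_eq_true, decide_true, if_true,
        List.map_cons, List.prod_cons]
      rw [← mul_assoc, ← mul_assoc, hc]

lemma monomialIn_eq (e : ι →₀ ℕ) (he : ∀ x, Odd (D.deg x) → e x ≤ 1) (m : D.Xt →₀ ℕ) (I : Finset D.Yt)
    (h1 : ∀ i, m i = e i.1) (h2 : ∀ j, j ∈ I ↔ e j.1 = 1) :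
    monomialIn lo D.g e = D.φ (MvPolynomial.monomial m 1) * D.y I := by
  rw [monomialIn, prod_split, sort_filter, sort_filter]
  congr 1
  · rw [List.map_map]
    have : ((Function.comp (fun x => D.g x ^ e x) Subtype.val) : D.Xt → A.carrier) =
      D.φ ∘ (fun i : D.Xt => MvPolynomial.X i ^ m i) := by
      ext i; simp [φ_X, h1]
    rw [this, ← List.map_map, ← map_list_prod, ← List.prod_toFinset _ (Finset.sort_nodup _ _), Finset.sort_toFinset]
    congr 1
    rw [MvPolynomial.monomial_eq, map_one, one_mul, Finsupp.prod]
    congr 1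
    ext i; simp [h1]
  · rw [List.map_map, y, yl]
    have : Finset.subtype (fun x => ¬ Even (D.deg x)) e.support = I := by
      ext j
      have := he j.1 (Int.not_even_iff_odd.1 j.2)
      simp [h2]; omega
    rw [this]
    congr 1
    apply List.map_congr_left
    intro j hj
    rw [Finset.mem_sort, h2] at hj
    simp [hj]

noncomputable def eqv : {e : ι →₀ ℕ // ∀ x : ι, Odd (D.deg x) → e x ≤ 1} ≃ Idx D.Xt D.Yt where
  toFun e := (Finsupp.equivFunOnFinite.symm fun i => e.1 i.1, Finset.univ.filter fun j => e.1 j.1 = 1)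
  invFun b := ⟨Finsupp.equivFunOnFinite.symm fun x => if h : Even (D.deg x) then b.1 ⟨x, h⟩ else
    if (⟨x, h⟩ : D.Yt) ∈ b.2 then 1 else 0, by
      intro x hx
      rw [← Int.not_even_iff_odd] at hx
      simp [hx]; split_ifs <;> simp⟩
  left_inv e := by
    ext x
    by_cases h : Even (D.deg x)
    · simp [h]
    · have := e.2 x (Int.not_even_iff_odd.1 h)
      simp only [Finset.mem_filter, Finset.mem_univ, true_and, Finsupp.coe_equivFunOnFinite_symm, h, dite_false]
      split_ifs <;> omega
  right_inv b := by
    ext i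
    · simp [i.2]
    · have := i.2
      simp [this]

noncomputable def B : Module.Basis (Idx D.Xt D.Yt) ℚ A.carrier :=
  (Module.Basis.mk D.hli D.hsp).reindex D.eqv

lemma B_eq (m I) : D.B (m, I) = D.φ (MvPolynomial.monomial m 1) * D.y I := by
  rw [B, Module.Basis.reindex_apply, Module.Basis.mk_apply]
  set e := D.eqv.symm (m, I) with he
  have h : D.eqv e = (m, I) := by simp [he]
  refine D.monomialIn_eq e.1 e.2 m I (fun i => ?_) (fun j => ?_)
  · have := congrArg (fun b => b.1 i) h; simpa [eqv] using this.symm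
  · have := congrArg (fun b => j ∈ b.2) h; simpa [eqv] using this.symm
end Dat

namespace Dat
variable {A : CDGA} {ι : Type} [Fintype ι] [lo : LinearOrder ι] (D : Dat A ι)

def w (b : Idx D.Xt D.Yt) : ℕ := ∑ i, b.1 i * D.a i + ∑ j ∈ b.2, D.c j

lemma B_mem (b : Idx D.Xt D.Yt) : D.B b ∈ A.grading (D.w b : ℤ) := by
  obtain ⟨m, I⟩ := b
  rw [B_eq, w]
  push_cast
  exact_mod_cast A.mul_mem (D.monomial_mem m) (D.y_mem I)

lemma grading_le (k : ℤ) : A.grading k ≤ Submodule.span ℚ (D.B '' {b | (D.w b : ℤ) = k}) := by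
  intro x hx
  classical
  have h0 := D.B.linearCombination_repr x
  rw [Finsupp.linearCombination_apply, Finsupp.sum,
    ← Finset.sum_filter_add_sum_filter_not _ (fun b => (D.w b : ℤ) = k)] at h0
  set x1 := ∑ b ∈ (D.B.repr x).support.filter (fun b => (D.w b : ℤ) = k), (D.B.repr x) b • D.B b
  set x2 := ∑ b ∈ (D.B.repr x).support.filter (fun b => ¬ (D.w b : ℤ) = k), (D.B.repr x) b • D.B b
  have h1 : x1 ∈ Submodule.span ℚ (D.B '' {b | (D.w b : ℤ) = k}) := by
    refine Submodule.sum_mem _ fun b hb => Submodule.smul_mem _ _ (Submodule.subset_span ⟨b, ?_, rfl⟩)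
    exact (Finset.mem_filter.1 hb).2
  have h1' : x1 ∈ A.grading k := by
    refine Submodule.sum_mem _ fun b hb => Submodule.smul_mem _ _ ?_
    have := (Finset.mem_filter.1 hb).2
    rw [← this]; exact D.B_mem b
  have h2 : x2 ∈ ⨆ j, ⨆ (_ : j ≠ k), A.grading j := by
    refine Submodule.sum_mem _ fun b hb => Submodule.smul_mem _ _ ?_
    have := (Finset.mem_filter.1 hb).2
    exact Submodule.mem_iSup_of_mem _ (Submodule.mem_iSup_of_mem this (D.B_mem b))
  have h3 : x2 ∈ A.grading k := by
    have : x2 = x - x1 := by rw [← h0]; abel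
    rw [this]; exact Submodule.sub_mem _ hx h1'
  have h4 : x2 = 0 := by
    have := (A.internal.submodule_iSupIndep k)
    exact Submodule.disjoint_def.1 this _ h3 h2
  rw [← h0, h4, add_zero]; exact h1

lemma w_parity (b : Idx D.Xt D.Yt) : (-1 : ℚ) ^ (D.w b) = (-1) ^ b.2.card := by
  rw [w, pow_add, Even.neg_one_pow, one_mul, ← Finset.prod_pow_eq_pow_sum]
  · rw [← Finset.prod_const]
    refine Finset.prod_congr rfl fun j _ => ?_
    apply Odd.neg_one_pow
    have h := j.2
    rw [← D.c_cast, Int.not_even_iff_odd] at h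
    exact_mod_cast h
  · refine Finset.even_sum _ fun i _ => Even.mul_left ?_ _
    have h := i.2
    rw [← D.a_cast] at h
    exact_mod_cast h

noncomputable def τl : A.carrier →ₗ[ℚ] A.carrier :=
  D.B.constr ℚ (fun b => (-1 : ℚ) ^ b.2.card • D.B b)

lemma τl_B (b) : D.τl (D.B b) = (-1 : ℚ) ^ b.2.card • D.B b := by simp [τl]

lemma τl_mem {k : ℤ} {x : A.carrier} (hx : x ∈ A.grading k) : D.τl x = (-1 : ℚ) ^ k • x := by
  refine Submodule.span_induction ?_ ?_ ?_ ?_ (D.grading_le k hx)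
  · rintro _ ⟨b, hb, rfl⟩
    rw [Set.mem_ofPred_eq] at hb
    rw [τl_B, ← w_parity, ← hb, zpow_natCast]
  · simp
  · intro x y _ _ h1 h2; rw [map_add, h1, h2, smul_add]
  · intro q x _ h; rw [map_smul, h, smul_comm]

noncomputable def τ : A.carrier →ₐ[ℚ] A.carrier :=
  AlgHom.ofLinearMap D.τl (by simpa using D.τl_mem A.one_mem) (by
    have : (LinearMap.mul ℚ A.carrier).compr₂ D.τl =
      (LinearMap.mul ℚ A.carrier).compl₁₂ D.τl D.τl := by
      refine D.B.ext fun b => D.B.ext fun b' => ?_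
      simp only [LinearMap.compr₂_apply, LinearMap.mul_apply', LinearMap.compl₁₂_apply]
      rw [D.τl_mem (A.mul_mem (D.B_mem b) (D.B_mem b')), D.τl_mem (D.B_mem b), D.τl_mem (D.B_mem b'),
        zpow_add₀ (by norm_num), smul_mul_smul_comm]
    intro x z
    simpa using LinearMap.congr_fun₂ this x z)

lemma y_ne (I) : D.y I ≠ 0 := by
  have h := D.B_eq 0 I
  have h2 := D.B.ne_zero (0, I)
  intro h3
  rw [h, h3, mul_zero] at h2
  exact h2 rfl

lemma y_mul_disj {I J : Finset D.Yt} (h : Disjoint I J) :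
    ∃ s : ℚ, s * s = 1 ∧ D.y I * D.y J = s • D.y (I ∪ J) := by
  rw [y, y, ← yl_append]
  refine D.yl_perm ?_
  rw [List.perm_ext_iff_of_nodup]
  · intro x; simp
  · rw [List.nodup_append]
    refine ⟨Finset.sort_nodup _ _, Finset.sort_nodup _ _, ?_⟩
    rintro a ha b hb rfl
    simp only [Finset.mem_sort] at ha hb
    exact Finset.disjoint_left.1 h ha hb
  · exact Finset.sort_nodup _ _

lemma y_mul_ndisj {I J : Finset D.Yt} (h : ¬ Disjoint I J) : D.y I * D.y J = 0 := by
  rw [Finset.not_disjoint_iff] at h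
  obtain ⟨j, h1, h2⟩ := h
  rw [y, y, ← yl_append]
  have p1 := List.perm_cons_erase (a := j) (l := I.sort (· ≤ ·)) (by simpa using h1)
  have p2 := List.perm_cons_erase (a := j) (l := J.sort (· ≤ ·)) (by simpa using h2)
  refine D.yl_dup j ((I.sort (· ≤ ·)).erase j ++ (J.sort (· ≤ ·)).erase j) ((p1.append p2).trans ?_)
  rw [List.cons_append]
  exact List.Perm.cons _ List.perm_middle

open Classical in
noncomputable def sg (I J : Finset D.Yt) : ℚ :=
  if h : Disjoint I J then (D.y_mul_disj h).choose else 0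

lemma sg_disj {I J : Finset D.Yt} (h : Disjoint I J) : D.sg I J * D.sg I J = 1 := by
  rw [sg, dif_pos h]; exact (D.y_mul_disj h).choose_spec.1

lemma sg_ndisj {I J : Finset D.Yt} (h : ¬ Disjoint I J) : D.sg I J = 0 := by
  rw [sg, dif_neg h]

lemma y_mul (I J : Finset D.Yt) : D.y I * D.y J = D.sg I J • D.y (I ∪ J) := by
  by_cases h : Disjoint I J
  · rw [sg, dif_pos h]; exact (D.y_mul_disj h).choose_spec.2
  · rw [sg, dif_neg h, D.y_mul_ndisj h, zero_smul]

lemma c_odd (j : D.Yt) : Odd (D.c j) := by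
  have h := j.2
  rw [← D.c_cast, Int.not_even_iff_odd] at h
  exact_mod_cast h

lemma odd_sum (I : Finset D.Yt) : ∃ t, (∑ j ∈ I, D.c j) = I.card + 2 * t := by
  choose f hf using fun j => D.c_odd j
  refine ⟨∑ j ∈ I, f j, ?_⟩
  rw [Finset.sum_congr rfl fun j _ => hf j, Finset.sum_add_distrib, ← Finset.mul_sum]
  simp; ring

lemma sg_comm (I J : Finset D.Yt) : D.sg I J = (-1 : ℚ) ^ (I.card * J.card) * D.sg J I := by
  have h := A.gcomm (D.y_mem I) (D.y_mem J)
  rw [y_mul, y_mul, Finset.union_comm J I, smul_smul] at h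
  have h2 := smul_left_injective ℚ (D.y_ne (I ∪ J)) h
  rw [h2]
  congr 1
  rw [← Nat.cast_mul, zpow_natCast]
  obtain ⟨s, hs⟩ := D.odd_sum I
  obtain ⟨t, ht⟩ := D.odd_sum J
  rw [hs, ht]
  rw [show (I.card + 2 * s) * (J.card + 2 * t) = I.card * J.card + 2 * (I.card * t + s * J.card + 2 * s * t) by ring,
    pow_add, pow_mul (-1 : ℚ) 2]
  simp

def ln (b : Idx D.Xt D.Yt) : ℕ := (∑ i, b.1 i) + b.2.card

lemma B_mul (b b' : Idx D.Xt D.Yt) :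
    D.B b * D.B b' = D.sg b.2 b'.2 • D.B (b.1 + b'.1, b.2 ∪ b'.2) := by
  obtain ⟨m, I⟩ := b
  obtain ⟨m', J⟩ := b'
  rw [B_eq, B_eq, B_eq, mul_assoc, ← mul_assoc (D.y I), ← D.φ_central, mul_assoc, y_mul, ← mul_assoc,
    ← map_mul, MvPolynomial.monomial_mul, one_mul, mul_smul_comm]

lemma ln_pos {b : Idx D.Xt D.Yt} (h : 0 < D.w b) : 1 ≤ D.ln b := by
  by_contra hc
  have h0 : D.ln b = 0 := by omega
  rw [ln] at h0
  have h1 : (∑ i, b.1 i) = 0 := by omega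
  have h2 : b.2 = ∅ := by rw [← Finset.card_eq_zero]; omega
  rw [Finset.sum_eq_zero_iff] at h1
  rw [w, h2, Finset.sum_eq_zero (fun i hi => by rw [h1 i hi, zero_mul])] at h
  simp at h

lemma dec_le : A.decomposables ≤ Submodule.span ℚ (D.B '' {b | 2 ≤ D.ln b}) := by
  rw [CDGA.decomposables, Submodule.span_le]
  rintro _ ⟨x, ⟨i, hi, hx⟩, z, ⟨j, hj, hz⟩, rfl⟩
  rw [SetLike.mem_coe]
  refine Submodule.span_induction ?_ ?_ ?_ ?_ (D.grading_le i hx)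
  · rintro _ ⟨b, hb, rfl⟩
    refine Submodule.span_induction ?_ ?_ ?_ ?_ (D.grading_le j hz)
    · rintro _ ⟨b', hb', rfl⟩
      rw [Set.mem_ofPred_eq] at hb hb'
      rw [B_mul]
      by_cases hd : Disjoint b.2 b'.2
      · refine Submodule.smul_mem _ _ (Submodule.subset_span ⟨_, ?_, rfl⟩)
        have h1 := D.ln_pos (b := b) (by omega)
        have h2 := D.ln_pos (b := b') (by omega)
        rw [Set.mem_ofPred_eq]
        simp only [ln, Finsupp.add_apply, Finset.sum_add_distrib, Finset.card_union_of_disjoint hd] at *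
        omega
      · rw [D.sg_ndisj hd, zero_smul]; exact Submodule.zero_mem _
    · simp
    · intro x y _ _ h1 h2; rw [mul_add]; exact Submodule.add_mem _ h1 h2
    · intro q x _ h; rw [mul_smul_comm]; exact Submodule.smul_mem _ _ h
  · simp
  · intro x y _ _ h1 h2; rw [add_mul]; exact Submodule.add_mem _ h1 h2
  · intro q x _ h; rw [smul_mul_assoc]; exact Submodule.smul_mem _ _ h

noncomputable def toFA : FA D.Xt D.Yt A.carrier where
  a := D.a
  c := D.c
  a_even i := by
    have h := i.2
    rw [← D.a_cast] at h
    exact_mod_cast h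
  a_pos i := by have := D.h2 i; rw [← D.a_cast] at this; exact_mod_cast this
  c_odd := D.c_odd
  c_pos i := by have := D.h2 i; rw [← D.c_cast] at this; exact_mod_cast this
  φ := D.φ
  φ_central := D.φ_central
  y := D.y
  y_empty := by simp [y, yl]
  sg := D.sg
  y_mul := D.y_mul
  sg_disj _ _ h := D.sg_disj h
  sg_ndisj _ _ h := D.sg_ndisj h
  sg_comm := D.sg_comm
  B := D.B
  B_eq := D.B_eq
  τ := D.τ
  τ_B m I := D.τl_B (m, I)
  d := A.d
  d_sq := A.d_sq
  leib x z := by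
    have : (LinearMap.mul ℚ A.carrier).compr₂ A.d =
      (LinearMap.mul ℚ A.carrier).compl₁₂ A.d LinearMap.id +
      (LinearMap.mul ℚ A.carrier).compl₁₂ D.τl A.d := by
      refine D.B.ext fun b => LinearMap.ext fun z => ?_
      simp only [LinearMap.compr₂_apply, LinearMap.mul_apply', LinearMap.compl₁₂_apply, LinearMap.add_apply,
        LinearMap.id_apply]
      rw [A.leibniz (D.B_mem b), D.τl_mem (D.B_mem b), smul_mul_assoc]
    exact LinearMap.congr_fun₂ this x z
  d_wt b := by
    have h := D.grading_le _ (A.d_mem (D.B_mem b))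
    refine Submodule.span_mono (Set.image_mono ?_) h
    intro b' hb'
    rw [Set.mem_ofPred_eq] at hb' ⊢
    simp only [w] at hb'
    exact_mod_cast hb'
  minX i := by
    rw [D.B_eq, y, Finset.sort_empty, yl, List.map_nil, List.prod_nil, mul_one,
      show MvPolynomial.monomial (Finsupp.single i 1) (1 : ℚ) = MvPolynomial.X i from rfl, φ_X]
    exact D.dec_le (D.hdec i)
  minY j := by
    rw [D.B_eq, y, Finset.sort_singleton, yl, List.map_singleton, List.prod_singleton,
      show MvPolynomial.monomial (0 : D.Xt →₀ ℕ) (1 : ℚ) = 1 from rfl, map_one, one_mul]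
    exact D.dec_le (D.hdec j)

lemma van (n : ℕ) (hn' : ∀ m : ℤ, (n : ℤ) < m → A.Hpiece m = ⊥) : D.toFA.Van n := by
  intro m hm z hz hdz
  have hz' : z ∈ A.grading m := by
    refine (Submodule.span_le (p := A.grading m)).2 ?_ hz
    rintro _ ⟨b, hb, rfl⟩
    have h := D.B_mem b
    have hb' : D.w b = m := hb
    rw [hb'] at h; exact h
  have h := hn' m (by exact_mod_cast hm)
  rw [CDGA.Hpiece, ← le_bot_iff, Submodule.map_le_iff_le_comap, ← LinearMap.ker.eq_1] at h
  have h2 := h (show (⟨z, hdz⟩ : LinearMap.ker A.d) ∈ A.cocyclesAt m from hz')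
  rw [Submodule.ker_mkQ] at h2
  exact h2
end Dat

lemma HB_finrank (A : CDGA) (k : ℕ) (h : HB (LinearMap.ker A.d) (LinearMap.range A.d) k) :
    Module.finrank ℚ A.Hspace ≤ k := by
  obtain ⟨W, hW, hk, hle⟩ := h
  let f : A.Hspace →ₗ[ℚ] A.carrier ⧸ LinearMap.range A.d :=
    Submodule.mapQ _ _ (LinearMap.ker A.d).subtype le_rfl
  have hf : Function.Injective f := by
    rw [← LinearMap.ker_eq_bot, eq_bot_iff]
    intro x hx
    obtain ⟨x, rfl⟩ := Submodule.mkQ_surjective _ x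
    rw [LinearMap.mem_ker] at hx
    simp only [f, Submodule.mkQ_apply, Submodule.mapQ_apply, Submodule.Quotient.mk_eq_zero] at hx
    rw [Submodule.mem_bot, Submodule.mkQ_apply, Submodule.Quotient.mk_eq_zero]
    exact hx
  have hr : LinearMap.range f ≤ W.map (LinearMap.range A.d).mkQ := by
    rintro _ ⟨x, rfl⟩
    obtain ⟨x, rfl⟩ := Submodule.mkQ_surjective _ x
    obtain ⟨u, hu, v, hv, e⟩ := Submodule.mem_sup.1 (hle x.2)
    refine ⟨u, hu, ?_⟩
    simp only [f, Submodule.mkQ_apply, Submodule.mapQ_apply]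
    rw [Submodule.Quotient.eq]
    have : u - (LinearMap.ker A.d).subtype x = -v := by
      rw [Submodule.subtype_apply, ← e]; abel
    rw [this]; exact Submodule.neg_mem _ hv
  rw [← LinearMap.finrank_range_of_inj hf]
  exact (Submodule.finrank_mono hr).trans ((Submodule.finrank_map_le _ _).trans hk)

theorem finite_gen (A : SullivanAlgebra) (N : ℤ) (hN : ∀ i : ℤ, N ≤ i → A.V i = ⊥) {ι : Type}
    (deg : ι → ℤ) (g : ι → A.carrier) (h1 : ∀ x : ι, g x ∈ A.V (deg x)) (h0 : ∀ x, g x ≠ 0)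
    (hli : LinearIndependent ℚ g) : Finite ι := by
  have hlow : ∀ x, 1 < deg x := fun x => by
    by_contra h; push Not at h
    have := h1 x; rw [A.V_lower _ h] at this; exact h0 x (by simpa using this)
  have hup : ∀ x, deg x < N := fun x => by
    by_contra h; push Not at h
    have := h1 x; rw [hN _ h] at this; exact h0 x (by simpa using this)
  have hfin : ∀ i : ℤ, (deg ⁻¹' {i}).Finite := by
    intro i
    haveI := A.V_findim i
    have h : LinearIndependent ℚ (fun x : deg ⁻¹' {i} => (⟨g x.1, by
      have := h1 x.1
      rwa [show deg x.1 = i from x.2] at this⟩ : A.V i)) := by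
      refine LinearIndependent.of_comp (A.V i).subtype ?_
      exact hli.comp _ Subtype.val_injective
    exact (Set.finite_coe_iff.1 h.finite)
  have : (Set.univ : Set ι) = ⋃ i ∈ Set.Icc 1 N, deg ⁻¹' {i} := by
    ext x; simp; exact ⟨(hlow x).le, (hup x).le⟩
  rw [← Set.finite_univ_iff, this]
  exact (Set.finite_Icc 1 N).biUnion fun i _ => hfin i

/-- **Dimension bound for highly connected formal elliptic algebras** (from the
proof of Theorem 5.10): let `(ΛV, d)` be a formal elliptic minimal Sullivan
algebra with `V^i = 0` for all `i < r`, where `r ≥ 2`, and let `n` be its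
formal dimension (the largest degree in which the cohomology is nonzero).
Then `dim_ℚ H^*(ΛV, d) ≤ 2^(n/r)`. -/
theorem formal_elliptic_connected_dim_bound (A : SullivanAlgebra)
    (hmin : A.IsMinimal) (hell : A.Elliptic) (hformal : A.toCDGA.IsFormal)
    (r : ℕ) (hr : 2 ≤ r) (hconn : ∀ i : ℤ, i < (r : ℤ) → A.V i = ⊥)
    (n : ℤ) (hn : A.toCDGA.Hpiece n ≠ ⊥)
    (hn' : ∀ m : ℤ, n < m → A.toCDGA.Hpiece m = ⊥) :
    (Module.finrank ℚ A.toCDGA.Hspace : ℝ) ≤ (2 : ℝ) ^ ((n : ℝ) / (r : ℝ)) := by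
  obtain ⟨ι, lo, deg, g, h1, h2, hli, hsp⟩ := A.free
  obtain ⟨⟨N, hN⟩, -⟩ := hell
  have hs : ∀ x, monomialIn lo g (Finsupp.single x 1) = g x := by
    intro x
    simp [monomialIn, Finsupp.support_single]
  have hlg : LinearIndependent ℚ g := by
    have := hli.comp (fun x : ι => (⟨Finsupp.single x 1, fun z _ => by
      rw [Finsupp.single_apply]; split_ifs <;> simp⟩ : {e : ι →₀ ℕ // ∀ x : ι, Odd (deg x) → e x ≤ 1})) (by
        intro x z h
        have := congrArg Subtype.val h
        exact Finsupp.single_left_injective one_ne_zero this)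
    convert this using 1
    ext x; exact (hs x).symm
  have h0 := hlg.ne_zero
  haveI := finite_gen A N hN deg g h1 h0 hlg
  haveI := Fintype.ofFinite ι
  have hge : ∀ x, (r : ℤ) ≤ deg x := fun x => by
    by_contra h; push Not at h
    have := h1 x; rw [hconn _ h] at this; exact h0 x (by simpa using this)
  letI := lo
  let D : Dat A.toCDGA ι :=
    { deg := deg, g := g, hg := fun x => A.V_le _ (h1 x), h2 := fun x => by have := hge x; omega
      hli := hli, hsp := hsp, hdec := fun x => hmin _ _ (h1 x) }
  have hn0 : 0 ≤ n := by
    by_contra h; push Not at h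
    apply hn
    rw [CDGA.Hpiece, ← le_bot_iff, Submodule.map_le_iff_le_comap, ← LinearMap.ker.eq_1]
    intro z hz
    have hz' : z.1 ∈ A.grading n := hz
    rw [A.nonneg n h, Submodule.mem_bot] at hz'
    have : z = 0 := Subtype.ext hz'
    rw [this]; exact Submodule.zero_mem _
  lift n to ℕ using hn0
  obtain ⟨k, hk1, hk2⟩ := D.toFA.main (D.van n hn') r (by omega)
    (fun i => by have := hge i.1; have h := D.a_cast i; change (D.a i : ℤ) = deg i.1 at h; change r ≤ D.a i; omega)
    (fun i => by have := hge i.1; have h := D.c_cast i; change (D.c i : ℤ) = deg i.1 at h; change r ≤ D.c i; omega)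
  have := HB_finrank A.toCDGA k hk2
  rw [Int.cast_natCast]
  exact le_trans (Nat.cast_le.2 this) hk1
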